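/- Mahler's conjecture in dimension three, symmetric case (Iriyeh–Shibata): for every centrally symmetric convex body K in ℝ³ (K = −K), one has vol(K)·vol(K*) ≥ 4³/3! = 32/3. -/

import Mathlib

open MeasureTheory Filter
open scoped InnerProductSpace Pointwise NNReal ENNReal Topology

noncomputable section

/-- The polar of a set `K` in Euclidean space: `{y | ⟨x,y⟩ ≤ 1 for all x ∈ K}`. -/
def polarSet {n : ℕ} (K : Set (EuclideanSpace ℝ (Fin n))) : Set (EuclideanSpace ℝ (Fin n)) :=
  {y | ∀ x ∈ K, ⟪x, y⟫_ℝ ≤ 1}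

/-- A convex body: a compact convex set with nonempty interior. -/
structure IsConvexBody {n : ℕ} (K : Set (EuclideanSpace ℝ (Fin n))) : Prop where
  convex : Convex ℝ K
  isCompact : IsCompact K
  nonempty_interior : (interior K).Nonempty

namespace Mahler

section

/-! ### Ordered simplicial chains modulo two -/

/-- Chains with coefficients in `ZMod 2` on ordered `n`-tuples of points of `X`. -/
abbrev Chain (X : Type) (n : ℕ) : Type := (Fin n → X) →₀ ZMod 2

section Chain

variable {X : Type}

/-- The cone over a chain with apex `v`. -/
def cone (v : X) (n : ℕ) : Chain X n →ₗ[ZMod 2] Chain X (n + 1) :=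
  Finsupp.lmapDomain _ _ (fun σ => (Fin.cons v σ : Fin (n + 1) → X))

/-- The (augmented) boundary operator. -/
def bdry : (n : ℕ) → Chain X (n + 1) →ₗ[ZMod 2] Chain X n
  | 0 => Finsupp.lmapDomain _ _ Fin.tail
  | n + 1 => Finsupp.linearCombination _ fun σ =>
      Finsupp.single (Fin.tail σ) 1 + cone (σ 0) n (bdry n (Finsupp.single (Fin.tail σ) 1))

/-- The map on chains induced by a map of points. -/
def push (g : X → X) (n : ℕ) : Chain X n →ₗ[ZMod 2] Chain X n :=
  Finsupp.lmapDomain _ _ (fun σ => g ∘ σ)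

/-- The subdivision operator attached to a choice `β` of barycentres. -/
def sd (β : (n : ℕ) → (Fin (n + 1) → X) → X) : (n : ℕ) → Chain X n →ₗ[ZMod 2] Chain X n
  | 0 => LinearMap.id
  | n + 1 => Finsupp.linearCombination _ fun σ =>
      cone (β n σ) n (sd β n (bdry n (Finsupp.single σ 1)))

/-- The chain homotopy between the identity and the subdivision operator. -/
def sdHtpy (β : (n : ℕ) → (Fin (n + 1) → X) → X) :
    (n : ℕ) → Chain X n →ₗ[ZMod 2] Chain X (n + 1)
  | 0 => 0
  | n + 1 => Finsupp.linearCombination _ fun σ =>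
      cone (β n σ) (n + 1) (Finsupp.single σ 1 + sd β (n + 1) (Finsupp.single σ 1) +
        sdHtpy β n (bdry n (Finsupp.single σ 1)))

lemma cone_single (v : X) {n : ℕ} (σ : Fin n → X) :
    cone v n (Finsupp.single σ 1) = Finsupp.single (Fin.cons v σ : Fin (n + 1) → X) 1 := by
  simp [cone]

lemma push_single (g : X → X) {n : ℕ} (σ : Fin n → X) :
    push g n (Finsupp.single σ 1) = Finsupp.single (g ∘ σ) 1 := by
  simp [push]

lemma bdry_single (n : ℕ) (σ : Fin (n + 2) → X) :
    bdry (n + 1) (Finsupp.single σ 1) = Finsupp.single (Fin.tail σ) 1 +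
      cone (σ 0) n (bdry n (Finsupp.single (Fin.tail σ) 1)) := by
  simp [bdry]

lemma sd_single (β : (n : ℕ) → (Fin (n + 1) → X) → X) (n : ℕ) (σ : Fin (n + 1) → X) :
    sd β (n + 1) (Finsupp.single σ 1) =
      cone (β n σ) n (sd β n (bdry n (Finsupp.single σ 1))) := by
  simp [sd]

lemma sdHtpy_single (β : (n : ℕ) → (Fin (n + 1) → X) → X) (n : ℕ) (σ : Fin (n + 1) → X) :
    sdHtpy β (n + 1) (Finsupp.single σ 1) =
      cone (β n σ) (n + 1) (Finsupp.single σ 1 + sd β (n + 1) (Finsupp.single σ 1) +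
        sdHtpy β n (bdry n (Finsupp.single σ 1))) := by
  simp [sdHtpy]

lemma chain_hom_ext {n : ℕ} {M : Type} [AddCommGroup M] [Module (ZMod 2) M]
    {f g : Chain X n →ₗ[ZMod 2] M}
    (h : ∀ σ, f (Finsupp.single σ 1) = g (Finsupp.single σ 1)) : f = g :=
  Finsupp.lhom_ext' fun σ => LinearMap.ext_ring (by simpa using h σ)

lemma bdry_cone_zero (v : X) (c : Chain X 0) : bdry 0 (cone v 0 c) = c := by
  suffices (bdry 0).comp (cone v 0) = LinearMap.id from LinearMap.congr_fun this c
  refine chain_hom_ext fun σ => ?_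
  simp [cone_single, bdry]

lemma bdry_cone (v : X) (n : ℕ) (c : Chain X (n + 1)) :
    bdry (n + 1) (cone v (n + 1) c) = c + cone v n (bdry n c) := by
  suffices (bdry (n + 1)).comp (cone v (n + 1)) = LinearMap.id + (cone v n).comp (bdry n) from
    LinearMap.congr_fun this c
  refine chain_hom_ext fun σ => ?_
  simp [cone_single, bdry_single]

lemma bdry_bdry (n : ℕ) (c : Chain X (n + 2)) : bdry n (bdry (n + 1) c) = 0 := by
  suffices (bdry n).comp (bdry (n + 1)) = (0 : Chain X (n + 2) →ₗ[ZMod 2] Chain X n) from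
    LinearMap.congr_fun this c
  clear c
  induction n with
  | zero =>
    refine chain_hom_ext fun σ => ?_
    simp only [LinearMap.comp_apply, bdry_single, map_add, bdry_cone_zero, LinearMap.zero_apply]
    exact ZModModule.add_self _
  | succ n ih =>
    refine chain_hom_ext fun σ => ?_
    simp only [LinearMap.comp_apply, bdry_single n.succ, map_add, bdry_cone, LinearMap.zero_apply]
    have := LinearMap.congr_fun ih (Finsupp.single (Fin.tail σ) 1)
    simp only [LinearMap.comp_apply, LinearMap.zero_apply] at this
    rw [this, map_zero, add_zero]
    exact ZModModule.add_self _

variable (β : (n : ℕ) → (Fin (n + 1) → X) → X)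

lemma bdry_sd (n : ℕ) (c : Chain X (n + 1)) :
    bdry n (sd β (n + 1) c) = sd β n (bdry n c) := by
  suffices (bdry n).comp (sd β (n + 1)) = (sd β n).comp (bdry n) from
    LinearMap.congr_fun this c
  clear c
  induction n with
  | zero =>
    refine chain_hom_ext fun σ => ?_
    simp only [LinearMap.comp_apply, sd_single, bdry_cone_zero]
  | succ n ih =>
    refine chain_hom_ext fun σ => ?_
    simp only [LinearMap.comp_apply, sd_single β n.succ, bdry_cone]
    have := LinearMap.congr_fun ih (bdry (n + 1) (Finsupp.single σ 1))
    simp only [LinearMap.comp_apply, bdry_bdry, map_zero] at this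
    rw [this, map_zero, add_zero]

lemma bdry_sdHtpy (n : ℕ) (c : Chain X (n + 1)) :
    bdry (n + 1) (sdHtpy β (n + 1) c) + sdHtpy β n (bdry n c) = c + sd β (n + 1) c := by
  suffices (bdry (n + 1)).comp (sdHtpy β (n + 1)) + (sdHtpy β n).comp (bdry n) =
      LinearMap.id + sd β (n + 1) from LinearMap.congr_fun this c
  clear c
  induction n with
  | zero =>
    refine chain_hom_ext fun σ => ?_
    simp only [LinearMap.add_apply, LinearMap.comp_apply, sdHtpy_single, bdry_cone,
      LinearMap.id_apply]
    have h0 : ∀ c : Chain X 0, sdHtpy β 0 c = 0 := fun _ => rfl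
    have h2 : bdry 0 (Finsupp.single σ 1 + sd β 1 (Finsupp.single σ 1)) = 0 := by
      rw [map_add, bdry_sd]
      exact ZModModule.add_self _
    rw [h0, add_zero, add_zero, h2, map_zero, add_zero]
  | succ n ih =>
    refine chain_hom_ext fun σ => ?_
    have h := LinearMap.congr_fun ih (bdry (n + 1) (Finsupp.single σ 1))
    simp only [LinearMap.add_apply, LinearMap.comp_apply, bdry_bdry, map_zero, add_zero,
      LinearMap.id_apply] at h
    simp only [LinearMap.add_apply, LinearMap.comp_apply, sdHtpy_single β n.succ, bdry_cone,
      LinearMap.id_apply]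
    have h2 : bdry (n + 1) (Finsupp.single σ 1 + sd β (n + 2) (Finsupp.single σ 1) +
        sdHtpy β (n + 1) (bdry (n + 1) (Finsupp.single σ 1))) = 0 := by
      rw [map_add, map_add, h, bdry_sd]
      exact ZModModule.add_self _
    rw [h2, map_zero, add_zero]
    exact (add_assoc _ _ _).trans (by rw [ZModModule.add_self, add_zero])

variable {β} {g : X → X}

lemma push_cone (g : X → X) (v : X) (n : ℕ) (c : Chain X n) :
    push g (n + 1) (cone v n c) = cone (g v) n (push g n c) := by
  suffices (push g (n + 1)).comp (cone v n) = (cone (g v) n).comp (push g n) from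
    LinearMap.congr_fun this c
  refine chain_hom_ext fun σ => ?_
  simp only [LinearMap.comp_apply, cone_single, push_single]
  congr 1
  funext i
  refine Fin.cases ?_ (fun j => ?_) i <;> simp

lemma push_bdry (g : X → X) (n : ℕ) (c : Chain X (n + 1)) :
    push g n (bdry n c) = bdry n (push g (n + 1) c) := by
  suffices (push g n).comp (bdry n) = (bdry n).comp (push g (n + 1)) from
    LinearMap.congr_fun this c
  clear c
  induction n with
  | zero =>
    refine chain_hom_ext fun σ => ?_
    simp only [LinearMap.comp_apply, push_single, bdry, Finsupp.lmapDomain_apply,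
      Finsupp.mapDomain_single]
    congr 1
  | succ n ih =>
    refine chain_hom_ext fun σ => ?_
    have h := LinearMap.congr_fun ih (Finsupp.single (Fin.tail σ) 1)
    simp only [LinearMap.comp_apply] at h
    simp only [LinearMap.comp_apply, push_single, bdry_single, map_add, push_cone, h]
    rfl

lemma push_sd (hg : ∀ n σ, β n (g ∘ σ) = g (β n σ)) (n : ℕ) (c : Chain X n) :
    push g n (sd β n c) = sd β n (push g n c) := by
  suffices (push g n).comp (sd β n) = (sd β n).comp (push g n) from
    LinearMap.congr_fun this c
  clear c
  induction n with
  | zero => rfl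
  | succ n ih =>
    refine chain_hom_ext fun σ => ?_
    have h := LinearMap.congr_fun ih (bdry n (Finsupp.single σ 1))
    simp only [LinearMap.comp_apply] at h
    simp only [LinearMap.comp_apply, push_single, sd_single, push_cone, h, push_bdry, hg]

lemma push_sdHtpy (hg : ∀ n σ, β n (g ∘ σ) = g (β n σ)) (n : ℕ) (c : Chain X n) :
    push g (n + 1) (sdHtpy β n c) = sdHtpy β n (push g n c) := by
  suffices (push g (n + 1)).comp (sdHtpy β n) = (sdHtpy β n).comp (push g n) from
    LinearMap.congr_fun this c
  clear c
  induction n with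
  | zero => simp [sdHtpy]
  | succ n ih =>
    refine chain_hom_ext fun σ => ?_
    have h := LinearMap.congr_fun ih (bdry n (Finsupp.single σ 1))
    simp only [LinearMap.comp_apply] at h
    simp only [LinearMap.comp_apply, push_single, sdHtpy_single, push_cone, map_add,
      push_sd hg, h, push_bdry, hg]

/-- A functional which vanishes on boundaries and is invariant under two maps `t` and `r` takes
the same value on a relative cycle and on its subdivision, and the subdivision is again a relative
cycle. -/
lemma cocycle_sd {t r : X → X} (ht : ∀ n σ, β n (t ∘ σ) = t (β n σ))
    (hr : ∀ n σ, β n (r ∘ σ) = r (β n σ)) {n : ℕ} (N : Chain X (n + 1) →ₗ[ZMod 2] ZMod 2)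
    (hN : ∀ c, N (bdry (n + 1) c) = 0) (hNt : ∀ c, N (push t _ c) = N c)
    (hNr : ∀ c, N (push r _ c) = N c) {z : Chain X (n + 1)} {x y p : Chain X n}
    (hz : bdry n z = x + push t n x + (y + push r n y) + p) (hp : sd β n p = 0)
    (hNp : N (sdHtpy β n p) = 0) :
    N (sd β (n + 1) z) = N z ∧ ∃ x' y', bdry n (sd β (n + 1) z) =
      x' + push t n x' + (y' + push r n y') + 0 := by
  constructor
  · have h := congrArg N (bdry_sdHtpy β n z)
    rw [map_add, hN, hz] at h
    simp only [map_add, ← push_sdHtpy ht, ← push_sdHtpy hr, hNt, hNr, hNp,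
      CharTwo.add_self_eq_zero] at h
    exact (CharTwo.add_eq_zero.mp h.symm).symm
  · refine ⟨sd β n x, sd β n y, ?_⟩
    rw [bdry_sd, hz]
    simp only [map_add, push_sd ht, push_sd hr, hp]

lemma cocycle_sd_iterate {t r : X → X} (ht : ∀ n σ, β n (t ∘ σ) = t (β n σ))
    (hr : ∀ n σ, β n (r ∘ σ) = r (β n σ)) {n : ℕ} (N : Chain X (n + 1) →ₗ[ZMod 2] ZMod 2)
    (hN : ∀ c, N (bdry (n + 1) c) = 0) (hNt : ∀ c, N (push t _ c) = N c)
    (hNr : ∀ c, N (push r _ c) = N c) {z : Chain X (n + 1)} {x y p : Chain X n}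
    (hz : bdry n z = x + push t n x + (y + push r n y) + p) (hp : sd β n p = 0)
    (hNp : N (sdHtpy β n p) = 0) (k : ℕ) :
    N ((sd β (n + 1))^[k] z) = N z := by
  induction k generalizing z x y p with
  | zero => rfl
  | succ k ih =>
    obtain ⟨h, x', y', hz'⟩ := cocycle_sd ht hr N hN hNt hNr hz hp hNp
    rw [Function.iterate_succ_apply, ih hz' (map_zero _) (by simp), h]

end Chain

end

/-! ### A cocycle on eight labels in space -/

/-- Three-dimensional integer determinant. -/
def det3 (a b c : ℤ × ℤ × ℤ) : ℤ :=
  a.1 * (b.2.1 * c.2.2 - b.2.2 * c.2.1) - a.2.1 * (b.1 * c.2.2 - b.2.2 * c.1) +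
    a.2.2 * (b.1 * c.2.1 - b.2.1 * c.1)

/-- The eight labels, an orbit of the dihedral symmetry group. -/
def lab : Fin 8 → ℤ × ℤ × ℤ :=
  ![(1, 2, 1), (-1, -1, 2), (-1, 2, -1), (1, -2, -1), (1, -1, -2), (1, 1, 2), (-1, 1, -2),
    (-1, -2, 1)]

/-- Action of the first generator on labels. -/
def labT : Fin 8 → Fin 8 := ![1, 3, 5, 6, 2, 7, 0, 4]

/-- Action of the second generator on labels. -/
def labR : Fin 8 → Fin 8 := ![2, 4, 0, 7, 1, 6, 5, 3]

/-- Whether a generic ray lies in the cone spanned by three labels. -/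
def rayHit (a b c : Fin 8) : ZMod 2 :=
  let D := det3 (lab a) (lab b) (lab c)
  if 0 < det3 (3, 1, 7) (lab b) (lab c) * D ∧ 0 < det3 (lab a) (3, 1, 7) (lab c) * D ∧
    0 < det3 (lab a) (lab b) (3, 1, 7) * D then 1 else 0

/-- The coboundary of `rayHit`: whether the origin lies in the simplex spanned by four labels. -/
def originHit (a b c d : Fin 8) : ZMod 2 :=
  rayHit b c d + (rayHit a c d + (rayHit a b d + rayHit a b c))

/-- Geometric description of `originHit`. -/
def OriginIn (a b c d : Fin 8) : Prop :=
  (0 < det3 (lab b) (lab c) (lab d) ∧ det3 (lab a) (lab c) (lab d) < 0 ∧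
    0 < det3 (lab a) (lab b) (lab d) ∧ det3 (lab a) (lab b) (lab c) < 0) ∨
  (det3 (lab b) (lab c) (lab d) < 0 ∧ 0 < det3 (lab a) (lab c) (lab d) ∧
    det3 (lab a) (lab b) (lab d) < 0 ∧ 0 < det3 (lab a) (lab b) (lab c))

instance (a b c d : Fin 8) : Decidable (OriginIn a b c d) := by
  unfold OriginIn; infer_instance

set_option maxRecDepth 100000 in
lemma originHit_eq : ∀ a b c d : Fin 8,
    originHit a b c d = if OriginIn a b c d then 1 else 0 := by
  decide +kernel

lemma originHit_labT : ∀ a b c d : Fin 8,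
    originHit (labT a) (labT b) (labT c) (labT d) = originHit a b c d := by
  decide +kernel

lemma originHit_labR : ∀ a b c d : Fin 8,
    originHit (labR a) (labR b) (labR c) (labR d) = originHit a b c d := by
  decide +kernel

lemma originHit_swap12 : ∀ a b c d : Fin 8, originHit a c b d = originHit a b c d := by
  decide +kernel

lemma originHit_swap23 : ∀ a b c d : Fin 8, originHit a b d c = originHit a b c d := by
  decide +kernel

lemma originHit_join : ∀ g : Fin 8, ∑ d ∈ Finset.range 4,
    originHit g (labT g) (labT^[d] (labR g)) (labT^[d + 1] (labR g)) = 1 := by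
  decide +kernel

/-- The symmetry of space corresponding to `labT`. -/
def spT (F : ℝ × ℝ × ℝ) : ℝ × ℝ × ℝ := (-F.1, -F.2.2, F.2.1)

/-- The symmetry of space corresponding to `labR`. -/
def spR (F : ℝ × ℝ × ℝ) : ℝ × ℝ × ℝ := (-F.1, F.2.1, -F.2.2)

/-- Pairing of a label with a vector. -/
def labPair (i : Fin 8) (F : ℝ × ℝ × ℝ) : ℝ :=
  (lab i).1 * F.1 + ((lab i).2.1 * F.2.1 + (lab i).2.2 * F.2.2)

lemma labPair_labT (i : Fin 8) (F : ℝ × ℝ × ℝ) : labPair (labT i) (spT F) = labPair i F := by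
  fin_cases i <;> simp [labPair, labT, lab, spT] <;> ring

lemma labPair_labR (i : Fin 8) (F : ℝ × ℝ × ℝ) : labPair (labR i) (spR F) = labPair i F := by
  fin_cases i <;> simp [labPair, labR, lab, spR]

/-- Every nonzero vector is positively paired with some label. -/
lemma exists_labPair_pos (F : ℝ × ℝ × ℝ) : ∃ i, ‖F‖ ≤ 2 * labPair i F := by
  obtain ⟨b, p, q⟩ := F
  have hn : ‖(b, p, q)‖ ≤ |b| + (|p| + |q|) := by
    simp only [Prod.norm_def, Real.norm_eq_abs]
    have := abs_nonneg b; have := abs_nonneg p; have := abs_nonneg q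
    refine max_le (by linarith) (max_le (by linarith) (by linarith))
  by_contra! h
  have h' : ∀ i, 2 * labPair i (b, p, q) < |b| + (|p| + |q|) := fun i => (h i).trans_le hn
  simp only [labPair] at h'
  have h0 := h' 0; have h1 := h' 1; have h2 := h' 2; have h3 := h' 3
  have h4 := h' 4; have h5 := h' 5; have h6 := h' 6; have h7 := h' 7
  simp [lab] at h0 h1 h2 h3 h4 h5 h6 h7
  rcases abs_cases b with ⟨e1, _⟩ | ⟨e1, _⟩ <;> rcases abs_cases p with ⟨e2, _⟩ | ⟨e2, _⟩ <;>
    rcases abs_cases q with ⟨e3, _⟩ | ⟨e3, _⟩ <;> linarith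

/-- If the origin lies in the simplex spanned by four labels, no vector is positively paired with
all of them. -/
lemma originHit_eq_zero {a b c d : Fin 8} {F : ℝ × ℝ × ℝ} (ha : 0 < labPair a F)
    (hb : 0 < labPair b F) (hc : 0 < labPair c F) (hd : 0 < labPair d F) :
    originHit a b c d = 0 := by
  rw [originHit_eq, if_neg]
  have key : (det3 (lab b) (lab c) (lab d) : ℝ) * labPair a F
      - det3 (lab a) (lab c) (lab d) * labPair b F
      + det3 (lab a) (lab b) (lab d) * labPair c F
      - det3 (lab a) (lab b) (lab c) * labPair d F = 0 := by
    simp only [det3, labPair]; push_cast; ring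
  rintro (⟨h0, h1, h2, h3⟩ | ⟨h0, h1, h2, h3⟩)
  · have h0' : (0 : ℝ) < det3 (lab b) (lab c) (lab d) := by exact_mod_cast h0
    have h1' : (det3 (lab a) (lab c) (lab d) : ℝ) < 0 := by exact_mod_cast h1
    have h2' : (0 : ℝ) < det3 (lab a) (lab b) (lab d) := by exact_mod_cast h2
    have h3' : (det3 (lab a) (lab b) (lab c) : ℝ) < 0 := by exact_mod_cast h3
    linarith [mul_pos h0' ha, mul_pos (neg_pos.2 h1') hb, mul_pos h2' hc,
      mul_pos (neg_pos.2 h3') hd]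
  · have h0' : (det3 (lab b) (lab c) (lab d) : ℝ) < 0 := by exact_mod_cast h0
    have h1' : (0 : ℝ) < (det3 (lab a) (lab c) (lab d) : ℝ) := by exact_mod_cast h1
    have h2' : (det3 (lab a) (lab b) (lab d) : ℝ) < 0 := by exact_mod_cast h2
    have h3' : (0 : ℝ) < (det3 (lab a) (lab b) (lab c) : ℝ) := by exact_mod_cast h3
    linarith [mul_pos (neg_pos.2 h0') ha, mul_pos h1' hb, mul_pos (neg_pos.2 h2') hc,
      mul_pos h3' hd]

section

section LabelledChains

variable {X : Type}

/-- Counts modulo two the labelled triangles of a chain hit by a generic ray. -/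
def rayCount (f : X → Fin 8) : Chain X 3 →ₗ[ZMod 2] ZMod 2 :=
  Finsupp.linearCombination _ fun σ => rayHit (f (σ 0)) (f (σ 1)) (f (σ 2))

/-- Counts modulo two the labelled tetrahedra of a chain which contain the origin. -/
def originCount (f : X → Fin 8) : Chain X 4 →ₗ[ZMod 2] ZMod 2 :=
  (rayCount f).comp (bdry 3)

lemma single_bdry_one (a b : X) : bdry 1 (Finsupp.single ![a, b] 1 : Chain X 2) =
    Finsupp.single ![b] 1 + Finsupp.single ![a] 1 := by
  rw [bdry_single]
  congr 1
  simp only [bdry, Finsupp.lmapDomain_apply, Finsupp.mapDomain_single, cone_single]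
  congr 1

lemma single_bdry_two (a b c : X) : bdry 2 (Finsupp.single ![a, b, c] 1 : Chain X 3) =
    Finsupp.single ![b, c] 1 + (Finsupp.single ![a, c] 1 + Finsupp.single ![a, b] 1) := by
  rw [bdry_single]
  change Finsupp.single ![b, c] 1 + cone a 1 (bdry 1 (Finsupp.single ![b, c] 1)) = _
  rw [single_bdry_one, map_add, cone_single, cone_single]
  rfl

lemma single_bdry_three (a b c d : X) : bdry 3 (Finsupp.single ![a, b, c, d] 1 : Chain X 4) =
    Finsupp.single ![b, c, d] 1 + (Finsupp.single ![a, c, d] 1 +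
      (Finsupp.single ![a, b, d] 1 + Finsupp.single ![a, b, c] 1)) := by
  rw [bdry_single]
  change Finsupp.single ![b, c, d] 1 + cone a 2 (bdry 2 (Finsupp.single ![b, c, d] 1)) = _
  rw [single_bdry_two, map_add, map_add, cone_single, cone_single, cone_single]
  rfl

lemma vec_eta_four (σ : Fin 4 → X) : ![σ 0, σ 1, σ 2, σ 3] = σ := by
  funext i; fin_cases i <;> rfl

lemma originCount_single (f : X → Fin 8) (σ : Fin 4 → X) :
    originCount f (Finsupp.single σ 1) =
      originHit (f (σ 0)) (f (σ 1)) (f (σ 2)) (f (σ 3)) := by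
  conv_lhs => rw [← vec_eta_four σ]
  simp [originCount, single_bdry_three, rayCount, originHit]

lemma originCount_cone (f : X → Fin 8) (g a b c : X) :
    originCount f (cone g 3 (Finsupp.single ![a, b, c] 1)) =
      originHit (f g) (f a) (f b) (f c) := by
  rw [cone_single]
  exact originCount_single f _

lemma originCount_cone_cone (f : X → Fin 8) (g m a b : X) :
    originCount f (cone g 3 (cone m 2 (Finsupp.single ![a, b] 1))) =
      originHit (f g) (f m) (f a) (f b) := by
  rw [cone_single]
  exact originCount_cone f g m a b

lemma originCount_bdry (f : X → Fin 8) (c : Chain X 5) : originCount f (bdry 4 c) = 0 := by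
  simp [originCount, bdry_bdry]

lemma originCount_push {f : X → Fin 8} {g : X → X} {l : Fin 8 → Fin 8}
    (hg : ∀ x, f (g x) = l (f x))
    (hl : ∀ a b c d, originHit (l a) (l b) (l c) (l d) = originHit a b c d) (c : Chain X 4) :
    originCount f (push g 4 c) = originCount f c := by
  suffices (originCount f).comp (push g 4) = originCount f from LinearMap.congr_fun this c
  refine chain_hom_ext fun σ => ?_
  simp [push_single, originCount_single, hg, hl]

variable {β : (n : ℕ) → (Fin (n + 1) → X) → X}

lemma sd_one_single (h0 : ∀ a, β 0 ![a] = a) (a : X) :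
    sd β 1 (Finsupp.single ![a] 1 : Chain X 1) = Finsupp.single ![a] 1 := by
  rw [sd_single, h0]
  simp only [sd, bdry, Finsupp.lmapDomain_apply, Finsupp.mapDomain_single, LinearMap.id_apply,
    cone_single]
  congr 1

lemma sd_two_single (h0 : ∀ a, β 0 ![a] = a) (a b : X) :
    sd β 2 (Finsupp.single ![a, b] 1 : Chain X 2) =
      cone (β 1 ![a, b]) 1 (Finsupp.single ![b] 1 + Finsupp.single ![a] 1) := by
  rw [sd_single, single_bdry_one, map_add, sd_one_single h0, sd_one_single h0]

lemma sdHtpy_one_single (h0 : ∀ a, β 0 ![a] = a) (a : X) :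
    sdHtpy β 1 (Finsupp.single ![a] 1 : Chain X 1) = 0 := by
  rw [sdHtpy_single, sd_one_single h0, ZModModule.add_self]
  simp [sdHtpy]

lemma sdHtpy_two_single (h0 : ∀ a, β 0 ![a] = a) (a b : X) :
    sdHtpy β 2 (Finsupp.single ![a, b] 1 : Chain X 2) =
      cone (β 1 ![a, b]) 2 (Finsupp.single ![a, b] 1 +
        cone (β 1 ![a, b]) 1 (Finsupp.single ![b] 1 + Finsupp.single ![a] 1)) := by
  rw [sdHtpy_single, single_bdry_one, map_add (sdHtpy β 1), sdHtpy_one_single h0,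
    sdHtpy_one_single h0, sd_two_single h0, add_zero, add_zero]

lemma sd_two_swap (h0 : ∀ a, β 0 ![a] = a) {a b : X} (h1 : β 1 ![a, b] = β 1 ![b, a]) :
    sd β 2 (Finsupp.single ![a, b] 1 : Chain X 2) = sd β 2 (Finsupp.single ![b, a] 1) := by
  rw [sd_two_single h0, sd_two_single h0, h1, add_comm (Finsupp.single ![a] 1)]

variable {a b c : X}

/-- Subdivision does not see the reversal of a triangle. -/
lemma sd_three_reverse (h0 : ∀ a, β 0 ![a] = a) (hab : β 1 ![a, b] = β 1 ![b, a])
    (hac : β 1 ![a, c] = β 1 ![c, a]) (hbc : β 1 ![b, c] = β 1 ![c, b])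
    (h : β 2 ![a, b, c] = β 2 ![c, b, a]) :
    sd β 3 (Finsupp.single ![a, b, c] 1 : Chain X 3) = sd β 3 (Finsupp.single ![c, b, a] 1) := by
  rw [sd_single, sd_single, single_bdry_two, single_bdry_two, h]
  simp only [map_add]
  rw [sd_two_swap h0 hab, sd_two_swap h0 hac, sd_two_swap h0 hbc]
  abel

lemma originCount_sdHtpy_three_reverse (f : X → Fin 8) (h0 : ∀ a, β 0 ![a] = a)
    (hab : β 1 ![a, b] = β 1 ![b, a])
    (hac : β 1 ![a, c] = β 1 ![c, a]) (hbc : β 1 ![b, c] = β 1 ![c, b])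
    (h : β 2 ![a, b, c] = β 2 ![c, b, a]) :
    originCount f (sdHtpy β 3 (Finsupp.single ![a, b, c] 1 : Chain X 3)) =
      originCount f (sdHtpy β 3 (Finsupp.single ![c, b, a] 1)) := by
  have key : ∀ g a b, β 1 ![a, b] = β 1 ![b, a] →
      originCount f (cone g 3 (sdHtpy β 2 (Finsupp.single ![a, b] 1))) =
      originCount f (cone g 3 (sdHtpy β 2 (Finsupp.single ![b, a] 1))) := by
    intro g a b hab
    rw [sdHtpy_two_single h0, sdHtpy_two_single h0, hab, add_comm (Finsupp.single ![a] 1)]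
    simp only [map_add]
    congr 1
    rw [originCount_cone_cone, originCount_cone_cone, originHit_swap23]
  rw [sdHtpy_single, sdHtpy_single, single_bdry_two, single_bdry_two, h,
    sd_three_reverse h0 hab hac hbc h]
  simp only [map_add]
  rw [key _ a b hab, key _ a c hac, key _ b c hbc]
  have : originCount f (cone (β 2 ![c, b, a]) 3 (Finsupp.single ![a, b, c] 1)) =
      originCount f (cone (β 2 ![c, b, a]) 3 (Finsupp.single ![c, b, a] 1)) := by
    rw [originCount_cone, originCount_cone, originHit_swap12, originHit_swap23, originHit_swap12]
  rw [this]
  abel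

end LabelledChains

end

/-! ### The generalized quaternion group of order sixteen acting on the punctured plane `ℂ × ℂ` -/

/-- The punctured complex plane. -/
abbrev Punct : Type := {x : ℂ × ℂ // x ≠ 0}

/-- A primitive eighth root of unity. -/
def zeta : ℂ := Complex.exp (2 * Real.pi * Complex.I / (8 : ℕ))

lemma zeta_primitive : IsPrimitiveRoot zeta 8 := Complex.isPrimitiveRoot_exp 8 (by norm_num)

lemma zeta_pow_eight : zeta ^ 8 = 1 := zeta_primitive.pow_eq_one

lemma zeta_pow_four : zeta ^ 4 = -1 := by
  have h : (zeta ^ 4 - 1) * (zeta ^ 4 + 1) = 0 := by linear_combination zeta_pow_eight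
  rcases mul_eq_zero.1 h with h | h
  · exact absurd (sub_eq_zero.1 h)
      (zeta_primitive.pow_ne_one_of_pos_of_lt (by norm_num) (by norm_num))
  · linear_combination h

lemma star_zeta_mul : (starRingEnd ℂ) zeta * zeta = 1 := by
  have h : ‖zeta‖ = 1 := zeta_primitive.norm'_eq_one (by norm_num)
  rw [Complex.conj_mul', h]; simp

lemma zeta_ne_zero : zeta ≠ 0 := zeta_primitive.ne_zero (by norm_num)

lemma star_zeta : (starRingEnd ℂ) zeta = zeta ^ 7 := by
  refine mul_right_cancel₀ zeta_ne_zero ?_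
  rw [star_zeta_mul, ← pow_succ, zeta_pow_eight]

/-- Multiplication by `zeta`. -/
def rotT : ℂ × ℂ →ₗ[ℝ] ℂ × ℂ where
  toFun x := (zeta * x.1, zeta * x.2)
  map_add' x y := by ext <;> simp <;> ring
  map_smul' c x := by ext <;> simp <;> ring

/-- The quaternionic structure. -/
def rotR : ℂ × ℂ →ₗ[ℝ] ℂ × ℂ where
  toFun x := (-(starRingEnd ℂ) x.2, (starRingEnd ℂ) x.1)
  map_add' x y := by ext <;> simp <;> ring
  map_smul' c x := by ext <;> simp

lemma rotT_apply (x : ℂ × ℂ) : rotT x = (zeta * x.1, zeta * x.2) := rfl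

lemma rotR_apply (x : ℂ × ℂ) :
    rotR x = (-(starRingEnd ℂ) x.2, (starRingEnd ℂ) x.1) := rfl

lemma rotT_pow (i : ℕ) (x : ℂ × ℂ) : (rotT ^ i) x = (zeta ^ i * x.1, zeta ^ i * x.2) := by
  induction i with
  | zero => simp
  | succ i ih =>
    rw [pow_succ', Module.End.mul_apply, ih, rotT_apply]
    ext1 <;> simp only <;> ring

lemma rotT_pow_eight : rotT ^ 8 = 1 := by
  refine LinearMap.ext fun x => ?_
  rw [rotT_pow, zeta_pow_eight]; simp

lemma rotR_mul_rotR : rotR * rotR = rotT ^ 4 := by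
  refine LinearMap.ext fun x => ?_
  rw [rotT_pow, zeta_pow_four, Module.End.mul_apply, rotR_apply, rotR_apply]; simp

lemma rotR_mul_rotT : rotR * rotT = rotT ^ 7 * rotR := by
  refine LinearMap.ext fun x => ?_
  rw [Module.End.mul_apply, Module.End.mul_apply, rotT_pow, ← star_zeta, rotR_apply, rotR_apply,
    rotT_apply]
  simp

lemma rotT_ne_zero {x : ℂ × ℂ} (hx : x ≠ 0) : rotT x ≠ 0 := by
  intro h
  apply hx
  have := congrArg (fun y => (rotT ^ 7) y) h
  rwa [map_zero, ← Module.End.mul_apply, ← pow_succ, rotT_pow_eight] at this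

lemma rotR_ne_zero {x : ℂ × ℂ} (hx : x ≠ 0) : rotR x ≠ 0 := by
  intro h
  apply hx
  have := congrArg (fun y => (rotT ^ 4 * rotR) y) h
  rwa [map_zero, ← Module.End.mul_apply, mul_assoc, rotR_mul_rotR, ← pow_add, rotT_pow_eight]
    at this

/-- `rotT` on the punctured plane. -/
def pT (x : Punct) : Punct := ⟨rotT x.1, rotT_ne_zero x.2⟩

/-- `rotR` on the punctured plane. -/
def pR (x : Punct) : Punct := ⟨rotR x.1, rotR_ne_zero x.2⟩

lemma pT_iterate_coe (i : ℕ) (x : Punct) : ((pT^[i] x : Punct) : ℂ × ℂ) = (rotT ^ i) x.1 := by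
  induction i with
  | zero => simp
  | succ i ih =>
    rw [Function.iterate_succ_apply', pow_succ', Module.End.mul_apply, ← ih]; rfl

lemma pT_iterate_eight (x : Punct) : pT^[8] x = x := by
  apply Subtype.ext; rw [pT_iterate_coe, rotT_pow_eight]; rfl

lemma pR_pR (x : Punct) : pR (pR x) = pT^[4] x := by
  apply Subtype.ext; rw [pT_iterate_coe, ← rotR_mul_rotR]; rfl

lemma pR_pT (x : Punct) : pR (pT x) = pT^[7] (pR x) := by
  apply Subtype.ext; rw [pT_iterate_coe]
  exact LinearMap.congr_fun rotR_mul_rotT x.1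

/-- The first generator acting on points and on labels. -/
def genT : Equiv.Perm Punct × Equiv.Perm (Fin 8) :=
  (⟨pT, pT^[7], pT_iterate_eight,
    fun x => (Function.iterate_succ_apply' pT 7 x).symm.trans (pT_iterate_eight x)⟩,
   ⟨labT, labT^[7], by decide, by decide⟩)

/-- The second generator acting on points and on labels. -/
def genR : Equiv.Perm Punct × Equiv.Perm (Fin 8) :=
  (⟨pR, fun x => pT^[4] (pR x), fun x => by
      change pT^[4] (pR (pR x)) = x
      rw [pR_pR, ← Function.iterate_add_apply]; exact pT_iterate_eight x,
    fun x => by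
      change pR (pT^[4] (pR x)) = x
      rw [← pR_pR (pR x), pR_pR, pR_pR, ← Function.iterate_add_apply]
      exact pT_iterate_eight x⟩,
   ⟨labR, labR, by decide, by decide⟩)

lemma genT_pow_fst (i : ℕ) (x : Punct) : (genT ^ i).1 x = pT^[i] x := by
  rw [Prod.pow_fst, Equiv.Perm.coe_pow]; rfl

lemma genT_pow_eight : genT ^ 8 = 1 := by
  refine Prod.ext (Equiv.ext fun x => ?_) (Equiv.ext ?_)
  · rw [genT_pow_fst, pT_iterate_eight]; rfl
  · rw [Prod.pow_snd, Equiv.Perm.coe_pow]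
    change ∀ x, labT^[8] x = x
    decide

lemma genR_mul_genR : genR * genR = genT ^ 4 := by
  refine Prod.ext (Equiv.ext fun x => ?_) (Equiv.ext ?_)
  · rw [genT_pow_fst]; exact pR_pR x
  · rw [Prod.pow_snd, Equiv.Perm.coe_pow]
    change ∀ x, labR (labR x) = labT^[4] x
    decide

lemma genR_mul_genT : genR * genT = genT ^ 7 * genR := by
  refine Prod.ext (Equiv.ext fun x => ?_) (Equiv.ext ?_)
  · rw [Prod.fst_mul, Prod.fst_mul, Equiv.Perm.mul_apply, Equiv.Perm.mul_apply, genT_pow_fst]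
    exact pR_pT x
  · rw [Prod.snd_mul, Prod.snd_mul, Prod.pow_snd, Equiv.Perm.coe_mul, Equiv.Perm.coe_mul,
      Equiv.Perm.coe_pow]
    change ∀ x, labR (labT x) = labT^[7] (labR x)
    decide

lemma genR_mul_genT_pow (i : ℕ) : genR * genT ^ i = genT ^ (7 * i) * genR := by
  induction i with
  | zero => simp
  | succ i ih =>
    rw [pow_succ, ← mul_assoc, ih, mul_assoc, genR_mul_genT, ← mul_assoc, ← pow_add]
    rfl

/-- The group generated by the two generators. -/
def gammaGrp : Subgroup (Equiv.Perm Punct × Equiv.Perm (Fin 8)) :=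
  Subgroup.closure {genT, genR}

lemma gammaGrp_normal_form {γ : Equiv.Perm Punct × Equiv.Perm (Fin 8)} (h : γ ∈ gammaGrp) :
    ∃ i : ℕ, γ = genT ^ i ∨ γ = genT ^ i * genR := by
  have hRinv : genR⁻¹ = genT ^ 4 * genR := by
    rw [inv_eq_iff_mul_eq_one, ← mul_assoc, genR_mul_genT_pow, mul_assoc, genR_mul_genR,
      ← pow_add]
    exact (pow_mul genT 8 4).trans (by rw [genT_pow_eight, one_pow])
  have hTinv : genT⁻¹ = genT ^ 7 := by
    rw [inv_eq_iff_mul_eq_one, ← pow_succ', genT_pow_eight]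
  have hR : ∀ y, (∃ i : ℕ, y = genT ^ i ∨ y = genT ^ i * genR) →
      ∃ i : ℕ, genR * y = genT ^ i ∨ genR * y = genT ^ i * genR := by
    rintro y ⟨i, rfl | rfl⟩
    · exact ⟨7 * i, Or.inr (genR_mul_genT_pow i)⟩
    · exact ⟨7 * i + 4, Or.inl (by
        rw [← mul_assoc, genR_mul_genT_pow, mul_assoc, genR_mul_genR, pow_add])⟩
  have hT : ∀ (k : ℕ) y, (∃ i : ℕ, y = genT ^ i ∨ y = genT ^ i * genR) →
      ∃ i : ℕ, genT ^ k * y = genT ^ i ∨ genT ^ k * y = genT ^ i * genR := by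
    rintro k y ⟨i, rfl | rfl⟩
    · exact ⟨k + i, Or.inl (pow_add _ _ _).symm⟩
    · exact ⟨k + i, Or.inr (by rw [pow_add, mul_assoc])⟩
  refine Subgroup.closure_induction_left (p := fun γ _ => ∃ i : ℕ, γ = genT ^ i ∨
    γ = genT ^ i * genR) ⟨0, Or.inl (pow_zero _).symm⟩ ?_ ?_ h
  · rintro x (rfl | rfl) y _ hy
    · simpa using hT 1 y hy
    · exact hR y hy
  · rintro x (rfl | rfl) y _ hy
    · rw [hTinv]; exact hT 7 y hy
    · rw [hRinv, mul_assoc]; exact hT 4 _ (hR y hy)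

/-- The group acts freely. -/
lemma gammaGrp_free {γ : Equiv.Perm Punct × Equiv.Perm (Fin 8)} (h : γ ∈ gammaGrp) {x : Punct}
    (hx : γ.1 x = x) : γ = 1 := by
  obtain ⟨i, rfl | rfl⟩ := gammaGrp_normal_form h
  · rw [genT_pow_fst] at hx
    have hx' := congrArg Subtype.val hx
    rw [pT_iterate_coe, rotT_pow, Prod.ext_iff] at hx'
    have hz : zeta ^ i = 1 := by
      by_cases h1 : x.1.1 = 0
      · have h2 : x.1.2 ≠ 0 := fun h2 => x.2 (Prod.ext h1 h2)
        exact mul_right_cancel₀ h2 (by rw [one_mul]; exact hx'.2)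
      · exact mul_right_cancel₀ h1 (by rw [one_mul]; exact hx'.1)
    obtain ⟨k, rfl⟩ := (zeta_primitive.pow_eq_one_iff_dvd i).1 hz
    rw [pow_mul, genT_pow_eight, one_pow]
  · exfalso
    rw [Prod.fst_mul, Equiv.Perm.mul_apply, genT_pow_fst] at hx
    have hx' := congrArg Subtype.val hx
    rw [pT_iterate_coe, rotT_pow, Prod.ext_iff] at hx'
    obtain ⟨h1, h2⟩ := hx'
    change zeta ^ i * (-(starRingEnd ℂ) x.1.2) = x.1.1 at h1
    change zeta ^ i * ((starRingEnd ℂ) x.1.1) = x.1.2 at h2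
    have hs : zeta ^ i * (starRingEnd ℂ) (zeta ^ i) = 1 := by
      rw [map_pow, ← mul_pow, mul_comm, star_zeta_mul, one_pow]
    have h3 := congrArg (starRingEnd ℂ) h2
    rw [map_mul, Complex.conj_conj] at h3
    have h4 : x.1.1 = 0 := by
      have : x.1.1 = - x.1.1 := by
        conv_lhs => rw [← h1, ← h3]
        linear_combination (-x.1.1) * hs
      exact self_eq_neg.1 this
    refine x.2 (Prod.ext h4 ?_)
    rw [← h2, h4]; simp

/-- Equivariant labelling of the punctured plane subordinate to an equivariant map. -/
lemma exists_labelling {F : Punct → ℝ × ℝ × ℝ} (hT : ∀ x, F (pT x) = spT (F x))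
    (hR : ∀ x, F (pR x) = spR (F x)) : ∃ f : Punct → Fin 8,
      (∀ x, f (pT x) = labT (f x)) ∧ (∀ x, f (pR x) = labR (f x)) ∧
      ∀ x, ‖F x‖ ≤ 2 * labPair (f x) (F x) := by
  classical
  have hinv : ∀ γ ∈ gammaGrp, ∀ x, ‖F (γ.1 x)‖ = ‖F x‖ ∧
      ∀ i, labPair (γ.2 i) (F (γ.1 x)) = labPair i (F x) := by
    intro γ hγ
    refine Subgroup.closure_induction (p := fun γ _ => ∀ x, ‖F (γ.1 x)‖ = ‖F x‖ ∧
      ∀ i, labPair (γ.2 i) (F (γ.1 x)) = labPair i (F x)) ?_ ?_ ?_ ?_ hγ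
    · rintro γ (rfl | rfl) x
      · change ‖F (pT x)‖ = ‖F x‖ ∧ ∀ i, labPair (labT i) (F (pT x)) = labPair i (F x)
        rw [hT]
        refine ⟨?_, fun i => labPair_labT i _⟩
        simp only [spT, Prod.norm_def, norm_neg]
        rw [max_comm ‖(F x).2.2‖]
      · change ‖F (pR x)‖ = ‖F x‖ ∧ ∀ i, labPair (labR i) (F (pR x)) = labPair i (F x)
        rw [hR]
        refine ⟨?_, fun i => labPair_labR i _⟩
        simp only [spR, Prod.norm_def, norm_neg]
    · intro x; exact ⟨rfl, fun i => rfl⟩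
    · intro a b _ _ ha hb x
      exact ⟨(ha (b.1 x)).1.trans (hb x).1,
        fun i => ((ha (b.1 x)).2 (b.2 i)).trans ((hb x).2 i)⟩
    · intro a _ ha x
      have h := ha (a.1⁻¹ x)
      rw [← Equiv.Perm.mul_apply, mul_inv_cancel, Equiv.Perm.one_apply] at h
      refine ⟨h.1.symm, fun i => ?_⟩
      have h2 := h.2 (a.2⁻¹ i)
      rw [← Equiv.Perm.mul_apply, mul_inv_cancel, Equiv.Perm.one_apply] at h2
      exact h2.symm
  let S : Setoid Punct :=
    { r := fun x y => ∃ γ ∈ gammaGrp, γ.1 x = y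
      iseqv := ⟨fun x => ⟨1, one_mem _, rfl⟩,
        fun {x y} ⟨γ, hγ, h⟩ => ⟨γ⁻¹, inv_mem hγ, by rw [← h]; exact γ.1.symm_apply_apply x⟩,
        fun {x y z} ⟨γ, hγ, h⟩ ⟨δ, hδ, h'⟩ => ⟨δ * γ, mul_mem hδ hγ, by rw [← h', ← h]; rfl⟩⟩ }
  let rep : Punct → Punct := fun x => (Quotient.mk S x).out
  have hrep : ∀ x, ∃ γ ∈ gammaGrp, γ.1 (rep x) = x := fun x => Quotient.mk_out (s := S) x
  choose γ hγ hγx using hrep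
  choose l hl using fun x => exists_labPair_pos (F x)
  have heq : ∀ δ ∈ gammaGrp, ∀ x, (γ (δ.1 x)).2 (l (rep (δ.1 x))) =
      δ.2 ((γ x).2 (l (rep x))) := by
    intro δ hδ x
    have h1 : rep (δ.1 x) = rep x := by
      change (Quotient.mk S _).out = (Quotient.mk S _).out
      congr 1
      exact (Quotient.sound (s := S) (show S.r x (δ.1 x) from ⟨δ, hδ, rfl⟩)).symm
    have h2 : (δ * γ x)⁻¹ * γ (δ.1 x) = 1 := by
      refine gammaGrp_free (x := rep x)
        (mul_mem (inv_mem (mul_mem hδ (hγ x))) (hγ _)) ?_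
      have h3 := hγx (δ.1 x)
      rw [h1] at h3
      change (δ.1 * (γ x).1)⁻¹ ((γ (δ.1 x)).1 (rep x)) = rep x
      rw [h3, Equiv.Perm.inv_eq_iff_eq, Equiv.Perm.mul_apply, hγx]
    rw [← inv_mul_eq_one.1 h2, h1]; rfl
  refine ⟨fun x => (γ x).2 (l (rep x)),
    fun x => heq genT (Subgroup.subset_closure (by simp)) x,
    fun x => heq genR (Subgroup.subset_closure (by simp)) x, fun x => ?_⟩
  have h := hinv (γ x) (hγ x) (rep x)
  have h1 := h.1
  have h2 := h.2 (l (rep x))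
  rw [hγx] at h1 h2
  rw [h1, h2]
  exact hl _

/-! ### Barycentric subdivision in the punctured plane -/

/-- The average of finitely many points. -/
def average (n : ℕ) (σ : Fin (n + 1) → Punct) : ℂ × ℂ := ((n : ℝ) + 1)⁻¹ • ∑ i, (σ i).1

open Classical in
/-- The barycentre, when it is not the origin. -/
def bary (n : ℕ) (σ : Fin (n + 1) → Punct) : Punct :=
  if h : average n σ ≠ 0 then ⟨average n σ, h⟩ else σ 0

lemma bary_coe {n : ℕ} {σ : Fin (n + 1) → Punct} (h : average n σ ≠ 0) :
    (bary n σ).1 = average n σ := by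
  rw [bary, dif_pos h]

lemma bary_equivariant (L : ℂ × ℂ →ₗ[ℝ] ℂ × ℂ) (hL : ∀ {x}, x ≠ 0 → L x ≠ 0) (n : ℕ)
    (σ : Fin (n + 1) → Punct) :
    bary n ((fun x : Punct => (⟨L x.1, hL x.2⟩ : Punct)) ∘ σ) =
      ⟨L (bary n σ).1, hL (bary n σ).2⟩ := by
  have key : average n ((fun x : Punct => (⟨L x.1, hL x.2⟩ : Punct)) ∘ σ) = L (average n σ) := by
    simp [average, map_sum]
  by_cases h : average n σ = 0
  · have h' : average n ((fun x : Punct => (⟨L x.1, hL x.2⟩ : Punct)) ∘ σ) = 0 := by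
      rw [key, h, map_zero]
    rw [bary, dif_neg (by simpa using h'), Subtype.ext_iff, bary, dif_neg (by simpa using h)]
    rfl
  · apply Subtype.ext
    rw [bary_coe (by rw [key]; exact hL h), key]
    exact congrArg L (bary_coe h).symm

lemma bary_pT (n : ℕ) (σ : Fin (n + 1) → Punct) : bary n (pT ∘ σ) = pT (bary n σ) :=
  bary_equivariant rotT rotT_ne_zero n σ

lemma bary_pR (n : ℕ) (σ : Fin (n + 1) → Punct) : bary n (pR ∘ σ) = pR (bary n σ) :=
  bary_equivariant rotR rotR_ne_zero n σ

lemma bary_zero (a : Punct) : bary 0 ![a] = a := by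
  have h : average 0 ![a] = a.1 := by simp [average]
  exact Subtype.ext ((bary_coe (by rw [h]; exact a.2)).trans h)

lemma bary_congr {n : ℕ} {σ τ : Fin (n + 1) → Punct} (h : average n σ ≠ 0)
    (h' : average n τ = average n σ) : bary n σ = bary n τ :=
  Subtype.ext (by rw [bary_coe h, bary_coe (h' ▸ h), h'])

lemma bary_one_swap {a b : Punct} (h : a.1 + b.1 ≠ 0) : bary 1 ![a, b] = bary 1 ![b, a] := by
  refine bary_congr ?_ ?_
  · exact smul_ne_zero (by norm_num) (by simpa [Fin.sum_univ_two] using h)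
  · simp [average, Fin.sum_univ_two, add_comm]

lemma bary_two_reverse {a b c : Punct} (h : a.1 + b.1 + c.1 ≠ 0) :
    bary 2 ![a, b, c] = bary 2 ![c, b, a] := by
  refine bary_congr ?_ ?_
  · exact smul_ne_zero (by norm_num) (by simpa [Fin.sum_univ_three] using h)
  · simp [average, Fin.sum_univ_three, add_comm, add_left_comm]

/-- Chains with small simplices in `A`. -/
def smallChains (A : Set (ℂ × ℂ)) (r : ℝ) (n : ℕ) : Submodule (ZMod 2) (Chain Punct n) :=
  Submodule.span _ ((fun τ => Finsupp.single τ 1) ''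
    {τ | (∀ i, (τ i).1 ∈ A) ∧ ∀ i j, dist (τ i) (τ j) ≤ r})

lemma single_mem_smallChains {A : Set (ℂ × ℂ)} {r : ℝ} {n : ℕ} {τ : Fin n → Punct}
    (h : ∀ i, (τ i).1 ∈ A) (h' : ∀ i j, dist (τ i) (τ j) ≤ r) :
    Finsupp.single τ 1 ∈ smallChains A r n :=
  Submodule.subset_span ⟨τ, ⟨h, h'⟩, rfl⟩

lemma map_mem_of_smallChains {A : Set (ℂ × ℂ)} {r : ℝ} {n : ℕ} {M : Type} [AddCommGroup M]
    [Module (ZMod 2) M] (f : Chain Punct n →ₗ[ZMod 2] M) (S : Submodule (ZMod 2) M)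
    (h : ∀ τ : Fin n → Punct, (∀ i, (τ i).1 ∈ A) → (∀ i j, dist (τ i) (τ j) ≤ r) →
      f (Finsupp.single τ 1) ∈ S) {c : Chain Punct n} (hc : c ∈ smallChains A r n) : f c ∈ S := by
  have : smallChains A r n ≤ S.comap f := by
    refine Submodule.span_le.2 ?_
    rintro _ ⟨τ, hτ, rfl⟩
    exact h τ hτ.1 hτ.2
  exact this hc

lemma smallChains_mono {A B : Set (ℂ × ℂ)} (h : A ⊆ B) (r : ℝ) (n : ℕ) :
    smallChains A r n ≤ smallChains B r n :=
  Submodule.span_mono (Set.image_mono fun _ hτ => ⟨fun i => h (hτ.1 i), hτ.2⟩)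

lemma cone_mem_smallChains {A : Set (ℂ × ℂ)} {r : ℝ} (hr : 0 ≤ r) {n : ℕ} {v : Punct}
    (hv : v.1 ∈ A) (hv' : ∀ y : Punct, y.1 ∈ A → dist v y ≤ r) {c : Chain Punct n}
    (hc : c ∈ smallChains A r n) : cone v n c ∈ smallChains A r (n + 1) := by
  refine map_mem_of_smallChains _ _ (fun τ h h' => ?_) hc
  rw [cone_single]
  refine single_mem_smallChains (Fin.cases hv h) (fun i j => ?_)
  refine Fin.cases (Fin.cases ?_ (fun j => ?_) j) (fun i => Fin.cases ?_ (fun j => ?_) j) i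
  · simpa using hr
  · simpa using hv' _ (h j)
  · simpa [dist_comm] using hv' _ (h i)
  · simpa using h' i j

lemma bdry_single_mem_span {X : Type} (n : ℕ) (σ : Fin (n + 1) → X) :
    bdry n (Finsupp.single σ 1) ∈ Submodule.span (ZMod 2)
      (Set.range fun e : Fin n → Fin (n + 1) => (Finsupp.single (σ ∘ e) 1 : Chain X n)) := by
  induction n with
  | zero =>
    refine Submodule.subset_span ⟨Fin.elim0, ?_⟩
    simp only [bdry, Finsupp.lmapDomain_apply, Finsupp.mapDomain_single]
    congr 1
    exact Subsingleton.elim _ _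
  | succ n ih =>
    rw [bdry_single]
    refine add_mem (Submodule.subset_span ⟨Fin.succ, rfl⟩) ?_
    have := Submodule.mem_map_of_mem (f := cone (σ 0) n) (ih (Fin.tail σ))
    rw [Submodule.map_span] at this
    refine Submodule.span_mono ?_ this
    rintro _ ⟨_, ⟨e, rfl⟩, rfl⟩
    refine ⟨Fin.cons 0 (Fin.succ ∘ e), ?_⟩
    simp only [cone_single]
    congr 1
    funext i
    refine Fin.cases rfl (fun j => rfl) i

lemma bdry_mem_smallChains {A : Set (ℂ × ℂ)} {r : ℝ} {n : ℕ} {c : Chain Punct (n + 1)}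
    (hc : c ∈ smallChains A r (n + 1)) : bdry n c ∈ smallChains A r n := by
  refine map_mem_of_smallChains _ _ (fun τ h h' => ?_) hc
  refine (Submodule.span_le.2 ?_) (bdry_single_mem_span n τ)
  rintro _ ⟨e, rfl⟩
  exact single_mem_smallChains (fun i => h (e i)) (fun i j => h' (e i) (e j))

lemma average_mem {n : ℕ} (σ : Fin (n + 1) → Punct) :
    average n σ ∈ convexHull ℝ (Set.range fun i => (σ i).1) := by
  rw [average, Finset.smul_sum]
  refine (convex_convexHull ℝ _).sum_mem (fun i _ => by positivity) ?_
    (fun i _ => subset_convexHull ℝ _ ⟨i, rfl⟩)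
  simp
  field_simp

lemma dist_average_le {n : ℕ} (hn : n ≤ 3) {σ : Fin (n + 1) → Punct} {r : ℝ}
    (h : ∀ i j, dist (σ i) (σ j) ≤ r) (j : Fin (n + 1)) :
    dist (average n σ) (σ j).1 ≤ 3 / 4 * r := by
  have hr : 0 ≤ r := dist_nonneg.trans (h j j)
  have hn1 : (0 : ℝ) < (n : ℝ) + 1 := by positivity
  have key : average n σ - (σ j).1 = ((n : ℝ) + 1)⁻¹ • ∑ i, ((σ i).1 - (σ j).1) := by
    rw [average, Finset.sum_sub_distrib, smul_sub]
    congr 1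
    rw [Finset.sum_const, Finset.card_univ, Fintype.card_fin, ← Nat.cast_smul_eq_nsmul ℝ, smul_smul]
    push_cast
    rw [inv_mul_cancel₀ hn1.ne', one_smul]
  rw [dist_eq_norm, key, norm_smul, Real.norm_of_nonneg (by positivity)]
  have hsum : ‖∑ i, ((σ i).1 - (σ j).1)‖ ≤ n * r := by
    rw [← Finset.sum_erase (a := j) Finset.univ (by simp)]
    refine (norm_sum_le_of_le _ (fun i _ => ?_)).trans
      (le_of_eq (b := n * r) (a := ∑ i ∈ Finset.univ.erase j, r) ?_)
    · rw [← dist_eq_norm]; exact h i j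
    · simp
  rw [inv_mul_le_iff₀ hn1]
  have : (n : ℝ) ≤ 3 := by exact_mod_cast hn
  nlinarith

lemma sd_mem_smallChains {n : ℕ} (hn : n ≤ 4) {A : Set (ℂ × ℂ)} (hA : Convex ℝ A)
    (h0 : (0 : ℂ × ℂ) ∉ A) {r : ℝ} {c : Chain Punct n} (hc : c ∈ smallChains A r n) :
    sd bary n c ∈ smallChains A (3 / 4 * r) n := by
  induction n generalizing A with
  | zero =>
    refine map_mem_of_smallChains _ _ (fun τ h h' => ?_) hc
    exact single_mem_smallChains (fun i => i.elim0) (fun i => i.elim0)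
  | succ n ih =>
    refine map_mem_of_smallChains _ _ (fun τ h h' => ?_) hc
    set B := convexHull ℝ (Set.range fun i => (τ i).1) with hB
    have hBA : B ⊆ A := convexHull_min (by rintro _ ⟨i, rfl⟩; exact h i) hA
    have hB0 : (0 : ℂ × ℂ) ∉ B := fun h => h0 (hBA h)
    have hr : 0 ≤ r := dist_nonneg.trans (h' 0 0)
    have ha : average n τ ≠ 0 := fun h => hB0 (h ▸ average_mem τ)
    refine smallChains_mono hBA _ _ ?_
    rw [sd_single]
    refine cone_mem_smallChains (by positivity) ?_ (fun y hy => ?_)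
      (ih (by omega) (convex_convexHull ℝ _) hB0 (bdry_mem_smallChains
        (single_mem_smallChains (fun i => subset_convexHull ℝ _ ⟨i, rfl⟩) h')))
    · rw [bary_coe ha]; exact average_mem τ
    · rw [Subtype.dist_eq, bary_coe ha, dist_comm]
      have hsub : B ⊆ Metric.closedBall (average n τ) (3 / 4 * r) := by
        refine convexHull_min ?_ (convex_closedBall _ _)
        rintro _ ⟨i, rfl⟩
        rw [Metric.mem_closedBall, dist_comm]
        exact dist_average_le (by omega) h' i
      exact hsub hy

lemma iterate_sd_mem_smallChains {A : Set (ℂ × ℂ)} (hA : Convex ℝ A)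
    (h0 : (0 : ℂ × ℂ) ∉ A) {r : ℝ} {c : Chain Punct 4} (hc : c ∈ smallChains A r 4) (k : ℕ) :
    (sd bary 4)^[k] c ∈ smallChains A ((3 / 4) ^ k * r) 4 := by
  induction k with
  | zero => simpa using hc
  | succ k ih =>
    rw [Function.iterate_succ_apply', pow_succ', mul_assoc]
    exact sd_mem_smallChains le_rfl hA h0 ih

lemma labPair_sub_le (i : Fin 8) (F G : ℝ × ℝ × ℝ) : labPair i F - labPair i G ≤ 4 * ‖F - G‖ := by
  have h1 : |F.1 - G.1| ≤ ‖F - G‖ := norm_fst_le (F - G)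
  have h2 : |F.2.1 - G.2.1| ≤ ‖F - G‖ := (norm_fst_le (F - G).2).trans (norm_snd_le (F - G))
  have h3 : |F.2.2 - G.2.2| ≤ ‖F - G‖ := (norm_snd_le (F - G).2).trans (norm_snd_le (F - G))
  rw [abs_le] at h1 h2 h3
  fin_cases i <;> simp [labPair, lab] <;> linarith

/-- Chains in a compact convex set with small enough simplices do not meet the origin. -/
lemma originCount_smallChains {F : Punct → ℝ × ℝ × ℝ} (hF : Continuous F) (hF0 : ∀ x, F x ≠ 0)
    {f : Punct → Fin 8} (hf : ∀ x, ‖F x‖ ≤ 2 * labPair (f x) (F x)) {A : Set (ℂ × ℂ)}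
    (hA : IsCompact A) (h0 : (0 : ℂ × ℂ) ∉ A) :
    ∃ δ > 0, ∀ r < δ, ∀ c ∈ smallChains A r 4, originCount f c = 0 := by
  set B : Set Punct := Subtype.val ⁻¹' A with hB
  have hBc : IsCompact B := by
    have hi : Topology.IsInducing (Subtype.val : Punct → ℂ × ℂ) := .subtypeVal
    have hs : (Subtype.val '' B : Set (ℂ × ℂ)) = A := by
      refine (Set.image_preimage_subset _ _).antisymm fun x hx => ?_
      exact ⟨⟨x, fun h => h0 (h ▸ hx)⟩, hx, rfl⟩
    rwa [hi.isCompact_iff, hs]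
  obtain ⟨ε, hε, hεF⟩ : ∃ ε > 0, ∀ x ∈ B, ε ≤ ‖F x‖ := by
    rcases B.eq_empty_or_nonempty with hBe | hBne
    · exact ⟨1, one_pos, by simp [hBe]⟩
    · obtain ⟨x, hx, hmin⟩ := hBc.exists_isMinOn hBne hF.norm.continuousOn
      exact ⟨‖F x‖, norm_pos_iff.2 (hF0 x), fun y hy => hmin hy⟩
  obtain ⟨δ, hδ, hδF⟩ := Metric.uniformContinuousOn_iff.1
    (hBc.uniformContinuousOn_of_continuous hF.continuousOn) (ε / 8) (by positivity)
  refine ⟨δ, hδ, fun r hr c hc => ?_⟩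
  refine (Submodule.mem_bot (ZMod 2)).1 (map_mem_of_smallChains _ ⊥ (fun τ h h' => ?_) hc)
  rw [Submodule.mem_bot, originCount_single]
  have key : ∀ i, 0 < labPair (f (τ i)) (F (τ 0)) := by
    intro i
    have h1 := hf (τ i)
    have h2 := hεF (τ i) (h i)
    have h3 := hδF (τ i) (h i) (τ 0) (h 0) ((h' _ _).trans_lt hr)
    rw [dist_eq_norm] at h3
    have h4 := labPair_sub_le (f (τ i)) (F (τ i)) (F (τ 0))
    linarith
  exact originHit_eq_zero (key 0) (key 1) (key 2) (key 3)

lemma eventually_originCount_iterate_sd {F : Punct → ℝ × ℝ × ℝ} (hF : Continuous F)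
    (hF0 : ∀ x, F x ≠ 0) {f : Punct → Fin 8} (hf : ∀ x, ‖F x‖ ≤ 2 * labPair (f x) (F x))
    (τ : Fin 4 → Punct)
    (h0 : (0 : ℂ × ℂ) ∉ convexHull ℝ (Set.range fun i => (τ i).1)) :
    ∀ᶠ k in atTop, originCount f ((sd bary 4)^[k] (Finsupp.single τ 1)) = 0 := by
  set A := convexHull ℝ (Set.range fun i => (τ i).1) with hA
  obtain ⟨δ, hδ, h⟩ := originCount_smallChains hF hF0 hf
    ((Set.finite_range fun i => (τ i).1).isCompact_convexHull ℝ) h0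
  set r := ∑ i, ∑ j, dist (τ i) (τ j) with hr
  have hτ : Finsupp.single τ 1 ∈ smallChains A r 4 := by
    refine single_mem_smallChains (fun i => subset_convexHull ℝ _ ⟨i, rfl⟩) (fun i j => ?_)
    exact (Finset.single_le_sum (f := fun j => dist (τ i) (τ j))
      (fun _ _ => dist_nonneg) (Finset.mem_univ j)).trans
      (Finset.single_le_sum (f := fun i => ∑ j, dist (τ i) (τ j))
        (fun _ _ => Finset.sum_nonneg fun _ _ => dist_nonneg) (Finset.mem_univ i))
  have hlim : Tendsto (fun k : ℕ => (3 / 4 : ℝ) ^ k * r) atTop (𝓝 0) := by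
    simpa using (tendsto_pow_atTop_nhds_zero_of_lt_one (r := (3 / 4 : ℝ)) (by norm_num)
      (by norm_num)).mul_const r
  filter_upwards [hlim.eventually_lt_const hδ] with k hk
  exact h _ hk _ (iterate_sd_mem_smallChains (convex_convexHull ℝ _) h0 hτ k)

/-! ### Equivariant maps to space have zeros -/

/-- Points on the first axis. -/
def ptT (m : ℕ) : Punct := pT^[m] ⟨(1, 0), by simp⟩

/-- Points on the second axis. -/
def ptR (n : ℕ) : Punct := pT^[n] ⟨(0, 1), by simp⟩

lemma ptT_coe (m : ℕ) : (ptT m).1 = (zeta ^ m, 0) := by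
  rw [ptT, pT_iterate_coe, rotT_pow]; simp

lemma ptR_coe (m : ℕ) : (ptR m).1 = (0, zeta ^ m) := by
  rw [ptR, pT_iterate_coe, rotT_pow]; simp

lemma pT_ptT (m : ℕ) : pT (ptT m) = ptT (m + 1) := (Function.iterate_succ_apply' _ _ _).symm

lemma pT_ptR (m : ℕ) : pT (ptR m) = ptR (m + 1) := (Function.iterate_succ_apply' _ _ _).symm

lemma ptR_eight : ptR 8 = ptR 0 := pT_iterate_eight _

lemma pR_ptT (m : ℕ) : pR (ptT m) = ptR (7 * m) := by
  apply Subtype.ext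
  rw [ptR_coe]
  change rotR (ptT m).1 = _
  rw [ptT_coe, rotR_apply, pow_mul, ← star_zeta]
  simp

lemma pR_ptR (m : ℕ) : pR (ptR m) = ptT (7 * m + 4) := by
  apply Subtype.ext
  rw [ptT_coe]
  change rotR (ptR m).1 = _
  rw [ptR_coe, rotR_apply, pow_add, zeta_pow_four, pow_mul, ← star_zeta]
  simp

lemma push_single_three (g : Punct → Punct) (a b c : Punct) :
    push g 3 (Finsupp.single ![a, b, c] 1) = Finsupp.single ![g a, g b, g c] 1 := by
  rw [push_single]
  congr 1
  funext i; fin_cases i <;> rfl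

/-- The tetrahedra of the fundamental relative cycle. -/
def joinSimplex (d : ℕ) : Fin 4 → Punct := ![ptT 0, ptT 1, ptR d, ptR (d + 1)]

/-- The fundamental relative cycle. -/
def joinChain : Chain Punct 4 := ∑ d ∈ Finset.range 4, Finsupp.single (joinSimplex d) 1

lemma ptT_mod (m : ℕ) : ptT (m + 8) = ptT m := by
  apply Subtype.ext; rw [ptT_coe, ptT_coe, pow_add, zeta_pow_eight, mul_one]

lemma joinChain_bdry : ∃ x y : Chain Punct 3, bdry 3 joinChain =
    x + push pT 3 x + (y + push pR 3 y) +
      (Finsupp.single ![ptT 0, ptR 7, ptR 0] 1 + Finsupp.single ![ptR 0, ptR 7, ptT 0] 1 +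
      (Finsupp.single ![ptT 0, ptR 3, ptR 4] 1 + Finsupp.single ![ptR 4, ptR 3, ptT 0] 1)) := by
  refine ⟨(Finsupp.single ![ptT 0, ptR 7, ptR 0] 1 + Finsupp.single ![ptT 0, ptR 0, ptR 1] 1 +
      Finsupp.single ![ptT 0, ptR 1, ptR 2] 1 + Finsupp.single ![ptT 0, ptR 2, ptR 3] 1) +
    (Finsupp.single ![ptR 4, ptR 3, ptT 0] 1 + Finsupp.single ![ptR 5, ptR 4, ptT 1] 1 +
      Finsupp.single ![ptR 6, ptR 5, ptT 2] 1 + Finsupp.single ![ptR 7, ptR 6, ptT 3] 1),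
    Finsupp.single ![ptT 0, ptT 1, ptR 4] 1 + Finsupp.single ![ptT 0, ptT 1, ptR 0] 1, ?_⟩
  have hR4 : pR (ptR 4) = ptT 0 := by
    rw [pR_ptR]
    rw [show 7 * 4 + 4 = 0 + 8 + 8 + 8 + 8 from rfl]; simp only [ptT_mod]
  have hR0 : pR (ptR 0) = ptT 4 := pR_ptR 0
  have hT0 : pR (ptT 0) = ptR 0 := pR_ptT 0
  have hT1 : pR (ptT 1) = ptR 7 := pR_ptT 1
  simp only [joinChain, joinSimplex, Finset.sum_range_succ, Finset.sum_range_zero, zero_add,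
    map_add, single_bdry_three, push_single_three, pT_ptT, pT_ptR, hR4, hR0, hT0, hT1, ptR_eight,
    Nat.reduceAdd]
  have h : ∀ v : Chain Punct 3, v + v = 0 := ZModModule.add_self
  linear_combination (norm := abel) h (Finsupp.single ![ptT 0, ptT 1, ptR 1] 1) +
    h (Finsupp.single ![ptT 0, ptT 1, ptR 2] 1) + h (Finsupp.single ![ptT 0, ptT 1, ptR 3] 1)
    - h (Finsupp.single ![ptR 5, ptR 4, ptT 1] 1) - h (Finsupp.single ![ptR 6, ptR 5, ptT 2] 1)
    - h (Finsupp.single ![ptR 7, ptR 6, ptT 3] 1) - h (Finsupp.single ![ptR 0, ptR 7, ptT 4] 1)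
    - h (Finsupp.single ![ptT 0, ptR 7, ptR 0] 1) - h (Finsupp.single ![ptR 4, ptR 3, ptT 0] 1)
    - h (Finsupp.single ![ptR 0, ptR 7, ptT 0] 1)

lemma zeta_re_gt : 0 < 1 + zeta.re := by
  have h : ‖zeta‖ = 1 := zeta_primitive.norm'_eq_one (by norm_num)
  have h1 : |zeta.re| ≤ 1 := h ▸ Complex.abs_re_le_norm zeta
  have h2 : zeta.re ≠ -1 := by
    intro h3
    have h4 : zeta.re * zeta.re + zeta.im * zeta.im = 1 := by
      rw [← Complex.normSq_apply, Complex.normSq_eq_norm_sq, h]; norm_num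
    have h5 : zeta.im = 0 := by rw [h3] at h4; nlinarith
    have h6 : zeta = -1 := Complex.ext (by simpa using h3) (by simpa using h5)
    have h7 := zeta_pow_four
    rw [h6] at h7
    norm_num at h7
  have := (abs_le.1 h1).1
  have := lt_of_le_of_ne this h2.symm
  linarith

lemma zero_notMem_joinSimplex (d : ℕ) :
    (0 : ℂ × ℂ) ∉ convexHull ℝ (Set.range fun i => (joinSimplex d i).1) := by
  let φ : ℂ × ℂ →ₗ[ℝ] ℝ :=
    { toFun := fun x => ((starRingEnd ℂ) (1 + zeta) * (x.1 + zeta ^ (7 * d) * x.2)).re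
      map_add' := fun x y => by
        rw [← Complex.add_re]; congr 1; simp only [Prod.fst_add, Prod.snd_add]; ring
      map_smul' := fun c x => by
        simp only [Prod.smul_fst, Prod.smul_snd, Complex.real_smul, RingHom.id_apply, smul_eq_mul]
        rw [← Complex.re_ofReal_mul]; congr 1; ring }
  have hzz := star_zeta_mul
  have hd : zeta ^ (7 * d) * zeta ^ d = 1 := by
    rw [← pow_add, show 7 * d + d = 8 * d by ring, pow_mul, zeta_pow_eight, one_pow]
  have h1 : 0 < ((starRingEnd ℂ) (1 + zeta)).re := by
    simpa using zeta_re_gt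
  have h2 : 0 < ((starRingEnd ℂ) (1 + zeta) * zeta).re := by
    have : (starRingEnd ℂ) (1 + zeta) * zeta = 1 + zeta := by
      rw [map_add, map_one]; linear_combination hzz
    rw [this]; simpa using zeta_re_gt
  have hpos : ∀ i, 0 < φ (joinSimplex d i).1 := by
    intro i
    change 0 < ((starRingEnd ℂ) (1 + zeta) * ((joinSimplex d i).1.1 +
      zeta ^ (7 * d) * (joinSimplex d i).1.2)).re
    fin_cases i
    · change 0 < ((starRingEnd ℂ) (1 + zeta) * ((ptT 0).1.1 + zeta ^ (7 * d) * (ptT 0).1.2)).re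
      simpa [ptT_coe] using h1
    · change 0 < ((starRingEnd ℂ) (1 + zeta) * ((ptT 1).1.1 + zeta ^ (7 * d) * (ptT 1).1.2)).re
      simpa [ptT_coe] using h2
    · change 0 < ((starRingEnd ℂ) (1 + zeta) * ((ptR d).1.1 + zeta ^ (7 * d) * (ptR d).1.2)).re
      simpa [ptR_coe, hd] using h1
    · change 0 < ((starRingEnd ℂ) (1 + zeta) *
        ((ptR (d + 1)).1.1 + zeta ^ (7 * d) * (ptR (d + 1)).1.2)).re
      rw [ptR_coe, zero_add, pow_succ, ← mul_assoc (zeta ^ (7 * d)), hd, one_mul]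
      exact h2
  intro h
  have hsub : convexHull ℝ (Set.range fun i => (joinSimplex d i).1) ⊆ {x | 0 < φ x} := by
    refine convexHull_min ?_ (convex_halfSpace_gt φ.isLinear 0)
    rintro _ ⟨i, rfl⟩
    exact hpos i
  have := hsub h
  simp at this

lemma originCount_joinChain {f : Punct → Fin 8} (hT : ∀ x, f (pT x) = labT (f x))
    (hR : ∀ x, f (pR x) = labR (f x)) : originCount f joinChain = 1 := by
  have hr : ∀ d, f (ptR d) = labT^[d] (labR (f (ptT 0))) := by
    intro d
    induction d with
    | zero => rw [← hR, pR_ptT]; rfl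
    | succ d ih => rw [← pT_ptR, hT, ih, Function.iterate_succ_apply']
  rw [← originHit_join (f (ptT 0)), joinChain, map_sum]
  refine Finset.sum_congr rfl fun d _ => ?_
  rw [originCount_single, ← hr, ← hr, ← hT, pT_ptT]
  rfl

/-- An equivariant continuous map from the punctured plane `ℂ × ℂ` to space has a zero. -/
theorem exists_zero_of_equivariant {F : Punct → ℝ × ℝ × ℝ} (hF : Continuous F)
    (hT : ∀ x, F (pT x) = spT (F x)) (hR : ∀ x, F (pR x) = spR (F x)) : ∃ x, F x = 0 := by
  by_contra! hF0
  obtain ⟨f, hfT, hfR, hf⟩ := exists_labelling hT hR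
  obtain ⟨x, y, hxy⟩ := joinChain_bdry
  have hne : ∀ m n : ℕ, (ptT m).1 + (ptR n).1 ≠ 0 := by
    intro m n h
    rw [ptT_coe, ptR_coe, Prod.ext_iff] at h
    exact pow_ne_zero m zeta_ne_zero (by simpa using h.1)
  have h1z : 1 + zeta ≠ 0 := by
    intro h
    have := congrArg Complex.re h
    simp at this
    linarith [zeta_re_gt]
  have hne2 : ∀ n : ℕ, (ptR n).1 + (ptR (n + 1)).1 ≠ 0 := by
    intro n h
    rw [ptR_coe, ptR_coe, Prod.ext_iff] at h
    have h2 : zeta ^ n * (1 + zeta) = 0 := by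
      rw [mul_add, mul_one, ← pow_succ]; simpa using h.2
    exact mul_ne_zero (pow_ne_zero _ zeta_ne_zero) h1z h2
  have hne3 : ∀ n k : ℕ, (ptT 0).1 + (ptR n).1 + (ptR k).1 ≠ 0 := by
    intro n k h
    rw [ptT_coe, ptR_coe, ptR_coe, Prod.ext_iff] at h
    simpa using h.1
  have hne4 : (ptR 7).1 + (ptR 0).1 ≠ 0 := by rw [← ptR_eight]; exact hne2 7
  have a1 := bary_one_swap (hne 0 7)
  have a2 := bary_one_swap (hne 0 0)
  have a3 := bary_one_swap hne4
  have a4 := bary_two_reverse (hne3 7 0)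
  have b1 := bary_one_swap (hne 0 3)
  have b2 := bary_one_swap (hne 0 4)
  have b3 := bary_one_swap (hne2 3)
  have b4 := bary_two_reverse (hne3 3 4)
  have hit := cocycle_sd_iterate (β := bary) bary_pT bary_pR (originCount f) (originCount_bdry f)
    (originCount_push hfT originHit_labT) (originCount_push hfR originHit_labR) hxy
    (by
      rw [map_add, map_add, map_add, sd_three_reverse bary_zero a1 a2 a3 a4,
        sd_three_reverse bary_zero b1 b2 b3 b4, ZModModule.add_self, ZModModule.add_self, add_zero])
    (by
      simp only [map_add]
      rw [originCount_sdHtpy_three_reverse f bary_zero a1 a2 a3 a4,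
        originCount_sdHtpy_three_reverse f bary_zero b1 b2 b3 b4, ZModModule.add_self,
        ZModModule.add_self, add_zero])
  have hev : ∀ᶠ k in atTop, ∀ d ∈ Finset.range 4,
      originCount f ((sd bary 4)^[k] (Finsupp.single (joinSimplex d) 1)) = 0 :=
    (Filter.eventually_all_finset _).2 fun d _ =>
      eventually_originCount_iterate_sd hF hF0 hf _ (zero_notMem_joinSimplex d)
  obtain ⟨k, hk⟩ := hev.exists
  have h1 := hit k
  rw [originCount_joinChain hfT hfR, joinChain] at h1
  have h2 : (sd bary (3 + 1))^[k] (∑ d ∈ Finset.range 4, Finsupp.single (joinSimplex d) 1) =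
      ∑ d ∈ Finset.range 4, (sd bary 4)^[k] (Finsupp.single (joinSimplex d) 1) := by
    have h3 := map_sum ((sd bary 4) ^ k) (fun d => Finsupp.single (joinSimplex d) (1 : ZMod 2))
      (Finset.range 4)
    simpa only [Module.End.coe_pow] using h3
  rw [h2, map_sum, Finset.sum_eq_zero hk] at h1
  exact zero_ne_one h1

section

/-! ### Definite seminorms on coordinate space -/

variable {n : ℕ}

/-- A seminorm vanishing only at the origin. -/
def IsDef {E : Type*} [AddCommGroup E] [Module ℝ E] (p : Seminorm ℝ E) : Prop :=
  ∀ x, p x = 0 → x = 0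

lemma seminorm_continuous (p : Seminorm ℝ (Fin n → ℝ)) : Continuous p := by
  have h := p.convexOn.locallyLipschitz
  exact h.continuous

lemma exists_upper (p : Seminorm ℝ (Fin n → ℝ)) : ∃ C, 0 < C ∧ ∀ x, p x ≤ C * ‖x‖ :=
  Seminorm.bound_of_continuous_normedSpace p (seminorm_continuous p)

lemma exists_lower (p : Seminorm ℝ (Fin n → ℝ)) (hp : IsDef p) :
    ∃ c, 0 < c ∧ ∀ x, c * ‖x‖ ≤ p x := by
  rcases isEmpty_or_nonempty (Metric.sphere (0 : Fin n → ℝ) 1) with he | ⟨⟨y, hy⟩⟩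
  · refine ⟨1, one_pos, fun x => ?_⟩
    have hx : x = 0 := by
      by_contra hx
      exact he.elim ⟨‖x‖⁻¹ • x, by simp [norm_smul, norm_ne_zero_iff.2 hx]⟩
    simp [hx]
  obtain ⟨z, hz, hmin⟩ := (isCompact_sphere (0 : Fin n → ℝ) 1).exists_isMinOn ⟨y, hy⟩
    (seminorm_continuous p).continuousOn
  have hz0 : z ≠ 0 := by rintro rfl; simp at hz
  refine ⟨p z, lt_of_le_of_ne (apply_nonneg p z) fun h => hz0 (hp z h.symm), fun x => ?_⟩
  rcases eq_or_ne x 0 with rfl | hx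
  · simp
  have hx' : 0 < ‖x‖ := norm_pos_iff.2 hx
  have h := hmin (show ‖x‖⁻¹ • x ∈ Metric.sphere (0 : Fin n → ℝ) 1 by
    simp [norm_smul, hx'.ne'])
  simp only [map_smul_eq_mul, Set.mem_ofPred_eq, norm_inv, norm_norm] at h
  rwa [inv_mul_eq_div, le_div_iff₀ hx'] at h

lemma integrable_exp_neg_mul_norm {c : ℝ} (hc : 0 < c) :
    Integrable fun x : Fin n → ℝ => Real.exp (-(c * ‖x‖)) := by
  set r : ℝ := n + 1 with hr
  have hr0 : 0 < r := by positivity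
  set b : ℝ := min 1 (c / r) with hb
  have hb0 : 0 < b := lt_min one_pos (by positivity)
  have hi : Integrable fun x : Fin n → ℝ => (1 + ‖x‖) ^ (-r) :=
    integrable_one_add_norm (by simp [hr])
  refine (hi.const_mul (b ^ (-r))).mono' (by fun_prop) (Eventually.of_forall fun x => ?_)
  have hx := norm_nonneg x
  rw [Real.norm_of_nonneg (Real.exp_pos _).le, ← Real.mul_rpow hb0.le (by positivity),
    Real.rpow_neg (by positivity), Real.exp_neg]
  refine inv_anti₀ (by positivity) ?_
  have h1 : b * (1 + ‖x‖) ≤ Real.exp (c / r * ‖x‖) := by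
    refine le_trans ?_ (Real.add_one_le_exp _)
    have h2 : b ≤ 1 := min_le_left _ _
    have h3 : b * ‖x‖ ≤ c / r * ‖x‖ := by gcongr; exact min_le_right _ _
    linarith
  calc (b * (1 + ‖x‖)) ^ r ≤ Real.exp (c / r * ‖x‖) ^ r := by gcongr
    _ = Real.exp (c * ‖x‖) := by
      rw [← Real.exp_mul]; congr 1; field_simp

lemma integrable_exp (p : Seminorm ℝ (Fin n → ℝ)) (hp : IsDef p) :
    Integrable fun x => Real.exp (-p x) := by
  obtain ⟨c, hc, h⟩ := exists_lower p hp
  refine (integrable_exp_neg_mul_norm hc).mono' ?_ (Eventually.of_forall fun x => ?_)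
  · exact (Real.continuous_exp.comp (seminorm_continuous p).neg).aestronglyMeasurable
  · rw [Real.norm_of_nonneg (Real.exp_pos _).le]
    exact Real.exp_le_exp.2 (neg_le_neg (h x))

/-- The unit ball of a seminorm. -/
def body (p : Seminorm ℝ (Fin n → ℝ)) : Set (Fin n → ℝ) := {x | p x ≤ 1}

/-- The polar of the unit ball of a seminorm. -/
def pol (p : Seminorm ℝ (Fin n → ℝ)) : Set (Fin n → ℝ) := {y | ∀ x, x ⬝ᵥ y ≤ p x}

lemma integral_exp_pos (p : Seminorm ℝ (Fin n → ℝ)) (hp : IsDef p) :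
    0 < ∫ x, Real.exp (-p x) := by
  rw [integral_pos_iff_support_of_nonneg (fun x => (Real.exp_pos _).le) (integrable_exp p hp)]
  have : (Function.support fun x => Real.exp (-p x)) = Set.univ := by
    ext x; simp [Real.exp_ne_zero]
  rw [this]
  exact isOpen_univ.measure_pos _ Set.univ_nonempty

lemma integral_exp_eq (p : Seminorm ℝ (Fin n → ℝ)) (hp : IsDef p) :
    ∫ x, Real.exp (-p x) = n.factorial * volume.real (body p) := by
  rcases Nat.eq_zero_or_pos n with rfl | hn
  · have h0 : ∀ x, p x = 0 := fun x => by rw [Subsingleton.elim x 0, map_zero]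
    have h1 : body p = Set.univ := by ext x; simp [body, h0]
    simp [h1, h0]
  · have : Nonempty (Fin n) := ⟨⟨0, hn⟩⟩
    have h5 : ∀ (r : ℝ) x, p (r • x) ≤ |r| * p x := fun r x => by
      rw [map_smul_eq_mul, Real.norm_eq_abs]
    have hlt := measure_lt_one_eq_integral_div_gamma (volume : Measure (Fin n → ℝ)) (g := p)
      (map_zero p) (fun x => map_neg_eq_map p x) (fun x y => map_add_le_add p x y)
      (fun {x} => hp x) h5 one_pos
    have hle := measure_le_eq_lt (volume : Measure (Fin n → ℝ)) (g := p)
      (map_zero p) (fun x => map_neg_eq_map p x) (fun x y => map_add_le_add p x y)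
      (fun {x} => hp x) h5 1
    have : volume.real (body p) = (∫ x, Real.exp (-p x)) / n.factorial := by
      rw [Measure.real, body, hle, hlt, ENNReal.toReal_ofReal]
      · simp [Real.Gamma_nat_eq_factorial]
      · have := (integral_exp_pos p hp).le
        simp only [Real.rpow_one]
        refine div_nonneg this (Real.Gamma_nonneg_of_nonneg (by positivity))
    rw [this]
    field_simp

end

section

/-! ### Coordinate sections and slabs -/

variable {n : ℕ}

/-- The inclusion of the coordinate hyperplane `x i = 0`. -/
def ins (i : Fin (n + 1)) : (Fin n → ℝ) →ₗ[ℝ] (Fin (n + 1) → ℝ) where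
  toFun z := i.insertNth (α := fun _ => ℝ) 0 z
  map_add' x y := by
    ext j; refine Fin.succAboveCases i ?_ (fun k => ?_) j <;> simp
  map_smul' c x := by
    ext j; refine Fin.succAboveCases i ?_ (fun k => ?_) j <;> simp

@[simp] lemma ins_same (i : Fin (n + 1)) (z : Fin n → ℝ) : ins i z i = 0 := by simp [ins]

@[simp] lemma ins_succAbove (i : Fin (n + 1)) (z : Fin n → ℝ) (k : Fin n) :
    ins i z (i.succAbove k) = z k := by simp [ins]

lemma ins_injective (i : Fin (n + 1)) : Function.Injective (ins (n := n) i) := fun x y h => by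
  ext k; simpa using congrFun h (i.succAbove k)

lemma IsDef.comp {E F : Type*} [AddCommGroup E] [Module ℝ E] [AddCommGroup F] [Module ℝ F]
    {p : Seminorm ℝ F} (hp : IsDef p) {A : E →ₗ[ℝ] F} (hA : Function.Injective A) :
    IsDef (p.comp A) := fun x hx => hA (by rw [hp _ hx, map_zero])

lemma setIntegral_Ici_shift (y : Fin n → ℝ) (f : (Fin n → ℝ) → ℝ) :
    ∫ z in Set.Ici y, f z = ∫ z in Set.Ici 0, f (z + y) := by
  have h := (measurePreserving_add_right volume y).setIntegral_preimage_emb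
    (measurableEmbedding_addRight y) f (Set.Ici y)
  rw [← h]
  congr 2
  ext z; simp

/-- The slab of `z ≥ 0` whose `i`-th coordinate is less than `y i`, and the others are not. -/
def slab (y : Fin (n + 1) → ℝ) (i : Fin (n + 1)) : Set (Fin (n + 1) → ℝ) :=
  MeasurableEquiv.piFinSuccAbove (fun _ => ℝ) i ⁻¹' (Set.Ico 0 (y i) ×ˢ Set.Ici (i.removeNth y))

lemma mem_slab {y z : Fin (n + 1) → ℝ} {i : Fin (n + 1)} :
    z ∈ slab y i ↔ (0 ≤ z i ∧ z i < y i) ∧ ∀ j, j ≠ i → y j ≤ z j := by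
  have : (∀ j, j ≠ i → y j ≤ z j) ↔ ∀ k : Fin n, y (i.succAbove k) ≤ z (i.succAbove k) := by
    constructor
    · intro h k
      exact h _ (Fin.succAbove_ne i k)
    · intro h j hj
      obtain ⟨k, rfl⟩ := Fin.exists_succAbove_eq hj
      exact h k
  rw [this]
  simp [slab, MeasurableEquiv.piFinSuccAbove, Fin.insertNthEquiv, Pi.le_def, Fin.removeNth]

lemma measurableSet_slab (y : Fin (n + 1) → ℝ) (i : Fin (n + 1)) : MeasurableSet (slab y i) :=
  (MeasurableEquiv.measurable _) (measurableSet_Ico.prod measurableSet_Ici)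

lemma slab_integral_ge (q : Seminorm ℝ (Fin (n + 1) → ℝ)) (hq : IsDef q) {C : ℝ} (hC0 : 0 < C)
    (hC : ∀ x, q x ≤ C * ‖x‖) {y : Fin (n + 1) → ℝ} (hy : 0 ≤ y) (i : Fin (n + 1)) :
    y i * (Real.exp (-(C * ‖y‖)) * ∫ z in Set.Ici 0, Real.exp (-q.comp (ins i) z)) ≤
      ∫ z in slab y i, Real.exp (-q z) := by
  have hmp := volume_preserving_piFinSuccAbove (fun _ : Fin (n + 1) => ℝ) i
  have h1 := hmp.symm.setIntegral_preimage_emb (MeasurableEquiv.measurableEmbedding _)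
    (fun z => Real.exp (-q z)) (slab y i)
  have hpre : (MeasurableEquiv.piFinSuccAbove (fun _ => ℝ) i).symm ⁻¹' slab y i =
      Set.Ico 0 (y i) ×ˢ Set.Ici (i.removeNth y) := by
    rw [slab, ← Set.preimage_comp]
    simp
  rw [← h1, hpre]
  have hS : IntegrableOn (fun z => Real.exp (-q.comp (ins i) (z - i.removeNth y)))
      (Set.Ici (i.removeNth y)) :=
    ((integrable_exp _ (hq.comp (ins_injective i))).comp_sub_right (i.removeNth y)).integrableOn
  have h2 : y i * (Real.exp (-(C * ‖y‖)) * ∫ z in Set.Ici 0, Real.exp (-q.comp (ins i) z)) =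
      ∫ w in Set.Ico 0 (y i) ×ˢ Set.Ici (i.removeNth y), Real.exp (-(C * ‖y‖)) *
        Real.exp (-q.comp (ins i) (w.2 - i.removeNth y)) := by
    have := setIntegral_prod_mul (μ := (volume : Measure ℝ)) (ν := (volume : Measure (Fin n → ℝ)))
      (fun _ => Real.exp (-(C * ‖y‖)))
      (fun z => Real.exp (-q.comp (ins i) (z - i.removeNth y)))
      (Set.Ico 0 (y i)) (Set.Ici (i.removeNth y))
    rw [Measure.volume_eq_prod, this, setIntegral_Ici_shift (i.removeNth y)]
    have := hy i
    simp only [Pi.zero_apply] at this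
    simp [this, mul_assoc]
  rw [h2]
  refine setIntegral_mono_on ?_ ?_ (measurableSet_Ico.prod measurableSet_Ici) ?_
  · have : Integrable (fun _ : ℝ => Real.exp (-(C * ‖y‖)))
        (volume.restrict (Set.Ico 0 (y i))) := integrable_const _
    have := this.mul_prod hS
    rw [IntegrableOn, Measure.volume_eq_prod, ← Measure.prod_restrict]
    exact this
  · refine Integrable.integrableOn ?_
    exact (hmp.symm.integrable_comp_emb (MeasurableEquiv.measurableEmbedding _)).2
      (integrable_exp q hq)
  · rintro ⟨t, z⟩ ⟨⟨ht0, ht⟩, hz⟩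
    simp only at ht0 ht hz ⊢
    rw [← Real.exp_add]
    refine Real.exp_le_exp.2 ?_
    have hdec : (MeasurableEquiv.piFinSuccAbove (fun _ => ℝ) i).symm (t, z) =
        ins i (z - i.removeNth y) + i.insertNth (α := fun _ => ℝ) t (i.removeNth y) := by
      change i.insertNth (α := fun _ => ℝ) t z = _
      ext j
      refine Fin.succAboveCases i ?_ (fun k => ?_) j <;> simp [Fin.removeNth]
    rw [hdec]
    have h3 := map_add_le_add q (ins i (z - i.removeNth y))
      (i.insertNth (α := fun _ => ℝ) t (i.removeNth y))
    have h4 := hC (i.insertNth (α := fun _ => ℝ) t (i.removeNth y))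
    have h5 : ‖i.insertNth (α := fun _ => ℝ) t (i.removeNth y)‖ ≤ ‖y‖ := by
      refine (pi_norm_le_iff_of_nonneg (norm_nonneg _)).2 fun j => ?_
      refine Fin.succAboveCases i ?_ (fun k => ?_) j
      · rw [Fin.insertNth_apply_same]
        refine le_trans ?_ (norm_le_pi_norm y i)
        rw [Real.norm_of_nonneg ht0, Real.norm_of_nonneg (ht0.trans ht.le)]
        exact ht.le
      · rw [Fin.insertNth_apply_succAbove]
        exact norm_le_pi_norm y _
    have h6 := mul_le_mul_of_nonneg_left h5 hC0.le
    rw [Seminorm.comp_apply]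
    linarith

lemma sum_slab_le (q : Seminorm ℝ (Fin (n + 1) → ℝ)) (hq : IsDef q) {C : ℝ} (hC0 : 0 < C)
    (hC : ∀ x, q x ≤ C * ‖x‖) {y : Fin (n + 1) → ℝ} (hy : 0 ≤ y) :
    ∑ i, y i * (Real.exp (-(C * ‖y‖)) * ∫ z in Set.Ici 0, Real.exp (-q.comp (ins i) z)) ≤
      q y * ∫ z in Set.Ici 0, Real.exp (-q z) := by
  have hexp := integrable_exp q hq
  have hdisj : Pairwise (Function.onFun Disjoint (slab y)) := by
    intro i j hij
    refine Set.disjoint_left.2 fun z hzi hzj => ?_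
    rw [mem_slab] at hzi hzj
    exact absurd hzi.1.2 (not_lt.2 (hzj.2 i hij))
  have hsum : ∑ i, ∫ z in slab y i, Real.exp (-q z) = ∫ z in ⋃ i, slab y i, Real.exp (-q z) :=
    (integral_iUnion_fintype (fun i => measurableSet_slab y i) hdisj
      (fun i => hexp.integrableOn)).symm
  have hd2 : Disjoint (⋃ i, slab y i) (Set.Ici y) := by
    refine Set.disjoint_left.2 fun z hz hzy => ?_
    obtain ⟨i, hi⟩ := Set.mem_iUnion.1 hz
    exact absurd (mem_slab.1 hi).1.2 (not_lt.2 (hzy i))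
  have hun := setIntegral_union hd2 measurableSet_Ici hexp.integrableOn hexp.integrableOn
  have hsub : (⋃ i, slab y i) ∪ Set.Ici y ⊆ Set.Ici 0 := by
    rintro z (hz | hz)
    · obtain ⟨i, hi⟩ := Set.mem_iUnion.1 hz
      rw [mem_slab] at hi
      intro j
      by_cases hj : j = i
      · subst hj; exact hi.1.1
      · exact (hy j).trans (hi.2 j hj)
    · exact hy.trans hz
  have hle : ∫ z in (⋃ i, slab y i) ∪ Set.Ici y, Real.exp (-q z) ≤
      ∫ z in Set.Ici 0, Real.exp (-q z) :=
    setIntegral_mono_set hexp.integrableOn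
      (Eventually.of_forall fun z => (Real.exp_pos _).le) hsub.eventuallyLE
  have hshift : Real.exp (-q y) * ∫ z in Set.Ici 0, Real.exp (-q z) ≤
      ∫ z in Set.Ici y, Real.exp (-q z) := by
    rw [setIntegral_Ici_shift y, ← integral_const_mul]
    refine integral_mono (hexp.const_mul _).integrableOn
      (hexp.comp_add_right y).integrableOn fun z => ?_
    simp only
    rw [← Real.exp_add]
    refine Real.exp_le_exp.2 ?_
    have := map_add_le_add q z y
    linarith
  have hI : 0 ≤ ∫ z in Set.Ici 0, Real.exp (-q z) := integral_nonneg fun z => (Real.exp_pos _).le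
  have hexp := Real.add_one_le_exp (-q y)
  calc _ ≤ ∑ i, ∫ z in slab y i, Real.exp (-q z) :=
        Finset.sum_le_sum fun i _ => slab_integral_ge q hq hC0 hC hy i
    _ ≤ _ := by
      rw [hsum]
      nlinarith

lemma orthant_estimate (q : Seminorm ℝ (Fin (n + 1) → ℝ)) (hq : IsDef q)
    {x : Fin (n + 1) → ℝ} (hx : 0 ≤ x) :
    ∑ i, x i * ∫ z in Set.Ici 0, Real.exp (-q.comp (ins i) z) ≤
      q x * ∫ z in Set.Ici 0, Real.exp (-q z) := by
  obtain ⟨C, hC0, hC⟩ := exists_upper q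
  set S := ∑ i, x i * ∫ z in Set.Ici 0, Real.exp (-q.comp (ins i) z) with hS
  have hlim : Tendsto (fun t : ℝ => Real.exp (-(C * (t * ‖x‖))) * S) (𝓝[>] 0) (𝓝 S) := by
    have : Continuous fun t : ℝ => Real.exp (-(C * (t * ‖x‖))) * S := by fun_prop
    have h := this.tendsto 0
    simp only [zero_mul, mul_zero, neg_zero, Real.exp_zero, one_mul] at h
    exact h.mono_left nhdsWithin_le_nhds
  refine le_of_tendsto hlim ?_
  filter_upwards [self_mem_nhdsWithin] with t ht
  have ht : 0 < t := ht
  have h := sum_slab_le q hq hC0 hC (y := t • x) (smul_nonneg ht.le hx)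
  rw [map_smul_eq_mul, norm_smul, Real.norm_of_nonneg ht.le, mul_assoc] at h
  have h2 : ∑ i, (t • x) i * (Real.exp (-(C * (t * ‖x‖))) *
      ∫ z in Set.Ici 0, Real.exp (-q.comp (ins i) z)) =
      t * (Real.exp (-(C * (t * ‖x‖))) * S) := by
    rw [hS, Finset.mul_sum, Finset.mul_sum]
    refine Finset.sum_congr rfl fun i _ => ?_
    simp only [Pi.smul_apply, smul_eq_mul]; ring
  rw [h2] at h
  exact le_of_mul_le_mul_left h ht

/-- A sign vector. -/
def IsSign (ε : Fin n → ℝ) : Prop := ∀ i, ε i = 1 ∨ ε i = -1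

/-- All orthants carry the same integral of `exp (-p)`. -/
def Balanced (p : Seminorm ℝ (Fin n → ℝ)) : Prop :=
  ∀ ε : Fin n → ℝ, IsSign ε →
    2 ^ n * ∫ x in Set.Ici 0, Real.exp (-p (ε * x)) = ∫ x, Real.exp (-p x)

/-- `p` and all its coordinate sections are balanced. -/
def Equi (p : Seminorm ℝ (Fin (n + 1) → ℝ)) : Prop :=
  Balanced p ∧ ∀ i, Balanced (p.comp (ins i))

lemma Equi.sum_le {p : Seminorm ℝ (Fin (n + 1) → ℝ)} (he : Equi p) (hp : IsDef p)
    (x : Fin (n + 1) → ℝ) :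
    2 * ∑ i, |x i| * ∫ z, Real.exp (-p.comp (ins i) z) ≤ p x * ∫ z, Real.exp (-p z) := by
  set ε : Fin (n + 1) → ℝ := fun i => if 0 ≤ x i then 1 else -1 with hε
  have hεs : IsSign ε := fun i => by by_cases h : 0 ≤ x i <;> simp [hε, h]
  have hεm : ∀ i, ε i * ε i = 1 := fun i => by rcases hεs i with h | h <;> simp [h]
  have hεx : ε * (fun i => |x i|) = x := by
    ext i; by_cases h : 0 ≤ x i
    · simp [hε, h, abs_of_nonneg h]
    · simp [hε, h, abs_of_neg (not_le.1 h)]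
  let L : (Fin (n + 1) → ℝ) →ₗ[ℝ] (Fin (n + 1) → ℝ) := LinearMap.mulLeft ℝ ε
  have hL : Function.Injective L := fun a b h => by
    ext i
    have := congrFun h i
    simp only [L, LinearMap.mulLeft_apply, Pi.mul_apply] at this
    have h2 := congrArg (ε i * ·) this
    simpa only [← mul_assoc, hεm, one_mul] using h2
  have h := orthant_estimate (p.comp L) (hp.comp hL) (x := fun i => |x i|)
    (fun i => abs_nonneg _)
  have h1 : (p.comp L) (fun i => |x i|) = p x := by simp [L, hεx]
  rw [h1] at h
  have h2 : 2 ^ (n + 1) * ∫ z in Set.Ici 0, Real.exp (-(p.comp L) z) = _ := he.1 ε hεs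
  have h3 : ∀ i, 2 ^ n * ∫ z in Set.Ici 0, Real.exp (-(p.comp L).comp (ins i) z) =
      ∫ z, Real.exp (-p.comp (ins i) z) := by
    intro i
    rw [← he.2 i (i.removeNth ε) (fun k => hεs _)]
    congr 2
    ext z
    have : L (ins i z) = ins i (i.removeNth ε * z) := by
      ext j
      refine Fin.succAboveCases i ?_ (fun k => ?_) j <;> simp [L, Fin.removeNth]
    simp only [Seminorm.comp_apply, this]
  rw [← h2]
  simp_rw [← h3]
  have h4 : ∑ i, |x i| * (2 ^ n * ∫ z in Set.Ici 0, Real.exp (-(p.comp L).comp (ins i) z)) =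
      2 ^ n * ∑ i, |x i| * ∫ z in Set.Ici 0, Real.exp (-(p.comp L).comp (ins i) z) := by
    rw [Finset.mul_sum]; exact Finset.sum_congr rfl fun i _ => by ring
  rw [h4, pow_succ]
  have : (0 : ℝ) < 2 ^ n := by positivity
  nlinarith

end

section

/-! ### Thickening a compact set along coordinate directions -/

variable {n : ℕ}

lemma volume_add_Icc_ge {S : Set ℝ} (hS : IsCompact S) (hne : S.Nonempty) {t : ℝ} (ht : 0 ≤ t) :
    volume S + ENNReal.ofReal (2 * t) ≤ volume (S + Set.Icc (-t) t) := by
  obtain ⟨M, hM, hMub⟩ := hS.exists_isGreatest hne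
  obtain ⟨m, hm, hmlb⟩ := hS.exists_isLeast hne
  have h1 : Disjoint S (Set.Ioc M (M + t)) :=
    Set.disjoint_left.2 fun x hx hx' => absurd (hMub hx) (not_le.2 hx'.1)
  have h2 : Disjoint (S ∪ Set.Ioc M (M + t)) (Set.Ico (m - t) m) := by
    refine Set.disjoint_left.2 fun x hx hx' => ?_
    rcases hx with hx | hx
    · exact absurd (hmlb hx) (not_le.2 hx'.2)
    · have := hmlb hM
      exact absurd hx'.2 (not_lt.2 (this.trans hx.1.le))
  have h3 : S ∪ Set.Ioc M (M + t) ∪ Set.Ico (m - t) m ⊆ S + Set.Icc (-t) t := by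
    rintro x ((hx | hx) | hx)
    · exact ⟨x, hx, 0, ⟨by linarith, ht⟩, by simp⟩
    · exact ⟨M, hM, x - M, ⟨by linarith [hx.1], by linarith [hx.2]⟩, by simp⟩
    · exact ⟨m, hm, x - m, ⟨by linarith [hx.1], by linarith [hx.2]⟩, by simp⟩
  refine le_trans (le_of_eq ?_) (measure_mono h3)
  rw [measure_union h2 measurableSet_Ico, measure_union h1 measurableSet_Ioc, Real.volume_Ioc,
    Real.volume_Ico, add_assoc, ← ENNReal.ofReal_add (by linarith) (by linarith)]
  congr 2; ring

/-- The sum of `D` and the segment `[-t, t]` in direction `i`. -/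
def thick (i : Fin (n + 1)) (t : ℝ) (D : Set (Fin (n + 1) → ℝ)) : Set (Fin (n + 1) → ℝ) :=
  (fun w : (Fin (n + 1) → ℝ) × ℝ => w.1 + Pi.single i w.2) '' (D ×ˢ Set.Icc (-t) t)

lemma isCompact_thick (i : Fin (n + 1)) (t : ℝ) {D : Set (Fin (n + 1) → ℝ)} (hD : IsCompact D) :
    IsCompact (thick i t D) :=
  (hD.prod isCompact_Icc).image (continuous_fst.add
    ((continuous_single (A := fun _ => ℝ) i).comp continuous_snd))

lemma volume_eq_lintegral_fibre (i : Fin (n + 1)) {D : Set (Fin (n + 1) → ℝ)}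
    (hD : IsCompact D) :
    volume D = ∫⁻ z : Fin n → ℝ, volume {r : ℝ | i.insertNth (α := fun _ => ℝ) r z ∈ D} := by
  have hmp := (volume_preserving_piFinSuccAbove (fun _ : Fin (n + 1) => ℝ) i).symm
  have hm : MeasurableSet ((MeasurableEquiv.piFinSuccAbove (fun _ => ℝ) i).symm ⁻¹' D) :=
    (MeasurableEquiv.measurable _) hD.measurableSet
  rw [← hmp.measure_preimage_equiv D, Measure.volume_eq_prod, Measure.prod_apply_symm hm]
  rfl

lemma continuous_insertNth_left (i : Fin (n + 1)) (z : Fin n → ℝ) :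
    Continuous fun r : ℝ => i.insertNth (α := fun _ => ℝ) r z := by
  refine continuous_pi fun j => ?_
  refine Fin.succAboveCases i ?_ (fun k => ?_) j
  · simpa using continuous_id'
  · simpa using continuous_const

lemma volume_thick_ge (i : Fin (n + 1)) {t : ℝ} (ht : 0 ≤ t) {D : Set (Fin (n + 1) → ℝ)}
    (hD : IsCompact D) :
    volume D + ENNReal.ofReal (2 * t) * volume (i.removeNth '' D) ≤ volume (thick i t D) := by
  have hP : MeasurableSet (i.removeNth '' D) := by
    refine (hD.image ?_).measurableSet
    exact continuous_pi fun k => continuous_apply _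
  rw [volume_eq_lintegral_fibre i hD, volume_eq_lintegral_fibre i (isCompact_thick i t hD),
    ← lintegral_indicator_const hP, ← lintegral_add_right _ (measurable_const.indicator hP)]
  refine lintegral_mono fun z => ?_
  simp only
  by_cases hz : z ∈ i.removeNth '' D
  · rw [Set.indicator_of_mem hz]
    obtain ⟨w, hw, rfl⟩ := hz
    refine (volume_add_Icc_ge (S := {r : ℝ | i.insertNth (α := fun _ => ℝ) r (i.removeNth w) ∈ D})
      ?_ ⟨w i, by simpa using hw⟩ ht).trans (measure_mono ?_)
    · obtain ⟨R, hR⟩ := hD.isBounded.exists_norm_le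
      refine Metric.isCompact_of_isClosed_isBounded
        (hD.isClosed.preimage (continuous_insertNth_left i _)) ?_
      refine isBounded_iff_forall_norm_le.2 ⟨R, fun r hr => ?_⟩
      refine le_trans ?_ (hR _ hr)
      simpa using norm_le_pi_norm (i.insertNth (α := fun _ => ℝ) r (i.removeNth w)) i
    · rintro _ ⟨r, hr, s, hs, rfl⟩
      refine ⟨(i.insertNth (α := fun _ => ℝ) r (i.removeNth w), s), ⟨hr, hs⟩, ?_⟩
      ext j
      refine Fin.succAboveCases i ?_ (fun k => ?_) j <;> simp [Fin.removeNth]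
  · rw [Set.indicator_of_notMem hz, add_zero]
    refine measure_mono fun r hr => ⟨(i.insertNth (α := fun _ => ℝ) r z, 0),
      ⟨hr, by simpa using ht⟩, by simp⟩

lemma exists_thickening {C : Set (Fin (n + 1) → ℝ)} (hC : IsCompact C) {q : Fin (n + 1) → ℝ}
    (hq : 0 ≤ q) (F : Finset (Fin (n + 1))) :
    ∃ D, IsCompact D ∧ C ⊆ D ∧
      (∀ z ∈ D, ∃ c ∈ C, (∀ i ∈ F, |z i - c i| ≤ q i) ∧ ∀ i ∉ F, z i = c i) ∧
      volume C + ∑ i ∈ F, ENNReal.ofReal (2 * q i) * volume (i.removeNth '' C) ≤ volume D := by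
  induction F using Finset.induction_on with
  | empty => exact ⟨C, hC, subset_rfl, fun z hz => ⟨z, hz, by simp, by simp⟩, by simp⟩
  | insert a F ha ih =>
    obtain ⟨D, hD, hCD, hDF, hvol⟩ := ih
    refine ⟨thick a (q a) D, isCompact_thick _ _ hD, ?_, ?_, ?_⟩
    · exact fun z hz => ⟨(z, 0), ⟨hCD hz, by simpa using hq a⟩, by simp⟩
    · rintro _ ⟨⟨w, s⟩, ⟨hw, hs⟩, rfl⟩
      obtain ⟨c, hc, h1, h2⟩ := hDF w hw
      refine ⟨c, hc, fun i hi => ?_, fun i hi => ?_⟩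
      · rcases Finset.mem_insert.1 hi with rfl | hi
        · have : w i = c i := h2 _ ha
          simpa [this, abs_le] using hs
        · have : i ≠ a := fun h => ha (h ▸ hi)
          simpa [this] using h1 i hi
      · rw [Finset.mem_insert, not_or] at hi
        simpa [hi.1] using h2 i hi.2
    · rw [Finset.sum_insert ha]
      refine le_trans ?_ (volume_thick_ge a (hq a) hD)
      calc _ = (volume C + ∑ i ∈ F, ENNReal.ofReal (2 * q i) * volume (i.removeNth '' C)) +
            ENNReal.ofReal (2 * q a) * volume (a.removeNth '' C) := by ring
        _ ≤ _ := by gcongr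

/-! ### The polar body -/

lemma isCompact_pol (p : Seminorm ℝ (Fin n → ℝ)) : IsCompact (pol p) := by
  refine Metric.isCompact_of_isClosed_isBounded ?_ ?_
  · rw [pol, Set.ofPred_forall]
    exact isClosed_iInter fun x => isClosed_le (by fun_prop) continuous_const
  · obtain ⟨C, hC0, hC⟩ := exists_upper p
    refine isBounded_iff_forall_norm_le.2 ⟨C, fun y hy => ?_⟩
    refine (pi_norm_le_iff_of_nonneg hC0.le).2 fun i => ?_
    have key : ∀ s : ℝ, |s| = 1 → s * y i ≤ C := fun s hs => by
      have h1 := hy (Pi.single i s)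
      have h2 := hC (Pi.single i s)
      rw [single_dotProduct] at h1
      have h3 : ‖(Pi.single i s : Fin n → ℝ)‖ = 1 := by
        rw [Pi.norm_single, Real.norm_eq_abs, hs]
      rw [h3, mul_one] at h2
      exact h1.trans h2
    rw [Real.norm_eq_abs, abs_le]
    have h1 := key 1 (by simp)
    have h2 := key (-1) (by simp)
    constructor <;> linarith

lemma pol_comp_ins_subset (p : Seminorm ℝ (Fin (n + 1) → ℝ)) (i : Fin (n + 1)) :
    pol (p.comp (ins i)) ⊆ i.removeNth '' pol p := by
  intro y hy
  let φ : (Fin (n + 1) → ℝ) →ₗ[ℝ] ℝ :=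
    { toFun := fun x => i.removeNth (α := fun _ => ℝ) x ⬝ᵥ y
      map_add' := fun a b => by
        rw [← add_dotProduct]; rfl
      map_smul' := fun c a => by
        rw [RingHom.id_apply, ← smul_dotProduct]; rfl }
  let f : (Fin (n + 1) → ℝ) →ₗ.[ℝ] ℝ := ⟨LinearMap.range (ins i), φ.domRestrict _⟩
  have hφ : ∀ x, φ (ins i x) = x ⬝ᵥ y := fun x => by
    simp only [φ, LinearMap.coe_mk, AddHom.coe_mk]
    congr 1; ext k; simp [Fin.removeNth]
  obtain ⟨g, hg, hgp⟩ := exists_extension_of_le_sublinear f p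
    (fun c hc x => by rw [map_smul_eq_mul, Real.norm_of_nonneg hc.le])
    (fun x y => map_add_le_add p x y) (by
      rintro ⟨_, x, rfl⟩
      change φ (ins i x) ≤ p (ins i x)
      rw [hφ]
      exact hy x)
  have hgf : ∀ x, g (ins i x) = x ⬝ᵥ y := fun x => by
    rw [hg ⟨ins i x, x, rfl⟩, ← hφ]; rfl
  refine ⟨fun j => g (Pi.single j 1), fun x => ?_, ?_⟩
  · refine le_trans (le_of_eq ?_) (hgp x)
    rw [LinearMap.pi_apply_eq_sum_univ g x, dotProduct]
    refine Finset.sum_congr rfl fun j _ => ?_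
    rw [smul_eq_mul]; congr 2
    ext k; simp [Pi.single_apply, eq_comm]
  · ext k
    have h1 := hgf (Pi.single k 1)
    rw [single_dotProduct, one_mul] at h1
    rw [← h1, Fin.removeNth]
    congr 1
    ext j
    refine Fin.succAboveCases i ?_ (fun l => ?_) j
    · simp [(Fin.succAbove_ne i k).symm]
    · simp [Pi.single_apply]

lemma dual_estimate (p : Seminorm ℝ (Fin (n + 1) → ℝ)) {q : Fin (n + 1) → ℝ} (hq : 0 ≤ q)
    (hqp : ∀ x, ∑ i, |x i| * q i ≤ p x) :
    2 * ∑ i, q i * volume.real (pol (p.comp (ins i))) ≤ (n + 1) * volume.real (pol p) := by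
  have hfin : ∀ {m : ℕ} (p : Seminorm ℝ (Fin m → ℝ)), volume (pol p) ≠ ∞ := fun p =>
    (isCompact_pol p).measure_lt_top.ne
  set S := 2 * ∑ i, q i * volume.real (pol (p.comp (ins i))) with hS
  have key : ∀ t : ℝ, 0 < t → t * S ≤ ((1 + t) ^ (n + 1) - 1) * volume.real (pol p) := by
    intro t ht
    obtain ⟨D, hD, -, hDF, hvol⟩ := exists_thickening (isCompact_pol p) (q := t • q)
      (smul_nonneg ht.le hq) Finset.univ
    have hsub : D ⊆ (1 + t) • pol p := by
      intro z hz
      obtain ⟨c, hc, h1, -⟩ := hDF z hz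
      have h1t : (0 : ℝ) < 1 + t := by positivity
      refine (Set.mem_smul_set_iff_inv_smul_mem₀ h1t.ne' _ _).2 fun x => ?_
      rw [dotProduct_smul, smul_eq_mul, inv_mul_le_iff₀ h1t]
      have h2 : x ⬝ᵥ (z - c) ≤ t * p x := by
        refine le_trans ?_ (mul_le_mul_of_nonneg_left (hqp x) ht.le)
        rw [Finset.mul_sum, dotProduct]
        refine Finset.sum_le_sum fun i _ => ?_
        calc x i * (z - c) i ≤ |x i * (z - c) i| := le_abs_self _
          _ = |x i| * |z i - c i| := by rw [abs_mul]; rfl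
          _ ≤ |x i| * (t * q i) := by gcongr; exact h1 i (Finset.mem_univ i)
          _ = _ := by ring
      have h3 := hc x
      rw [dotProduct_sub] at h2
      linarith
    have h4 : volume (pol p) + ∑ i, ENNReal.ofReal (2 * (t * q i)) *
        volume (pol (p.comp (ins i))) ≤
        ENNReal.ofReal ((1 + t) ^ (n + 1)) * volume (pol p) := by
      calc _ ≤ volume (pol p) + ∑ i, ENNReal.ofReal (2 * (t • q) i) *
            volume (i.removeNth '' pol p) := by
            exact add_le_add le_rfl (Finset.sum_le_sum fun i _ =>
              mul_le_mul' le_rfl (measure_mono (pol_comp_ins_subset p i)))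
        _ ≤ volume ((1 + t) • pol p) := hvol.trans (measure_mono hsub)
        _ = _ := by
          rw [Measure.addHaar_smul_of_nonneg _ (by positivity)]; simp
    have h5 := ENNReal.toReal_mono (ENNReal.mul_ne_top ENNReal.ofReal_ne_top (hfin p)) h4
    have hne : ∀ i, ENNReal.ofReal (2 * (t * q i)) * volume (pol (p.comp (ins i))) ≠ ∞ :=
      fun i => ENNReal.mul_ne_top ENNReal.ofReal_ne_top (hfin _)
    rw [ENNReal.toReal_add (hfin p) (ENNReal.sum_ne_top.2 fun i _ => hne i),
      ENNReal.toReal_sum fun i _ => hne i, ENNReal.toReal_mul,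
      ENNReal.toReal_ofReal (by positivity)] at h5
    have h6 : ∑ i, (ENNReal.ofReal (2 * (t * q i)) * volume (pol (p.comp (ins i)))).toReal =
        t * S := by
      rw [hS, Finset.mul_sum, Finset.mul_sum]
      refine Finset.sum_congr rfl fun i _ => ?_
      have := hq i
      simp only [Pi.zero_apply] at this
      rw [ENNReal.toReal_mul, ENNReal.toReal_ofReal (by positivity), Measure.real]
      ring
    rw [h6] at h5
    simp only [Measure.real]
    linarith
  have hd : HasDerivAt (fun t : ℝ => (1 + t) ^ (n + 1)) (n + 1) 0 := by
    have := ((hasDerivAt_id' (0 : ℝ)).const_add 1).fun_pow (n + 1)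
    simpa using this
  have hlim := (hasDerivAt_iff_tendsto_slope_zero.1 hd).mono_left
    (nhdsWithin_mono (0 : ℝ) (s := Set.Ioi 0) fun t ht => (ne_of_gt ht : t ≠ 0))
  refine ge_of_tendsto (hlim.mul_const (volume.real (pol p))) ?_
  filter_upwards [self_mem_nhdsWithin] with t ht
  have ht : 0 < t := ht
  have := key t ht
  rw [smul_eq_mul, mul_assoc, inv_mul_eq_div, le_div_iff₀ ht]
  simpa [mul_comm] using this

/-- The induction step: a lower bound for the volume product in dimension `n` yields one in
dimension `n + 1` for equipartitioned bodies. -/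
lemma Equi.volume_product_ge {p : Seminorm ℝ (Fin (n + 1) → ℝ)} (he : Equi p) (hp : IsDef p)
    {m : ℝ} (hm : ∀ q : Seminorm ℝ (Fin n → ℝ), IsDef q →
      m ≤ volume.real (body q) * volume.real (pol q)) :
    4 * m / (n + 1) ≤ volume.real (body p) * volume.real (pol p) := by
  set I := ∫ z, Real.exp (-p z) with hI
  have hI0 : 0 < I := integral_exp_pos p hp
  have hdef : ∀ i, IsDef (p.comp (ins i)) := fun i => hp.comp (ins_injective i)
  have hIV : I = (n + 1).factorial * volume.real (body p) := integral_exp_eq p hp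
  set V := volume.real (body p) with hV
  have hV0 : 0 < V := by
    rw [hIV] at hI0
    exact pos_of_mul_pos_right hI0 (by positivity)
  have hdual := dual_estimate p
    (q := fun i => 2 * (∫ z, Real.exp (-p.comp (ins i) z)) / I)
    (fun i => by have := (integral_exp_pos _ (hdef i)).le; simp only [Pi.zero_apply]; positivity)
    (fun x => by
      have h := he.sum_le hp x
      have : ∑ i, |x i| * (2 * (∫ z, Real.exp (-p.comp (ins i) z)) / I) =
          (2 * ∑ i, |x i| * ∫ z, Real.exp (-p.comp (ins i) z)) / I := by
        rw [Finset.mul_sum, Finset.sum_div]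
        exact Finset.sum_congr rfl fun i _ => by ring
      rw [this, div_le_iff₀ hI0]
      exact h)
  have hterm : ∀ i, 2 * m / ((n + 1) * V) ≤
      2 * (∫ z, Real.exp (-p.comp (ins i) z)) / I * volume.real (pol (p.comp (ins i))) := by
    intro i
    rw [integral_exp_eq _ (hdef i), hIV, Nat.factorial_succ]
    have h := hm _ (hdef i)
    have hf : (0 : ℝ) < n.factorial := by positivity
    push_cast
    rw [div_mul_eq_mul_div, div_le_div_iff₀ (by positivity) (by positivity)]
    have h3 := mul_le_mul_of_nonneg_left h
      (show 0 ≤ 2 * (((n : ℝ) + 1) * n.factorial * V) by positivity)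
    nlinarith
  have hsum : (n + 1) * (2 * m / ((n + 1) * V)) ≤
      ∑ i, 2 * (∫ z, Real.exp (-p.comp (ins i) z)) / I *
        volume.real (pol (p.comp (ins i))) := by
    have := Finset.card_nsmul_le_sum Finset.univ _ _ fun i _ => hterm i
    simpa using this
  have h7 : (n + 1) * (2 * m / ((n + 1) * V)) = 2 * m / V := by field_simp
  rw [h7] at hsum
  have h8 : 2 * (2 * m / V) ≤ (n + 1) * volume.real (pol p) :=
    (mul_le_mul_of_nonneg_left hsum (by norm_num)).trans hdual
  rw [div_le_iff₀ (by positivity)]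
  rw [← mul_div_assoc, div_le_iff₀ hV0] at h8
  linarith

end

section

/-! ### Integrals of sign patterns over frames -/

variable {n k : ℕ}

lemma sign_mul (x y : ℝ) : Real.sign (x * y) = Real.sign x * Real.sign y := by
  rcases lt_trichotomy x 0 with hx | rfl | hx
  · rcases lt_trichotomy y 0 with hy | rfl | hy
    · simp [Real.sign_of_neg, hx, hy, Real.sign_of_pos, mul_pos_of_neg_of_neg]
    · simp
    · simp [Real.sign_of_neg, hx, hy, Real.sign_of_pos, mul_neg_of_neg_of_pos]
  · simp
  · rcases lt_trichotomy y 0 with hy | rfl | hy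
    · simp [Real.sign_of_neg, hx, hy, Real.sign_of_pos, mul_neg_of_pos_of_neg]
    · simp
    · simp [hx, hy, Real.sign_of_pos]

lemma sign_mono : Monotone Real.sign := fun x y h => by
  rcases lt_trichotomy y 0 with hy | rfl | hy
  · simp [Real.sign_of_neg, hy, h.trans_lt hy]
  · rcases h.lt_or_eq with h | rfl
    · simp [Real.sign_of_neg h]
    · simp
  · rw [Real.sign_of_pos hy]
    rcases Real.sign_apply_eq x with h | h | h <;> rw [h] <;> norm_num

lemma measurable_sign : Measurable Real.sign :=
  Measurable.ite measurableSet_Iio measurable_const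
    (Measurable.ite measurableSet_Ioi measurable_const measurable_const)

lemma abs_sign_le (x : ℝ) : |Real.sign x| ≤ 1 := by
  rcases Real.sign_apply_eq x with h | h | h <;> simp [h]

lemma continuousAt_sign {x : ℝ} (hx : x ≠ 0) : ContinuousAt Real.sign x := by
  rcases hx.lt_or_gt with h | h
  · refine (continuousAt_const (y := (-1 : ℝ))).congr ?_
    filter_upwards [Iio_mem_nhds h] with y hy using (Real.sign_of_neg hy).symm
  · refine (continuousAt_const (y := (1 : ℝ))).congr ?_
    filter_upwards [Ioi_mem_nhds h] with y hy using (Real.sign_of_pos hy).symm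

/-- The linear map with coefficients the vectors of a frame. -/
abbrev lin (a : Fin k → Fin n → ℝ) : (Fin k → ℝ) →ₗ[ℝ] (Fin n → ℝ) := Fintype.linearCombination ℝ a

/-- The integral of the weight `w` against `exp (-p)` in the coordinates of a frame. -/
def wint (p : Seminorm ℝ (Fin n → ℝ)) (w : (Fin k → ℝ) → ℝ) (a : Fin k → Fin n → ℝ) : ℝ :=
  ∫ η, w η * Real.exp (-p (lin a η))

/-- A bounded measurable weight. -/
def IsWeight (w : (Fin k → ℝ) → ℝ) : Prop := Measurable w ∧ ∀ η, |w η| ≤ 1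

lemma IsDef.lin {p : Seminorm ℝ (Fin n → ℝ)} (hp : IsDef p) {a : Fin k → Fin n → ℝ}
    (ha : LinearIndependent ℝ a) : IsDef (p.comp (lin a)) :=
  hp.comp (linearIndependent_iff_injective_fintypeLinearCombination.1 ha)

lemma measurable_weight_mul (p : Seminorm ℝ (Fin n → ℝ)) {w : (Fin k → ℝ) → ℝ}
    (hw : IsWeight w) (a : Fin k → Fin n → ℝ) :
    Measurable fun η => w η * Real.exp (-p (lin a η)) :=
  hw.1.mul (Real.continuous_exp.comp (seminorm_continuous (p.comp (lin a))).neg).measurable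

lemma integrable_weight_mul {p : Seminorm ℝ (Fin n → ℝ)} (hp : IsDef p) {w : (Fin k → ℝ) → ℝ}
    (hw : IsWeight w) {a : Fin k → Fin n → ℝ} (ha : LinearIndependent ℝ a) :
    Integrable fun η => w η * Real.exp (-p (lin a η)) := by
  refine (integrable_exp _ (hp.lin ha)).mono'
    (measurable_weight_mul p hw a).aestronglyMeasurable (Eventually.of_forall fun η => ?_)
  rw [Real.norm_eq_abs, abs_mul, abs_of_pos (Real.exp_pos _), Seminorm.comp_apply]
  exact mul_le_of_le_one_left (Real.exp_pos _).le (hw.2 η)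

lemma continuousAt_wint {p : Seminorm ℝ (Fin n → ℝ)} (hp : IsDef p) {w : (Fin k → ℝ) → ℝ}
    (hw : IsWeight w) {a : Fin k → Fin n → ℝ} (ha : LinearIndependent ℝ a) :
    ContinuousAt (wint p w) a := by
  obtain ⟨c, hc, hcp⟩ := exists_lower _ (hp.lin ha)
  obtain ⟨C, hC, hCp⟩ := exists_upper p
  refine continuousAt_of_dominated (bound := fun η => Real.exp (-(c / 2 * ‖η‖)))
    (Eventually.of_forall fun b => (measurable_weight_mul p hw b).aestronglyMeasurable) ?_
    (integrable_exp_neg_mul_norm (by positivity)) (Eventually.of_forall fun η => ?_)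
  · have hδ : 0 < c / (2 * C * (k + 1)) := by positivity
    filter_upwards [Metric.ball_mem_nhds a hδ] with b hb
    refine Eventually.of_forall fun η => ?_
    rw [Real.norm_eq_abs, abs_mul, abs_of_pos (Real.exp_pos _)]
    refine (mul_le_of_le_one_left (Real.exp_pos _).le (hw.2 η)).trans (Real.exp_le_exp.2 ?_)
    have h1 : p (lin a η) ≤ p (lin b η) + p (lin (b - a) η) := by
      have : lin a η = lin b η - lin (b - a) η := by
        simp [lin, Fintype.linearCombination_apply, smul_sub, Finset.sum_sub_distrib]
      rw [this]
      exact map_sub_le_add p _ _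
    have h2 : ‖lin (b - a) η‖ ≤ k * (‖η‖ * (c / (2 * C * (k + 1)))) := by
      rw [lin, Fintype.linearCombination_apply]
      refine (norm_sum_le _ _).trans ?_
      refine (Finset.sum_le_card_nsmul _ _ (‖η‖ * (c / (2 * C * (k + 1)))) fun i _ => ?_).trans
        (by simp)
      rw [norm_smul]
      have h3 := norm_le_pi_norm η i
      have h4 : ‖(b - a) i‖ ≤ c / (2 * C * (k + 1)) :=
        (norm_le_pi_norm (b - a) i).trans (mem_ball_iff_norm.1 hb).le
      gcongr
    have h3 : p (lin (b - a) η) ≤ c / 2 * ‖η‖ := by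
      refine ((hCp _).trans (mul_le_mul_of_nonneg_left h2 hC.le)).trans ?_
      have : C * (k * (‖η‖ * (c / (2 * C * (k + 1))))) = c / 2 * ‖η‖ * (k / (k + 1)) := by
        field_simp
      rw [this]
      refine mul_le_of_le_one_right (by positivity) ?_
      rw [div_le_one (by positivity)]
      linarith
    have h4 := hcp η
    rw [Seminorm.comp_apply] at h4
    linarith
  · refine Continuous.continuousAt (continuous_const.mul (Real.continuous_exp.comp ?_))
    refine ((seminorm_continuous p).comp ?_).neg
    simp only [lin, Fintype.linearCombination_apply]
    fun_prop

lemma continuous_wint {X : Type*} [TopologicalSpace X] {p : Seminorm ℝ (Fin n → ℝ)}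
    (hp : IsDef p) {w : (Fin k → ℝ) → ℝ} (hw : IsWeight w) {a : X → Fin k → Fin n → ℝ}
    (ha : Continuous a) (hli : ∀ x, LinearIndependent ℝ (a x)) :
    Continuous fun x => wint p w (a x) :=
  continuous_iff_continuousAt.2 fun x =>
    ContinuousAt.comp (f := a) (x := x) (continuousAt_wint hp hw (hli x)) ha.continuousAt

lemma exists_continuous_root {X : Type*} [TopologicalSpace X] {M : X → ℝ → ℝ}
    (hx : ∀ t, Continuous fun x => M x t) (ht : ∀ x, Continuous (M x))
    (hanti : ∀ x, Antitone (M x)) (hpos : ∀ x, ∃ t, 0 < M x t) (hneg : ∀ x, ∃ t, M x t < 0)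
    (huniq : ∀ x t t', M x t = 0 → M x t' = 0 → t = t') :
    ∃ τ : X → ℝ, Continuous τ ∧ ∀ x, M x (τ x) = 0 := by
  have hex : ∀ x, ∃ t, M x t = 0 := fun x => by
    obtain ⟨a, ha⟩ := hpos x
    obtain ⟨b, hb⟩ := hneg x
    exact mem_range_of_exists_le_of_exists_ge (ht x) ⟨b, hb.le⟩ ⟨a, ha.le⟩
  choose τ hτ using hex
  refine ⟨τ, continuous_iff_continuousAt.2 fun x => ?_, hτ⟩
  refine tendsto_order.2 ⟨fun b hb => ?_, fun b hb => ?_⟩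
  · have h1 : 0 < M x b := lt_of_le_of_ne ((hτ x).symm.le.trans (hanti x hb.le))
      fun h => hb.ne (huniq x _ _ h.symm (hτ x))
    filter_upwards [(hx b).continuousAt.eventually (lt_mem_nhds h1)] with y hy
    by_contra hc
    exact absurd ((hanti y (not_lt.1 hc)).trans (hτ y).le) (not_le.2 hy)
  · have h1 : M x b < 0 := lt_of_le_of_ne ((hanti x hb.le).trans (hτ x).le)
      fun h => hb.ne (huniq x _ _ (hτ x) h)
    filter_upwards [(hx b).continuousAt.eventually (gt_mem_nhds h1)] with y hy
    by_contra hc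
    exact absurd ((hτ y).symm.le.trans (hanti y (not_lt.1 hc))) (not_le.2 hy)

/-- A function whose level sets are null and whose essential range is an interval. -/
structure IsQuantile (ρ : (Fin k → ℝ) → ℝ) : Prop where
  measurable : Measurable ρ
  level : ∀ t, ∀ᵐ η, ρ η ≠ t
  gap : ∀ t t', t < t' → (∀ᵐ η, ¬(t < ρ η ∧ ρ η < t')) → (∀ᵐ η, ρ η ≤ t) ∨ ∀ᵐ η, t' ≤ ρ η

lemma IsQuantile.weight {ρ : (Fin k → ℝ) → ℝ} (hρ : IsQuantile ρ) (t : ℝ) :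
    IsWeight fun η => Real.sign (ρ η - t) :=
  ⟨measurable_sign.comp (hρ.measurable.sub_const t), fun _ => abs_sign_le _⟩

lemma wint_congr_ae {p : Seminorm ℝ (Fin n → ℝ)} {w w' : (Fin k → ℝ) → ℝ}
    {a : Fin k → Fin n → ℝ} (h : ∀ᵐ η, w η = w' η) : wint p w a = wint p w' a :=
  integral_congr_ae (h.mono fun η hη => by simp only [hη])

lemma IsQuantile.wint_neg {p : Seminorm ℝ (Fin n → ℝ)} (hp : IsDef p) {ρ : (Fin k → ℝ) → ℝ}
    (hρ : IsQuantile ρ) {a : Fin k → Fin n → ℝ} (ha : LinearIndependent ℝ a) {t : ℝ}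
    (hc : ∀ᵐ η, ρ η ≤ t) : wint p (fun η => Real.sign (ρ η - t)) a < 0 := by
  have hpos : 0 < ∫ η, Real.exp (-p (Mahler.lin a η)) := integral_exp_pos _ (hp.lin ha)
  have : wint p (fun η => Real.sign (ρ η - t)) a = wint p (fun _ => -1) a :=
    wint_congr_ae (by
      filter_upwards [hc, hρ.level t] with η h1 h2
      exact Real.sign_of_neg (sub_neg.2 (lt_of_le_of_ne h1 h2)))
  rw [this, wint]
  simpa [integral_neg] using hpos

lemma IsQuantile.wint_pos {p : Seminorm ℝ (Fin n → ℝ)} (hp : IsDef p) {ρ : (Fin k → ℝ) → ℝ}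
    (hρ : IsQuantile ρ) {a : Fin k → Fin n → ℝ} (ha : LinearIndependent ℝ a) {t : ℝ}
    (hc : ∀ᵐ η, t ≤ ρ η) : 0 < wint p (fun η => Real.sign (ρ η - t)) a := by
  have hpos : 0 < ∫ η, Real.exp (-p (Mahler.lin a η)) := integral_exp_pos _ (hp.lin ha)
  have : wint p (fun η => Real.sign (ρ η - t)) a = wint p (fun _ => 1) a :=
    wint_congr_ae (by
      filter_upwards [hc, hρ.level t] with η h1 h2
      exact Real.sign_of_pos (sub_pos.2 (lt_of_le_of_ne h1 (Ne.symm h2))))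
  rw [this, wint]
  simpa using hpos

lemma IsQuantile.unique {p : Seminorm ℝ (Fin n → ℝ)} (hp : IsDef p) {ρ : (Fin k → ℝ) → ℝ}
    (hρ : IsQuantile ρ) {a : Fin k → Fin n → ℝ} (ha : LinearIndependent ℝ a) {t t' : ℝ}
    (h : wint p (fun η => Real.sign (ρ η - t)) a = 0)
    (h' : wint p (fun η => Real.sign (ρ η - t')) a = 0) : t = t' := by
  by_contra hne
  wlog htt : t < t' generalizing t t'
  · exact this h' h (Ne.symm hne) (lt_of_le_of_ne (not_lt.1 htt) (Ne.symm hne))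
  have hi := integrable_weight_mul hp (hρ.weight t) ha
  have hi' := integrable_weight_mul hp (hρ.weight t') ha
  have hsub := integral_sub hi hi'
  rw [show ∫ η, _ = _ from h, show ∫ η, _ = _ from h', sub_zero] at hsub
  have hae := (integral_eq_zero_iff_of_nonneg (fun η => ?_) (hi.sub hi')).1 hsub
  · have hgap : ∀ᵐ η, ¬(t < ρ η ∧ ρ η < t') := by
      filter_upwards [hae] with η hη hc
      simp only [Pi.sub_apply, Real.sign_of_pos (sub_pos.2 hc.1), Real.sign_of_neg (sub_neg.2 hc.2),
        Pi.zero_apply] at hη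
      linarith [Real.exp_pos (-p (Mahler.lin a η))]
    rcases hρ.gap t t' htt hgap with hc | hc
    · exact absurd h (hρ.wint_neg hp ha hc).ne
    · exact absurd h' (hρ.wint_pos hp ha hc).ne'
  · simp only [Pi.zero_apply, Pi.sub_apply, ← sub_mul]
    exact mul_nonneg (sub_nonneg.2 (sign_mono (by linarith))) (Real.exp_pos _).le

lemma IsQuantile.tendsto {p : Seminorm ℝ (Fin n → ℝ)} (hp : IsDef p) {ρ : (Fin k → ℝ) → ℝ}
    (hρ : IsQuantile ρ) {a : Fin k → Fin n → ℝ} (ha : LinearIndependent ℝ a)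
    {l : Filter ℝ} [l.IsCountablyGenerated] {w : (Fin k → ℝ) → ℝ}
    (h : ∀ᵐ η, Tendsto (fun t => Real.sign (ρ η - t)) l (𝓝 (w η))) :
    Tendsto (fun t => wint p (fun η => Real.sign (ρ η - t)) a) l (𝓝 (wint p w a)) := by
  refine tendsto_integral_filter_of_dominated_convergence
    (fun η => Real.exp (-(p.comp (Mahler.lin a)) η))
    (Eventually.of_forall fun t =>
      (measurable_weight_mul p (hρ.weight t) a).aestronglyMeasurable)
    (Eventually.of_forall fun t => Eventually.of_forall fun η => ?_)
    (integrable_exp _ (hp.lin ha)) (h.mono fun η hη => hη.mul_const _)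
  rw [Real.norm_eq_abs, abs_mul, abs_of_pos (Real.exp_pos _), Seminorm.comp_apply]
  exact mul_le_of_le_one_left (Real.exp_pos _).le (abs_sign_le _)

lemma IsQuantile.exists_root {X : Type*} [TopologicalSpace X] {p : Seminorm ℝ (Fin n → ℝ)}
    (hp : IsDef p) {ρ : (Fin k → ℝ) → ℝ} (hρ : IsQuantile ρ) {a : X → Fin k → Fin n → ℝ}
    (ha : Continuous a) (hli : ∀ x, LinearIndependent ℝ (a x)) :
    ∃ τ : X → ℝ, Continuous τ ∧ ∀ x, wint p (fun η => Real.sign (ρ η - τ x)) (a x) = 0 := by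
  have hpos : ∀ x, 0 < ∫ η, Real.exp (-p (Mahler.lin (a x) η)) :=
    fun x => integral_exp_pos _ (hp.lin (hli x))
  refine exists_continuous_root (M := fun x t => wint p (fun η => Real.sign (ρ η - t)) (a x))
    (fun t => continuous_wint hp (hρ.weight t) ha hli) (fun x => ?_) (fun x t t' h => ?_)
    (fun x => ?_) (fun x => ?_) (fun x t t' => hρ.unique hp (hli x))
  · refine continuous_iff_continuousAt.2 fun t => hρ.tendsto hp (hli x) ?_
    filter_upwards [hρ.level t] with η hη
    exact (continuousAt_sign (sub_ne_zero.2 hη)).tendsto.comp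
      (tendsto_const_nhds.sub tendsto_id)
  · refine integral_mono (integrable_weight_mul hp (hρ.weight t') (hli x))
      (integrable_weight_mul hp (hρ.weight t) (hli x)) fun η => ?_
    exact mul_le_mul_of_nonneg_right (sign_mono (by linarith)) (Real.exp_pos _).le
  · have h1 : Tendsto (fun t => wint p (fun η => Real.sign (ρ η - t)) (a x)) atBot
        (𝓝 (wint p (fun _ => 1) (a x))) := hρ.tendsto hp (hli x) (Eventually.of_forall fun η => by
      refine tendsto_const_nhds.congr' ?_
      filter_upwards [eventually_lt_atBot (ρ η)] with t ht
      exact (Real.sign_of_pos (sub_pos.2 ht)).symm)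
    have h2 : 0 < wint p (fun _ => 1) (a x) := by simpa [wint] using hpos x
    exact (h1.eventually (lt_mem_nhds h2)).exists
  · have h1 : Tendsto (fun t => wint p (fun η => Real.sign (ρ η - t)) (a x)) atTop
        (𝓝 (wint p (fun _ => -1) (a x))) := hρ.tendsto hp (hli x) (Eventually.of_forall fun η => by
      refine tendsto_const_nhds.congr' ?_
      filter_upwards [eventually_gt_atTop (ρ η)] with t ht
      exact (Real.sign_of_neg (sub_neg.2 ht)).symm)
    have h2 : wint p (fun _ => -1) (a x) < 0 := by simpa [wint, integral_neg] using hpos x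
    exact (h1.eventually (gt_mem_nhds h2)).exists

end

section

/-! ### Changes of frame -/

variable {n k : ℕ}

lemma wint_comp (p : Seminorm ℝ (Fin n → ℝ)) {w : (Fin k → ℝ) → ℝ} (hw : IsWeight w)
    {a a' : Fin k → Fin n → ℝ} (M : Matrix (Fin k) (Fin k) ℝ) (hM : M.det ≠ 0)
    (h : ∀ η, lin a' (M.mulVec η) = lin a η) :
    wint p w a' = |M.det| * wint p (fun η => w (M.mulVec η)) a := by
  have hdet : LinearMap.det (Matrix.toLin' M) ≠ 0 := by rwa [LinearMap.det_toLin']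
  have hmap := Measure.map_linearMap_addHaar_eq_smul_addHaar
    (volume : Measure (Fin k → ℝ)) hdet
  have hcont : Measurable (Matrix.toLin' M) :=
    (LinearMap.continuous_of_finiteDimensional _).measurable
  have h1 := integral_map (μ := (volume : Measure (Fin k → ℝ))) hcont.aemeasurable
    (f := fun ξ => w ξ * Real.exp (-p (lin a' ξ)))
    (measurable_weight_mul p hw a').aestronglyMeasurable
  rw [hmap, integral_smul_measure, LinearMap.det_toLin', abs_inv,
    ENNReal.toReal_ofReal (by positivity), smul_eq_mul] at h1
  have h2 : 0 < |M.det| := abs_pos.2 hM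
  simp only [Matrix.toLin'_apply, h] at h1
  rw [wint, wint, ← h1, mul_inv_cancel_left₀ h2.ne']

lemma wint_perm (p : Seminorm ℝ (Fin n → ℝ)) (w : (Fin k → ℝ) → ℝ) (a : Fin k → Fin n → ℝ)
    (σ : Equiv.Perm (Fin k)) :
    wint p w (fun i => a (σ i)) = wint p (fun η => w fun i => η (σ i)) a := by
  have hmp := volume_measurePreserving_piCongrLeft (fun _ : Fin k => ℝ) σ.symm
  have h := hmp.integral_comp' fun ξ => w ξ * Real.exp (-p (lin (fun i => a (σ i)) ξ))
  rw [wint, ← h, wint]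
  have hT : ∀ η : Fin k → ℝ, MeasurableEquiv.piCongrLeft (fun _ : Fin k => ℝ) σ.symm η =
      fun i => η (σ i) := fun η => by
    ext i
    obtain ⟨j, rfl⟩ := σ.symm.surjective i
    rw [MeasurableEquiv.coe_piCongrLeft, Equiv.piCongrLeft_apply_apply]
    simp
  refine integral_congr_ae (Eventually.of_forall fun η => ?_)
  simp only [hT, lin, Fintype.linearCombination_apply]
  rw [Equiv.sum_comp σ fun i => η i • a i]

/-- The product of the signs of two coordinates. -/
def pw (i j : Fin k) (η : Fin k → ℝ) : ℝ := Real.sign (η i) * Real.sign (η j)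

lemma isWeight_pw (i j : Fin k) : IsWeight (pw i j) :=
  ⟨(measurable_sign.comp (measurable_pi_apply i)).mul
    (measurable_sign.comp (measurable_pi_apply j)),
    fun η => by
      rw [pw, abs_mul]
      exact mul_le_one₀ (abs_sign_le _) (abs_nonneg _) (abs_sign_le _)⟩

lemma wint_pw_sign (p : Seminorm ℝ (Fin n → ℝ)) (a : Fin k → Fin n → ℝ) {ε : Fin k → ℝ}
    (hε : IsSign ε) (i j : Fin k) :
    wint p (pw i j) (fun l => ε l • a l) = ε i * ε j * wint p (pw i j) a := by
  have hsq : ∀ l, ε l * ε l = 1 := fun l => by rcases hε l with h | h <;> simp [h]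
  have habs : ∀ l, |ε l| = 1 := fun l => by rcases hε l with h | h <;> simp [h]
  have hsign : ∀ l, Real.sign (ε l) = ε l := fun l => by
    rcases hε l with h | h <;> simp [h, Real.sign_of_neg]
  have hdet : |(Matrix.diagonal ε).det| = 1 := by
    rw [Matrix.det_diagonal, Finset.abs_prod]; simp [habs]
  rw [wint_comp p (isWeight_pw i j) (a := a) (Matrix.diagonal ε)
    (fun h => by rw [h] at hdet; simp at hdet) (fun η => by
      simp only [lin, Fintype.linearCombination_apply, Matrix.mulVec_diagonal]
      refine Finset.sum_congr rfl fun l _ => ?_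
      rw [smul_smul, mul_right_comm, hsq, one_mul]), hdet, one_mul, wint, wint,
    ← integral_const_mul]
  refine integral_congr_ae (Eventually.of_forall fun η => ?_)
  simp only [pw, Matrix.mulVec_diagonal, sign_mul, hsign]
  ring

/-- The signed volume of a frame of space, for its first two coordinates. -/
def V (p : Seminorm ℝ (Fin 3 → ℝ)) (a b c : Fin 3 → ℝ) : ℝ := wint p (pw 0 1) ![a, b, c]

/-- The signed area of a pair of vectors. -/
def Ar (p : Seminorm ℝ (Fin n → ℝ)) (a b : Fin n → ℝ) : ℝ := wint p (pw 0 1) ![a, b]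

section
variable (p : Seminorm ℝ (Fin 3 → ℝ)) (a b c : Fin 3 → ℝ)

lemma V_neg_left : V p (-a) b c = -V p a b c := by
  have h := wint_pw_sign p ![a, b, c] (ε := ![-1, 1, 1])
    (fun i => by fin_cases i <;> simp) 0 1
  have e : (fun l => (![-1, 1, 1] : Fin 3 → ℝ) l • ![a, b, c] l) = ![-a, b, c] := by
    ext i : 1; fin_cases i <;> simp
  rw [e] at h
  rw [V, h, V]; simp

lemma V_neg_right : V p a b (-c) = V p a b c := by
  have h := wint_pw_sign p ![a, b, c] (ε := ![1, 1, -1])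
    (fun i => by fin_cases i <;> simp) 0 1
  have e : (fun l => (![1, 1, -1] : Fin 3 → ℝ) l • ![a, b, c] l) = ![a, b, -c] := by
    ext i : 1; fin_cases i <;> simp
  rw [e] at h
  rw [V, h, V]; simp

lemma V_comm : V p b a c = V p a b c := by
  have h := wint_perm p (pw 0 1) ![a, b, c] (Equiv.swap 0 1)
  have e : (fun l => ![a, b, c] (Equiv.swap (0 : Fin 3) 1 l)) = ![b, a, c] := by
    ext i : 1; fin_cases i <;> rfl
  rw [e] at h
  rw [V, h, V, wint, wint]
  refine integral_congr_ae (Eventually.of_forall fun η => ?_)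
  simp [pw, mul_comm (Real.sign (η 1))]

lemma V_neg_mid : V p a (-b) c = -V p a b c := by
  rw [V_comm, V_neg_left, V_comm]
end

section
variable (p : Seminorm ℝ (Fin n → ℝ)) (a b : Fin n → ℝ)

lemma Ar_neg_left : Ar p (-a) b = -Ar p a b := by
  have h := wint_pw_sign p ![a, b] (ε := ![-1, 1])
    (fun i => by fin_cases i <;> simp) 0 1
  have e : (fun l => (![-1, 1] : Fin 2 → ℝ) l • ![a, b] l) = ![-a, b] := by
    ext i : 1; fin_cases i <;> simp
  rw [e] at h
  rw [Ar, h, Ar]; simp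

lemma Ar_comm : Ar p b a = Ar p a b := by
  have h := wint_perm p (pw 0 1) ![a, b] (Equiv.swap 0 1)
  have e : (fun l => ![a, b] (Equiv.swap (0 : Fin 2) 1 l)) = ![b, a] := by
    ext i : 1; fin_cases i <;> rfl
  rw [e] at h
  rw [Ar, h, Ar, wint, wint]
  refine integral_congr_ae (Eventually.of_forall fun η => ?_)
  simp [pw, mul_comm (Real.sign (η 1))]

lemma Ar_neg_right : Ar p a (-b) = -Ar p a b := by
  rw [Ar_comm, Ar_neg_left, Ar_comm]
end

/-! ### Two quantile functions -/

lemma ae_linear_ne (φ : (Fin k → ℝ) →ₗ[ℝ] ℝ) (hφ : φ ≠ 0) : ∀ᵐ η, φ η ≠ 0 := by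
  have h := Measure.addHaar_submodule (volume : Measure (Fin k → ℝ)) (LinearMap.ker φ)
    (by rwa [Ne, LinearMap.ker_eq_top])
  rw [ae_iff]
  simp only [ne_eq, not_not]
  exact h

lemma ae_coord_sub_ne {i j : Fin k} (hij : i ≠ j) (t : ℝ) :
    ∀ᵐ η : Fin k → ℝ, η i - t * η j ≠ 0 := by
  refine ae_linear_ne (LinearMap.proj i - t • LinearMap.proj j) fun h => ?_
  have := congrArg (fun f => f (Pi.single i 1)) h
  simp [hij] at this

lemma ae_coord_ne (i : Fin k) : ∀ᵐ η : Fin k → ℝ, η i ≠ 0 := by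
  refine ae_linear_ne (LinearMap.proj i) fun h => ?_
  have := congrArg (fun f => f (Pi.single i 1)) h
  simp at this

lemma not_ae_not_mem_of_isOpen {U : Set (Fin k → ℝ)} (hU : IsOpen U) (hne : U.Nonempty) :
    ¬∀ᵐ η, η ∉ U := fun h => by
  have := hU.measure_pos volume hne
  rw [ae_iff] at h
  simp at h
  exact this.ne' h

lemma not_ae_not_mem_cone {t t' : ℝ} (h : t < t') :
    ¬∀ᵐ η : Fin (k + 2) → ℝ, ¬(0 < η 0 ∧ t * η 0 < η 1 ∧ η 1 < t' * η 0) := by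
  refine not_ae_not_mem_of_isOpen
    (U := {η : Fin (k + 2) → ℝ | 0 < η 0 ∧ t * η 0 < η 1 ∧ η 1 < t' * η 0}) ?_ ?_
  · have h0 := continuous_apply (A := fun _ : Fin (k + 2) => ℝ) 0
    have h1 := continuous_apply (A := fun _ : Fin (k + 2) => ℝ) 1
    exact (isOpen_lt continuous_const h0).inter
      ((isOpen_lt (continuous_const.mul h0) h1).inter (isOpen_lt h1 (continuous_const.mul h0)))
  · refine ⟨fun i => if i = 0 then 1 else (t + t') / 2, ?_⟩
    simp only [Set.mem_ofPred_eq, if_true, one_ne_zero, if_false]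
    exact ⟨one_pos, by linarith, by linarith⟩

lemma isQuantile_ratio : IsQuantile fun η : Fin (k + 2) → ℝ => η 1 / η 0 where
  measurable := (measurable_pi_apply 1).div (measurable_pi_apply 0)
  level t := by
    filter_upwards [ae_coord_sub_ne (one_ne_zero : (1 : Fin (k + 2)) ≠ 0) t, ae_coord_ne 0]
      with η h1 h2 h3
    rw [div_eq_iff h2] at h3
    exact h1 (sub_eq_zero.2 h3)
  gap t t' h hgap := by
    refine absurd ?_ (not_ae_not_mem_cone (k := k) h)
    filter_upwards [hgap] with η hη hc
    exact hη ⟨(lt_div_iff₀ hc.1).2 hc.2.1, (div_lt_iff₀ hc.1).2 hc.2.2⟩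

/-- The ratio of the smaller to the larger coordinate. -/
def rat (η : Fin 2 → ℝ) : ℝ := if |η 1| < |η 0| then η 1 / η 0 else η 0 / η 1

lemma abs_rat_le (η : Fin 2 → ℝ) : |rat η| ≤ 1 := by
  rw [rat]
  split_ifs with h
  · rw [abs_div]
    exact div_le_one_of_le₀ h.le (abs_nonneg _)
  · rw [abs_div]
    exact div_le_one_of_le₀ (not_lt.1 h) (abs_nonneg _)

lemma isQuantile_rat : IsQuantile rat where
  measurable := Measurable.ite
    (measurableSet_lt (measurable_pi_apply 1).norm (measurable_pi_apply 0).norm)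
    ((measurable_pi_apply 1).div (measurable_pi_apply 0))
    ((measurable_pi_apply 0).div (measurable_pi_apply 1))
  level t := by
    filter_upwards [ae_coord_sub_ne (one_ne_zero : (1 : Fin 2) ≠ 0) t,
      ae_coord_sub_ne (zero_ne_one : (0 : Fin 2) ≠ 1) t, ae_coord_ne 0, ae_coord_ne 1]
      with η h1 h1' h2 h2' h3
    rw [rat] at h3
    split_ifs at h3
    · rw [div_eq_iff h2] at h3
      exact h1 (sub_eq_zero.2 h3)
    · rw [div_eq_iff h2'] at h3
      exact h1' (sub_eq_zero.2 h3)
  gap t t' h hgap := by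
    have hr := fun η => abs_le.1 (abs_rat_le η)
    rcases le_or_gt 1 t with ht | ht
    · exact Or.inl (Eventually.of_forall fun η => (hr η).2.trans ht)
    rcases le_or_gt t' (-1) with ht' | ht'
    · exact Or.inr (Eventually.of_forall fun η => ht'.trans (hr η).1)
    have hlt : max t (-1) < min t' 1 := by
      rw [max_lt_iff, lt_min_iff, lt_min_iff]; exact ⟨⟨h, ht⟩, ht', by norm_num⟩
    refine absurd ?_ (not_ae_not_mem_cone (k := 0) hlt)
    filter_upwards [hgap] with η hη hc
    refine hη ?_
    obtain ⟨h0, h1, h2⟩ := hc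
    rw [← lt_div_iff₀ h0, max_lt_iff] at h1
    rw [← div_lt_iff₀ h0, lt_min_iff] at h2
    have : |η 1| < |η 0| := by
      rw [abs_of_pos h0, abs_lt]
      have h3 := (lt_div_iff₀ h0).1 h1.2
      have h4 := (div_lt_iff₀ h0).1 h2.2
      constructor <;> linarith
    rw [rat, if_pos this]
    exact ⟨h1.1, h2.1⟩

lemma sign_pos_mul {c : ℝ} (hc : 0 < c) (x : ℝ) : Real.sign (c * x) = Real.sign x := by
  rw [sign_mul, Real.sign_of_pos hc, one_mul]

lemma pw_shear {η : Fin (k + 2) → ℝ} (h0 : η 0 ≠ 0) (t : ℝ) :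
    Real.sign (η 0) * Real.sign (η 1 - t * η 0) = Real.sign (η 1 / η 0 - t) := by
  rw [← sign_mul, ← sign_pos_mul (show 0 < η 0 ^ 2 by positivity) (η 1 / η 0 - t)]
  congr 1; field_simp

lemma V_shear (p : Seminorm ℝ (Fin 3 → ℝ)) (u m l : Fin 3 → ℝ) (t : ℝ) :
    V p (u + t • m) m l = wint p (fun η => Real.sign (η 1 / η 0 - t)) ![u, m, l] := by
  have hdet : (!![1, 0, 0; -t, 1, 0; 0, 0, 1] : Matrix (Fin 3) (Fin 3) ℝ).det = 1 := by
    simp [Matrix.det_fin_three]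
  rw [V, wint_comp p (isWeight_pw 0 1) (a := ![u, m, l]) !![1, 0, 0; -t, 1, 0; 0, 0, 1]
    (by rw [hdet]; exact one_ne_zero) (fun η => by
      ext i
      simp [lin, Fintype.linearCombination_apply, Fin.sum_univ_three, dotProduct]
      ring), hdet, abs_one, one_mul]
  refine wint_congr_ae ((ae_coord_ne 0).mono fun η h0 => ?_)
  rw [← pw_shear h0, pw]
  congr 2 <;> simp [Matrix.mulVec, dotProduct, Fin.sum_univ_three]; ring

lemma V_shear_third (p : Seminorm ℝ (Fin 3 → ℝ)) (u m l : Fin 3 → ℝ) (t : ℝ) :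
    V p (u + t • l) m l = V p u m l := by
  have hdet : (!![1, 0, 0; 0, 1, 0; -t, 0, 1] : Matrix (Fin 3) (Fin 3) ℝ).det = 1 := by
    simp [Matrix.det_fin_three]
  rw [V, wint_comp p (isWeight_pw 0 1) (a := ![u, m, l]) !![1, 0, 0; 0, 1, 0; -t, 0, 1]
    (by rw [hdet]; exact one_ne_zero) (fun η => by
      ext i
      simp [lin, Fintype.linearCombination_apply, Fin.sum_univ_three, dotProduct]
      ring), hdet, abs_one, one_mul, V]
  congr 1
  ext η
  simp [pw, Matrix.mulVec, dotProduct, Fin.sum_univ_three]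

lemma Ar_shear (p : Seminorm ℝ (Fin n → ℝ)) (u m : Fin n → ℝ) (t : ℝ) :
    Ar p (u + t • m) m = wint p (fun η => Real.sign (η 1 / η 0 - t)) ![u, m] := by
  have hdet : (!![1, 0; -t, 1] : Matrix (Fin 2) (Fin 2) ℝ).det = 1 := by
    simp [Matrix.det_fin_two]
  rw [Ar, wint_comp p (isWeight_pw 0 1) (a := ![u, m]) !![1, 0; -t, 1]
    (by rw [hdet]; exact one_ne_zero) (fun η => by
      ext i
      simp [lin, Fintype.linearCombination_apply, Fin.sum_univ_two, dotProduct]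
      ring), hdet, abs_one, one_mul]
  refine wint_congr_ae ((ae_coord_ne 0).mono fun η h0 => ?_)
  rw [← pw_shear h0, pw]
  congr 2 <;> simp [Matrix.mulVec, dotProduct, Fin.sum_univ_two]; ring

lemma Ar_squeeze (p : Seminorm ℝ (Fin n → ℝ)) (v w : Fin n → ℝ) {s : ℝ} (hs : |s| < 1) :
    ∃ c, 0 < c ∧ Ar p (w + s • v) (v + s • w) =
      c * wint p (fun η => Real.sign (rat η - s)) ![v, w] := by
  have hd : 0 < 1 - s ^ 2 := by rw [sub_pos]; exact (sq_lt_one_iff_abs_lt_one s).2 hs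
  set d := (1 - s ^ 2)⁻¹ with hdd
  have hd0 : 0 < d := inv_pos.2 hd
  have hdm : d * (1 - s ^ 2) = 1 := inv_mul_cancel₀ hd.ne'
  have hdet : (!![-(d * s), d; d, -(d * s)] : Matrix (Fin 2) (Fin 2) ℝ).det = -d := by
    rw [Matrix.det_fin_two_of]; linear_combination (-d) * hdm
  refine ⟨d, hd0, ?_⟩
  rw [Ar, wint_comp p (isWeight_pw 0 1) (a := ![v, w]) !![-(d * s), d; d, -(d * s)]
    (by rw [hdet]; exact neg_ne_zero.2 hd0.ne') (fun η => by
      ext i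
      simp [lin, Fintype.linearCombination_apply, Fin.sum_univ_two, dotProduct]
      linear_combination (η 0 * v i + η 1 * w i) * hdm), hdet, abs_neg, abs_of_pos hd0]
  congr 1
  refine wint_congr_ae ?_
  filter_upwards [ae_coord_ne 0, ae_coord_ne 1] with η h0 h1
  have hr : 0 < 1 - s * rat η := by
    have : |s * rat η| < 1 := by
      rw [abs_mul]
      exact (mul_le_of_le_one_right (abs_nonneg _) (abs_rat_le η)).trans_lt hs
    linarith [(abs_lt.1 this).2]
  rw [pw, ← sign_mul]
  have e : (Matrix.mulVec !![-(d * s), d; d, -(d * s)] η) 0 *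
      (Matrix.mulVec !![-(d * s), d; d, -(d * s)] η) 1 =
      d ^ 2 * ((η 1 - s * η 0) * (η 0 - s * η 1)) := by
    simp [Matrix.mulVec, dotProduct, Fin.sum_univ_two]; ring
  rw [e, sign_pos_mul (by positivity)]
  rw [rat] at hr ⊢
  split_ifs at hr ⊢ with h
  · rw [← sign_pos_mul (show 0 < η 0 ^ 2 * (1 - s * (η 1 / η 0)) by positivity)
      (η 1 / η 0 - s)]
    congr 1; field_simp
  · rw [← sign_pos_mul (show 0 < η 1 ^ 2 * (1 - s * (η 0 / η 1)) by positivity)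
      (η 0 / η 1 - s)]
    congr 1; field_simp

end

section

/-! ### Equipartitioned frames -/

section roots
variable {X : Type*} [TopologicalSpace X] {n : ℕ}

lemma exists_squeeze {p : Seminorm ℝ (Fin n → ℝ)} (hp : IsDef p) {v w : X → Fin n → ℝ}
    (hv : Continuous v) (hw : Continuous w) (hli : ∀ x, LinearIndependent ℝ ![v x, w x]) :
    ∃ s : X → ℝ, Continuous s ∧ ∀ x, |s x| < 1 ∧ Ar p (w x + s x • v x) (v x + s x • w x) = 0 := by
  have hc : Continuous fun x => ![v x, w x] := by
    refine continuous_pi fun i => ?_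
    fin_cases i
    exacts [hv, hw]
  obtain ⟨s, hs, h0⟩ := isQuantile_rat.exists_root hp hc hli
  refine ⟨s, hs, fun x => ?_⟩
  have hx : |s x| < 1 := by
    by_contra! h
    rcases le_abs.1 h with h | h
    · exact (isQuantile_rat.wint_neg hp (hli x) (Eventually.of_forall fun η =>
        (abs_le.1 (abs_rat_le η)).2.trans h)).ne (h0 x)
    · exact (isQuantile_rat.wint_pos hp (hli x) (Eventually.of_forall fun η =>
        (le_neg.1 h).trans (abs_le.1 (abs_rat_le η)).1)).ne' (h0 x)
  obtain ⟨c, -, hA⟩ := Ar_squeeze p (v x) (w x) hx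
  exact ⟨hx, by rw [hA, h0, mul_zero]⟩

lemma squeeze_unique {p : Seminorm ℝ (Fin n → ℝ)} (hp : IsDef p) {v w : Fin n → ℝ}
    (hli : LinearIndependent ℝ ![v, w]) {s t : ℝ} (hs : |s| < 1) (ht : |t| < 1)
    (h : Ar p (w + s • v) (v + s • w) = 0) (h' : Ar p (w + t • v) (v + t • w) = 0) : s = t := by
  obtain ⟨c, hc, hA⟩ := Ar_squeeze p v w hs
  obtain ⟨c', hc', hA'⟩ := Ar_squeeze p v w ht
  exact isQuantile_rat.unique hp hli
    ((mul_eq_zero.1 (hA.symm.trans h)).resolve_left hc.ne')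
    ((mul_eq_zero.1 (hA'.symm.trans h')).resolve_left hc'.ne')

lemma exists_shear {p : Seminorm ℝ (Fin 3 → ℝ)} (hp : IsDef p) {u m l : X → Fin 3 → ℝ}
    (hu : Continuous u) (hm : Continuous m) (hl : Continuous l)
    (hli : ∀ x, LinearIndependent ℝ ![u x, m x, l x]) :
    ∃ τ : X → ℝ, Continuous τ ∧ ∀ x, V p (u x + τ x • m x) (m x) (l x) = 0 := by
  have hc : Continuous fun x => ![u x, m x, l x] := by
    refine continuous_pi fun i => ?_
    fin_cases i
    exacts [hu, hm, hl]
  obtain ⟨τ, hτ, h0⟩ := (isQuantile_ratio (k := 1)).exists_root hp hc hli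
  exact ⟨τ, hτ, fun x => by rw [V_shear]; exact h0 x⟩

lemma shear_unique {p : Seminorm ℝ (Fin 3 → ℝ)} (hp : IsDef p) {u m l : Fin 3 → ℝ}
    (hli : LinearIndependent ℝ ![u, m, l]) {s t : ℝ} (h : V p (u + s • m) m l = 0)
    (h' : V p (u + t • m) m l = 0) : s = t := by
  rw [V_shear] at h h'
  exact (isQuantile_ratio (k := 1)).unique hp hli h h'

end roots

/-! ### The frame attached to a point of the punctured plane -/

/-- The isotropic vector attached to a pair of complex numbers. -/
def iso (x : ℂ × ℂ) : Fin 3 → ℂ :=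
  ![x.1 ^ 2 - x.2 ^ 2, Complex.I * (x.1 ^ 2 + x.2 ^ 2), -2 * (x.1 * x.2)]

/-- The real part of the isotropic vector. -/
def isoRe (x : ℂ × ℂ) : Fin 3 → ℝ := fun i => (iso x i).re

/-- The imaginary part of the isotropic vector. -/
def isoIm (x : ℂ × ℂ) : Fin 3 → ℝ := fun i => (iso x i).im

/-- The direction orthogonal to the real and imaginary parts of the isotropic vector. -/
def isoNormal (x : ℂ × ℂ) : Fin 3 → ℝ := crossProduct (isoRe x) (isoIm x)

lemma zeta_sq : zeta ^ 2 = Complex.I := by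
  rw [zeta, ← Complex.exp_nat_mul, show ((2 : ℕ) : ℂ) * (2 * Real.pi * Complex.I / (8 : ℕ)) =
    Real.pi / 2 * Complex.I by push_cast; ring, Complex.exp_pi_div_two_mul_I]

lemma iso_rotT (x : ℂ × ℂ) (i : Fin 3) : iso (rotT x) i = Complex.I * iso x i := by
  have h := zeta_sq
  fin_cases i <;> simp only [iso, rotT_apply, Fin.reduceFinMk, Matrix.cons_val] <;>
    rw [← h] <;> ring

lemma iso_rotR (x : ℂ × ℂ) (i : Fin 3) : iso (rotR x) i = -(starRingEnd ℂ) (iso x i) := by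
  fin_cases i <;> simp [iso, rotR_apply, Complex.conj_ofNat] <;> ring

lemma isoRe_rotT (x : ℂ × ℂ) : isoRe (rotT x) = -isoIm x := by
  ext i; simp [isoRe, isoIm, iso_rotT]

lemma isoIm_rotT (x : ℂ × ℂ) : isoIm (rotT x) = isoRe x := by
  ext i; simp [isoRe, isoIm, iso_rotT]

lemma isoNormal_rotT (x : ℂ × ℂ) : isoNormal (rotT x) = isoNormal x := by
  rw [isoNormal, isoRe_rotT, isoIm_rotT, map_neg, LinearMap.neg_apply, cross_anticomm, isoNormal]

lemma isoRe_rotR (x : ℂ × ℂ) : isoRe (rotR x) = -isoRe x := by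
  ext i; simp [isoRe, iso_rotR]

lemma isoIm_rotR (x : ℂ × ℂ) : isoIm (rotR x) = isoIm x := by
  ext i; simp [isoIm, iso_rotR]

lemma isoNormal_rotR (x : ℂ × ℂ) : isoNormal (rotR x) = -isoNormal x := by
  rw [isoNormal, isoRe_rotR, isoIm_rotR, map_neg, LinearMap.neg_apply, isoNormal]

lemma continuous_iso : Continuous iso := by
  refine continuous_pi fun i => ?_
  fin_cases i <;> simp only [iso, Fin.reduceFinMk, Matrix.cons_val] <;> fun_prop

lemma continuous_isoRe : Continuous isoRe :=
  continuous_pi fun i => Complex.continuous_re.comp ((continuous_apply i).comp continuous_iso)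

lemma continuous_isoIm : Continuous isoIm :=
  continuous_pi fun i => Complex.continuous_im.comp ((continuous_apply i).comp continuous_iso)

lemma continuous_isoNormal : Continuous isoNormal := by
  have h1 := fun i => (continuous_apply i).comp continuous_isoRe
  have h2 := fun i => (continuous_apply i).comp continuous_isoIm
  refine continuous_pi fun i => ?_
  fin_cases i <;> simp only [isoNormal, cross_apply, Fin.reduceFinMk, Matrix.cons_val]
  · exact ((h1 1).mul (h2 2)).sub ((h1 2).mul (h2 1))
  · exact ((h1 2).mul (h2 0)).sub ((h1 0).mul (h2 2))
  · exact ((h1 0).mul (h2 1)).sub ((h1 1).mul (h2 0))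

/-- The determinant of a triple of vectors. -/
def frameDet (a b c : Fin 3 → ℝ) : ℝ := (Matrix.of ![a, b, c]).det

lemma det_iso (x : ℂ × ℂ) : frameDet (isoNormal x) (isoRe x) (isoIm x) =
    (Complex.normSq x.1 + Complex.normSq x.2) ^ 4 := by
  rw [frameDet, Matrix.det_fin_three]
  simp [isoNormal, cross_apply, isoRe, isoIm, iso, Complex.normSq_apply, pow_two]
  ring

lemma det_squeeze (u v w : Fin 3 → ℝ) (s : ℝ) :
    frameDet u (w + s • v) (v + s • w) = -((1 - s ^ 2) * frameDet u v w) := by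
  simp only [frameDet, Matrix.det_fin_three, Matrix.of_apply, Matrix.cons_val, Pi.add_apply,
    Pi.smul_apply, smul_eq_mul]
  ring

lemma li_of_det {a b c : Fin 3 → ℝ} (h : frameDet a b c ≠ 0) :
    LinearIndependent ℝ ![a, b, c] :=
  Matrix.linearIndependent_rows_of_det_ne_zero h

lemma det_iso_ne_zero (x : Punct) :
    frameDet (isoNormal x.1) (isoRe x.1) (isoIm x.1) ≠ 0 := by
  rw [det_iso]
  refine pow_ne_zero _ fun h => x.2 ?_
  have h1 := Complex.normSq_nonneg x.1.1
  have h2 := Complex.normSq_nonneg x.1.2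
  exact Prod.ext (Complex.normSq_eq_zero.1 (by linarith)) (Complex.normSq_eq_zero.1 (by linarith))

lemma li_swap {a b c : Fin 3 → ℝ} (h : LinearIndependent ℝ ![a, b, c]) :
    LinearIndependent ℝ ![a, c, b] := by
  convert h.comp _ (Equiv.swap (1 : Fin 3) 2).injective using 1
  ext i : 1; fin_cases i <;> rfl

lemma li_tail {a b c : Fin 3 → ℝ} (h : LinearIndependent ℝ ![a, b, c]) :
    LinearIndependent ℝ ![b, c] := by
  convert h.comp _ (Fin.succ_injective 2) using 1
  ext i : 1; fin_cases i <;> rfl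

theorem exists_frame {p : Seminorm ℝ (Fin 3 → ℝ)} (hp : IsDef p) :
    ∃ a b c : Fin 3 → ℝ, LinearIndependent ℝ ![a, b, c] ∧ V p a b c = 0 ∧ V p a c b = 0 ∧
      V p b c a = 0 ∧ Ar p a b = 0 ∧ Ar p a c = 0 ∧ Ar p b c = 0 := by
  let u : Punct → Fin 3 → ℝ := fun x => isoNormal x.1
  let v : Punct → Fin 3 → ℝ := fun x => isoRe x.1
  let w : Punct → Fin 3 → ℝ := fun x => isoIm x.1
  have hu : Continuous u := continuous_isoNormal.comp continuous_subtype_val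
  have hv : Continuous v := continuous_isoRe.comp continuous_subtype_val
  have hw : Continuous w := continuous_isoIm.comp continuous_subtype_val
  have uT : ∀ x, u (pT x) = u x := fun x => isoNormal_rotT x.1
  have vT : ∀ x, v (pT x) = -w x := fun x => isoRe_rotT x.1
  have wT : ∀ x, w (pT x) = v x := fun x => isoIm_rotT x.1
  have uR : ∀ x, u (pR x) = -u x := fun x => isoNormal_rotR x.1
  have vR : ∀ x, v (pR x) = -v x := fun x => isoRe_rotR x.1
  have wR : ∀ x, w (pR x) = w x := fun x => isoIm_rotR x.1
  have hdet : ∀ x, frameDet (u x) (v x) (w x) ≠ 0 := det_iso_ne_zero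
  have hvw : ∀ x, LinearIndependent ℝ ![v x, w x] := fun x => li_tail (li_of_det (hdet x))
  clear_value u v w
  obtain ⟨s, hs, hs0⟩ := exists_squeeze hp hv hw hvw
  have sT : ∀ x, s (pT x) = -s x := fun x => by
    have h := (hs0 (pT x)).2
    rw [vT, wT] at h
    refine neg_eq_iff_eq_neg.1 (squeeze_unique hp (hvw x) ?_ (hs0 x).1 ?_ (hs0 x).2)
    · rw [abs_neg]; exact (hs0 _).1
    · rw [show w x + -s (pT x) • v x = -(-w x + s (pT x) • v x) by module,
        show v x + -s (pT x) • w x = v x + s (pT x) • -w x by module, Ar_neg_left, Ar_comm, h,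
        neg_zero]
  have sR : ∀ x, s (pR x) = -s x := fun x => by
    have h := (hs0 (pR x)).2
    rw [vR, wR] at h
    refine neg_eq_iff_eq_neg.1 (squeeze_unique hp (hvw x) ?_ (hs0 x).1 ?_ (hs0 x).2)
    · rw [abs_neg]; exact (hs0 _).1
    · rw [show w x + -s (pR x) • v x = w x + s (pR x) • -v x by module,
        show v x + -s (pR x) • w x = -(-v x + s (pR x) • w x) by module, Ar_neg_right, h,
        neg_zero]
  set m : Punct → Fin 3 → ℝ := fun x => w x + s x • v x with hm_def
  set l : Punct → Fin 3 → ℝ := fun x => v x + s x • w x with hl_def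
  have hm : Continuous m := hw.add (hs.smul hv)
  have hl : Continuous l := hv.add (hs.smul hw)
  have hAml : ∀ x, Ar p (m x) (l x) = 0 := fun x => (hs0 x).2
  have lT : ∀ x, l (pT x) = -m x := fun x => by
    simp only [hl_def, hm_def, vT, wT, sT]; module
  have mT : ∀ x, m (pT x) = l x := fun x => by
    simp only [hl_def, hm_def, vT, wT, sT]; module
  have lR : ∀ x, l (pR x) = -l x := fun x => by
    simp only [hl_def, vR, wR, sR]; module
  have mR : ∀ x, m (pR x) = m x := fun x => by
    simp only [hm_def, vR, wR, sR]; module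
  have hdet' : ∀ x, frameDet (u x) (m x) (l x) ≠ 0 := fun x => by
    rw [det_squeeze]
    have := (sq_lt_one_iff_abs_lt_one (s x)).2 (hs0 x).1
    exact neg_ne_zero.2 (mul_ne_zero (sub_pos.2 this).ne' (hdet x))
  clear_value m l
  have huml := fun x => li_of_det (hdet' x)
  have hulm := fun x => li_swap (huml x)
  obtain ⟨τ, hτ, hτ0⟩ := exists_shear hp hu hm hl huml
  obtain ⟨σ, hσ, hσ0⟩ := exists_shear hp hu hl hm hulm
  have τT : ∀ x, τ (pT x) = σ x := fun x => by
    have h := hτ0 (pT x)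
    rw [uT, mT, lT, V_neg_right] at h
    exact shear_unique hp (hulm x) h (hσ0 x)
  have σT : ∀ x, σ (pT x) = -τ x := fun x => by
    have h := hσ0 (pT x)
    rw [uT, mT, lT, V_neg_mid, neg_eq_zero, smul_neg, ← neg_smul] at h
    exact neg_eq_iff_eq_neg.1 (shear_unique hp (huml x) h (hτ0 x))
  have τR : ∀ x, τ (pR x) = -τ x := fun x => by
    have h := hτ0 (pR x)
    rw [uR, mR, lR, V_neg_right, show -u x + τ (pR x) • m x = -(u x + -τ (pR x) • m x) by module,
      V_neg_left, neg_eq_zero] at h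
    exact neg_eq_iff_eq_neg.1 (shear_unique hp (huml x) h (hτ0 x))
  have σR : ∀ x, σ (pR x) = σ x := fun x => by
    have h := hσ0 (pR x)
    rw [uR, mR, lR, V_neg_mid, show -u x + σ (pR x) • -l x = -(u x + σ (pR x) • l x) by module,
      V_neg_left, neg_neg] at h
    exact shear_unique hp (hulm x) h (hσ0 x)
  set a : Punct → Fin 3 → ℝ := fun x => u x + τ x • m x + σ x • l x with ha_def
  have ha : Continuous a := (hu.add (hτ.smul hm)).add (hσ.smul hl)
  have aT : ∀ x, a (pT x) = a x := fun x => by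
    simp only [ha_def, uT, mT, lT, τT, σT]; module
  have aR : ∀ x, a (pR x) = -a x := fun x => by
    simp only [ha_def, uR, mR, lR, τR, σR]; module
  have hli : ∀ x, LinearIndependent ℝ ![a x, m x, l x] := fun x => by
    refine li_of_det ?_
    convert hdet' x using 1
    simp only [ha_def, frameDet, Matrix.det_fin_three, Matrix.of_apply, Matrix.cons_val,
      Pi.add_apply,
      Pi.smul_apply, smul_eq_mul]
    ring
  have h1 : ∀ x, V p (a x) (m x) (l x) = 0 := fun x => by
    rw [ha_def]; exact (V_shear_third p _ _ _ _).trans (hτ0 x)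
  have h2 : ∀ x, V p (a x) (l x) (m x) = 0 := fun x => by
    simp only [ha_def]
    rw [add_right_comm]
    exact (V_shear_third p _ _ _ _).trans (hσ0 x)
  clear_value a
  have hmla : ∀ x, LinearIndependent ℝ ![m x, l x, a x] := fun x => by
    convert (hli x).comp _ (finRotate 3).injective using 1
    ext i : 1; fin_cases i <;> rfl
  have hal : ∀ x, LinearIndependent ℝ ![a x, l x] := fun x => by
    convert (hli x).comp ![(0 : Fin 3), 2] (by decide) using 1
    ext i : 1; fin_cases i <;> rfl
  have ham : ∀ x, LinearIndependent ℝ ![a x, m x] := fun x => by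
    convert (hli x).comp ![(0 : Fin 3), 1] (by decide) using 1
    ext i : 1; fin_cases i <;> rfl
  have hF : Continuous fun x => (V p (m x) (l x) (a x), Ar p (a x) (l x), Ar p (a x) (m x)) := by
    refine (continuous_wint hp (isWeight_pw 0 1) ?_ hmla).prodMk
      ((continuous_wint hp (isWeight_pw 0 1) ?_ hal).prodMk
        (continuous_wint hp (isWeight_pw 0 1) ?_ ham)) <;>
    · refine continuous_pi fun i => ?_
      fin_cases i <;> assumption
  obtain ⟨x, hx⟩ := exists_zero_of_equivariant hF
    (fun x => by
      simp only [mT, lT, aT, spT, V_neg_mid, Ar_neg_right]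
      rw [V_comm])
    (fun x => by
      simp only [mR, lR, aR, spR, V_neg_mid, V_neg_right, Ar_neg_right, Ar_neg_left, neg_neg])
  simp only [Prod.mk_eq_zero] at hx
  exact ⟨a x, m x, l x, hli x, h1 x, h2 x, hx.1, hx.2.2, hx.2.1, hAml x⟩

end

section

/-! ### Balanced seminorms from vanishing pair weights -/

variable {n k : ℕ}

/-- The product of the signs of the coordinates in a finite set. -/
def sw (S : Finset (Fin k)) (η : Fin k → ℝ) : ℝ := ∏ i ∈ S, Real.sign (η i)

lemma isWeight_sw (S : Finset (Fin k)) : IsWeight (sw S) :=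
  ⟨Finset.measurable_prod _ fun i _ => measurable_sign.comp (measurable_pi_apply i), fun η => by
    rw [sw, Finset.abs_prod]
    exact Finset.prod_le_one (fun _ _ => abs_nonneg _) fun _ _ => abs_sign_le _⟩

lemma wint_sw_of_odd (p : Seminorm ℝ (Fin n → ℝ)) (a : Fin k → Fin n → ℝ) {S : Finset (Fin k)}
    (hS : Odd S.card) : wint p (sw S) a = 0 := by
  have h := integral_neg_eq_self (fun η => sw S η * Real.exp (-p (lin a η))) volume
  have h1 : ∀ η, sw S (-η) * Real.exp (-p (lin a (-η))) =
      -(sw S η * Real.exp (-p (lin a η))) := fun η => by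
    rw [map_neg, map_neg_eq_map, sw, sw]
    simp only [Pi.neg_apply, Real.sign_neg]
    rw [Finset.prod_neg, hS.neg_one_pow]
    ring
  simp only [h1] at h
  rw [integral_neg] at h
  rw [wint]
  linarith

lemma prod_one_add_sign {η : Fin k → ℝ} (hη : ∀ i, η i ≠ 0) :
    ∏ i, (1 + Real.sign (η i)) = 2 ^ k * (Set.Ici (0 : Fin k → ℝ)).indicator 1 η := by
  by_cases h : η ∈ Set.Ici (0 : Fin k → ℝ)
  · rw [Set.indicator_of_mem h, Pi.one_apply, mul_one]
    have : ∀ i, 1 + Real.sign (η i) = 2 := fun i => by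
      rw [Real.sign_of_pos (lt_of_le_of_ne (h i) (hη i).symm)]; norm_num
    simp [this]
  · rw [Set.indicator_of_notMem h, mul_zero]
    obtain ⟨i, hi⟩ : ∃ i, η i < 0 := by
      by_contra! h'; exact h h'
    refine Finset.prod_eq_zero (Finset.mem_univ i) ?_
    rw [Real.sign_of_neg hi]; norm_num

lemma integral_orthant {p : Seminorm ℝ (Fin n → ℝ)} (hp : IsDef p) {a : Fin k → Fin n → ℝ}
    (ha : LinearIndependent ℝ a) (hk : k ≤ 3) (h : ∀ i j, i ≠ j → wint p (pw i j) a = 0) :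
    2 ^ k * ∫ η in Set.Ici 0, Real.exp (-p (lin a η)) = ∫ η, Real.exp (-p (lin a η)) := by
  have hne : ∀ᵐ η : Fin k → ℝ, ∀ i, η i ≠ 0 := ae_all_iff.2 fun i => ae_coord_ne i
  have h1 : 2 ^ k * ∫ η in Set.Ici 0, Real.exp (-p (lin a η)) =
      ∫ η, (∏ i, (1 + Real.sign (η i))) * Real.exp (-p (lin a η)) := by
    rw [← integral_indicator measurableSet_Ici, ← integral_const_mul]
    refine integral_congr_ae (hne.mono fun η hη => ?_)
    simp only [prod_one_add_sign hη]
    by_cases h : η ∈ Set.Ici (0 : Fin k → ℝ) <;> simp [h]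
  rw [h1]
  simp only [Finset.prod_one_add, Finset.sum_mul, ← sw.eq_1]
  rw [integral_finsetSum _ fun S _ => integrable_weight_mul hp (isWeight_sw S) ha,
    Finset.sum_eq_single ∅]
  · simp [sw]
  · intro S _ hS
    change wint p (sw S) a = 0
    rcases Nat.even_or_odd S.card with he | ho
    · have hc : S.card ≤ 3 := (Finset.card_le_univ S).trans (by simpa using hk)
      have hpos : 0 < S.card := Finset.card_pos.2 (Finset.nonempty_iff_ne_empty.2 hS)
      obtain ⟨i, j, hij, rfl⟩ := Finset.card_eq_two.1 (show S.card = 2 by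
        obtain ⟨r, hr⟩ := he; omega)
      rw [← h i j hij]
      congr 1
      ext η
      rw [sw, Finset.prod_pair hij, pw]
    · exact wint_sw_of_odd p a ho
  · simp

lemma balanced_lin {p : Seminorm ℝ (Fin n → ℝ)} (hp : IsDef p) {a : Fin k → Fin n → ℝ}
    (ha : LinearIndependent ℝ a) (hk : k ≤ 3) (h : ∀ i j, i ≠ j → wint p (pw i j) a = 0) :
    Balanced (p.comp (lin a)) := fun ε hε => by
  have hε0 : ∀ l, ε l ≠ 0 := fun l => by rcases hε l with h | h <;> simp [h]
  have ha' : LinearIndependent ℝ fun l => ε l • a l :=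
    ha.units_smul fun l => Units.mk0 (ε l) (hε0 l)
  have h1 := integral_orthant hp ha' hk fun i j hij => by
    rw [wint_pw_sign p a hε, h i j hij, mul_zero]
  have h2 := integral_orthant hp ha hk h
  have e : ∀ η, lin (fun l => ε l • a l) η = lin a (ε * η) := fun η => by
    simp only [lin, Fintype.linearCombination_apply, Pi.mul_apply, smul_smul, mul_comm]
  simp only [e] at h1
  simp only [Seminorm.comp_apply]
  rw [h1]
  have hsq : ∀ l, ε l * ε l = 1 := fun l => by rcases hε l with h | h <;> simp [h]
  have hM : |(Matrix.diagonal ε).det| = 1 := by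
    have habs : ∀ l, |ε l| = 1 := fun l => by rcases hε l with h | h <;> simp [h]
    rw [Matrix.det_diagonal, Finset.abs_prod]; simp [habs]
  have h3 := wint_comp p (w := fun _ => 1) ⟨measurable_const, fun _ => by simp⟩ (a := a)
    (a' := fun l => ε l • a l) (Matrix.diagonal ε) (fun h => by rw [h] at hM; simp at hM)
    fun η => by
      simp only [lin, Fintype.linearCombination_apply, Matrix.mulVec_diagonal]
      refine Finset.sum_congr rfl fun l _ => ?_
      rw [smul_smul, mul_right_comm, hsq, one_mul]
  rw [hM, one_mul] at h3
  simpa [wint, e] using h3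

lemma lin_ins (a : Fin (k + 1) → Fin n → ℝ) (i : Fin (k + 1)) :
    lin a ∘ₗ ins i = lin fun j => a (i.succAbove j) := by
  refine LinearMap.ext fun η => ?_
  simp [lin, Fintype.linearCombination_apply, Fin.sum_univ_succAbove _ i]

lemma equi_lin {p : Seminorm ℝ (Fin n → ℝ)} (hp : IsDef p) {a : Fin (k + 1) → Fin n → ℝ}
    (ha : LinearIndependent ℝ a) (hk : k ≤ 2) (h : ∀ i j, i ≠ j → wint p (pw i j) a = 0)
    (h' : ∀ (i : Fin (k + 1)) j l, j ≠ l → wint p (pw j l) (fun j => a (i.succAbove j)) = 0) :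
    Equi (p.comp (lin a)) := by
  refine ⟨balanced_lin hp ha (by omega) h, fun i => ?_⟩
  have : (p.comp (lin a)).comp (ins i) = p.comp (lin fun j => a (i.succAbove j)) := by
    rw [← lin_ins]; rfl
  rw [this]
  exact balanced_lin hp (ha.comp _ Fin.succAbove_right_injective) (by omega) (h' i)

/-! ### Linear invariance of the volume product -/

lemma volume_product_lin (p : Seminorm ℝ (Fin n → ℝ)) {a : Fin n → Fin n → ℝ}
    (ha : LinearIndependent ℝ a) :
    volume.real (body (p.comp (lin a))) * volume.real (pol (p.comp (lin a))) =
      volume.real (body p) * volume.real (pol p) := by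
  set M : Matrix (Fin n) (Fin n) ℝ := (Matrix.of a).transpose with hM
  have hu : IsUnit M := by
    rw [hM, Matrix.isUnit_transpose]
    exact Matrix.linearIndependent_rows_iff_isUnit.1 ha
  have hud : IsUnit M.det := (Matrix.isUnit_iff_isUnit_det M).1 hu
  have hlin : lin a = Matrix.toLin' M := by
    refine LinearMap.ext fun η => ?_
    ext i
    simp [lin, Fintype.linearCombination_apply, hM, Matrix.mulVec, dotProduct, mul_comm]
  have hbody : body (p.comp (lin a)) = Matrix.toLin' M ⁻¹' body p := by
    rw [hlin]; rfl
  have hpol : pol (p.comp (lin a)) = Matrix.toLin' (M⁻¹).transpose ⁻¹' pol p := by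
    ext y
    simp only [pol, Set.mem_ofPred_eq, Set.mem_preimage, Seminorm.comp_apply, hlin,
      Matrix.toLin'_apply, Matrix.dotProduct_mulVec, Matrix.vecMul_transpose]
    refine ⟨fun h z => ?_, fun h x => ?_⟩
    · simpa [Matrix.mul_nonsing_inv M hud] using h (M⁻¹.mulVec z)
    · simpa [Matrix.nonsing_inv_mul M hud] using h (M.mulVec x)
  rw [hbody, hpol, measureReal_def, measureReal_def, Measure.addHaar_preimage_linearMap,
    Measure.addHaar_preimage_linearMap, LinearMap.det_toLin', LinearMap.det_toLin',
    Matrix.det_transpose M⁻¹, Matrix.det_nonsing_inv, ENNReal.toReal_mul, ENNReal.toReal_mul,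
    ENNReal.toReal_ofReal (abs_nonneg _), ENNReal.toReal_ofReal (abs_nonneg _),
    Ring.inverse_eq_inv', inv_inv, mul_mul_mul_comm, ← abs_mul, inv_mul_cancel₀ hud.ne_zero,
    abs_one, one_mul, measureReal_def, measureReal_def]
  · rw [LinearMap.det_toLin', Matrix.det_transpose]
    exact (Matrix.isUnit_nonsing_inv_det M hud).ne_zero
  · rw [LinearMap.det_toLin']; exact hud.ne_zero

lemma volume_product_ge_of_frame {p : Seminorm ℝ (Fin (n + 1) → ℝ)} (hp : IsDef p)
    {a : Fin (n + 1) → Fin (n + 1) → ℝ} (ha : LinearIndependent ℝ a) (hn : n ≤ 2)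
    (h : ∀ i j, i ≠ j → wint p (pw i j) a = 0)
    (h' : ∀ (i : Fin (n + 1)) j l, j ≠ l → wint p (pw j l) (fun j => a (i.succAbove j)) = 0) {m : ℝ}
    (hm : ∀ q : Seminorm ℝ (Fin n → ℝ), IsDef q → m ≤ volume.real (body q) * volume.real (pol q)) :
    4 * m / (n + 1) ≤ volume.real (body p) * volume.real (pol p) := by
  rw [← volume_product_lin p ha]
  exact (equi_lin hp ha hn h h').volume_product_ge (hp.lin ha) hm

/-! ### Dimensions zero to three -/

lemma pw_comm (i j : Fin k) : pw (k := k) i j = pw j i := funext fun _ => mul_comm _ _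

lemma volume_product_zero (q : Seminorm ℝ (Fin 0 → ℝ)) :
    1 ≤ volume.real (body q) * volume.real (pol q) := by
  have h0 : ∀ x, q x = 0 := fun x => by rw [Subsingleton.elim x 0, map_zero]
  have h1 : body q = Set.univ := by ext x; simp [body, h0]
  have h2 : pol q = Set.univ := by ext x; simp [pol, h0]
  simp [h1, h2, measureReal_def, volume_pi]

lemma volume_product_one (q : Seminorm ℝ (Fin 1 → ℝ)) (hq : IsDef q) :
    4 ≤ volume.real (body q) * volume.real (pol q) := by
  have h := volume_product_ge_of_frame hq (Pi.basisFun ℝ (Fin 1)).linearIndependent (by norm_num)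
    (fun i j hij => absurd (Fin.ext (by omega)) hij) (fun _ j => j.elim0)
    fun q _ => volume_product_zero q
  norm_num at h
  exact h

lemma volume_product_two (q : Seminorm ℝ (Fin 2 → ℝ)) (hq : IsDef q) :
    8 ≤ volume.real (body q) * volume.real (pol q) := by
  have hli : LinearIndependent ℝ ![![1, 0], (![0, 1] : Fin 2 → ℝ)] := by
    rw [LinearIndependent.pair_iff]
    intro s t h
    exact ⟨by simpa using congrFun h 0, by simpa using congrFun h 1⟩
  obtain ⟨τ, -, hτ⟩ := (isQuantile_ratio (k := 0)).exists_root (X := Unit) hq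
    (continuous_const (y := ![![1, 0], (![0, 1] : Fin 2 → ℝ)])) fun _ => hli
  have h0 : Ar q (![1, 0] + τ () • ![0, 1]) ![0, 1] = 0 := by rw [Ar_shear]; exact hτ ()
  have hli' : LinearIndependent ℝ ![![1, 0] + τ () • ![0, 1], (![0, 1] : Fin 2 → ℝ)] := by
    rw [LinearIndependent.pair_iff]
    intro s t h
    have h1 : s = 0 := by simpa using congrFun h 0
    exact ⟨h1, by simpa [h1] using congrFun h 1⟩
  have h := volume_product_ge_of_frame hq hli' (by norm_num)
    (fun i j hij => by
      fin_cases i <;> fin_cases j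
      · exact absurd rfl hij
      · exact h0
      · rw [pw_comm]; exact h0
      · exact absurd rfl hij) (fun _ i j hij => absurd (Subsingleton.elim i j) hij)
    volume_product_one
  norm_num at h
  exact h

theorem volume_product_three (p : Seminorm ℝ (Fin 3 → ℝ)) (hp : IsDef p) :
    32 / 3 ≤ volume.real (body p) * volume.real (pol p) := by
  obtain ⟨a, b, c, hli, h01, h02, h12, hab, hac, hbc⟩ := exists_frame hp
  have e01 : wint p (pw 0 1) ![a, b, c] = 0 := h01
  have e02 : wint p (pw 0 2) ![a, b, c] = 0 := by
    rw [← h02, V, show ![a, c, b] = fun i => ![a, b, c] (Equiv.swap 1 2 i) by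
      ext i : 1; fin_cases i <;> rfl, wint_perm]
    rfl
  have e12 : wint p (pw 1 2) ![a, b, c] = 0 := by
    rw [← h12, V, show ![b, c, a] = fun i => ![a, b, c] (finRotate 3 i) by
      ext i : 1; fin_cases i <;> rfl, wint_perm]
    rfl
  have hpair : ∀ f : Fin 2 → Fin 3 → ℝ, Ar p (f 0) (f 1) = 0 →
      ∀ i j : Fin 2, i ≠ j → wint p (pw i j) f = 0 := fun f hf i j hij => by
    have e : wint p (pw 0 1) f = 0 := by
      rw [← hf, Ar]; congr 1; ext i : 1; fin_cases i <;> rfl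
    fin_cases i <;> fin_cases j
    · exact absurd rfl hij
    · exact e
    · rw [pw_comm]; exact e
    · exact absurd rfl hij
  have h := volume_product_ge_of_frame hp hli le_rfl
    (fun i j hij => by
      fin_cases i <;> fin_cases j
      · exact absurd rfl hij
      · exact e01
      · exact e02
      · rw [pw_comm]; exact e01
      · exact absurd rfl hij
      · exact e12
      · rw [pw_comm]; exact e02
      · rw [pw_comm]; exact e12
      · exact absurd rfl hij)
    (fun i => by
      refine hpair _ ?_
      fin_cases i
      exacts [hbc, hac, hab]) volume_product_two
  norm_num at h
  exact h

end

section

/-! ### From convex bodies to seminorms -/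

variable {n : ℕ}

lemma mem_nhds_zero {K : Set (EuclideanSpace ℝ (Fin n))} (hK : IsConvexBody K) (hsym : K = -K) :
    K ∈ 𝓝 0 := by
  obtain ⟨x, hx⟩ := hK.nonempty_interior
  have hx' : -x ∈ interior K := by
    have h := (Homeomorph.neg (EuclideanSpace ℝ (Fin n))).preimage_interior K
    have h' : (Homeomorph.neg (EuclideanSpace ℝ (Fin n))) ⁻¹' K = K := hsym.symm
    rw [h'] at h
    rw [← h] at hx
    exact hx
  have h := hK.convex.interior hx hx' (by norm_num : (0 : ℝ) ≤ 1 / 2)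
    (by norm_num : (0 : ℝ) ≤ 1 / 2) (by norm_num)
  rw [smul_neg, add_neg_cancel] at h
  exact mem_interior_iff_mem_nhds.1 h

lemma exists_seminorm {K : Set (EuclideanSpace ℝ (Fin n))} (hK : IsConvexBody K)
    (hsym : K = -K) : ∃ g : Seminorm ℝ (EuclideanSpace ℝ (Fin n)), IsDef g ∧ {x | g x ≤ 1} = K := by
  have h0 := mem_nhds_zero hK hsym
  have hb : _root_.Balanced ℝ K := (balanced_iff_neg_mem hK.convex).2 fun x hx => by
    rw [hsym] at hx; exact hx
  refine ⟨gaugeSeminorm hb hK.convex (absorbent_nhds_zero h0), fun x hx => ?_, ?_⟩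
  · exact (gauge_eq_zero (absorbent_nhds_zero h0)
      (NormedSpace.isVonNBounded_of_isBounded ℝ hK.isCompact.isBounded)).1 hx
  · ext x
    exact (gauge_le_one_iff_mem_closure hK.convex h0).trans
      (by rw [hK.isCompact.isClosed.closure_eq])

lemma polarSet_eq {g : Seminorm ℝ (EuclideanSpace ℝ (Fin n))} (hg : IsDef g) :
    WithLp.toLp 2 ⁻¹' polarSet {x | g x ≤ 1} =
      pol (g.comp (WithLp.linearEquiv 2 ℝ (Fin n → ℝ)).symm.toLinearMap) := by
  ext y
  have hinner : ∀ x : Fin n → ℝ, ⟪WithLp.toLp 2 x, WithLp.toLp 2 y⟫_ℝ = x ⬝ᵥ y := fun x => by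
    simp [PiLp.inner_apply, dotProduct, mul_comm]
  constructor
  · intro h x
    change x ⬝ᵥ y ≤ g (WithLp.toLp 2 x)
    rcases (apply_nonneg g (WithLp.toLp 2 x)).eq_or_lt with h0 | h0
    · have hx : WithLp.toLp 2 x = 0 := hg _ h0.symm
      rw [← hinner, hx]; simp
    · have h1 := h ((g (WithLp.toLp 2 x))⁻¹ • WithLp.toLp 2 x) (by
        rw [Set.mem_ofPred_eq, map_smul_eq_mul, Real.norm_of_nonneg (inv_nonneg.2 h0.le),
          inv_mul_cancel₀ h0.ne'])
      rwa [real_inner_smul_left, hinner, inv_mul_le_one₀ h0] at h1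
  · intro h x hx
    exact (hinner _).trans_le ((h (WithLp.ofLp x)).trans hx)

end

end Mahler

/-- Mahler's conjecture in dimension three, symmetric case (Iriyeh–Shibata): every centrally
symmetric convex body `K ⊆ ℝ³` satisfies `vol(K)·vol(K*) ≥ 4³/3! = 32/3`. -/
theorem mahler_dim3_symmetric (K : Set (EuclideanSpace ℝ (Fin 3))) (hK : IsConvexBody K)
    (hsym : K = -K) :
    (32 / 3 : ℝ≥0∞) ≤ volume K * volume (polarSet K) := by
  obtain ⟨g, hg, rfl⟩ := Mahler.exists_seminorm hK hsym
  have hvol : ∀ S : Set (EuclideanSpace ℝ (Fin 3)), volume (WithLp.toLp 2 ⁻¹' S) = volume S :=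
    fun S => (EuclideanSpace.volume_preserving_symm_measurableEquiv_toLp
      (Fin 3)).symm.measure_preimage_equiv S
  have h := Mahler.volume_product_three
    (g.comp (WithLp.linearEquiv 2 ℝ (Fin 3 → ℝ)).symm.toLinearMap)
    (hg.comp (WithLp.linearEquiv 2 ℝ (Fin 3 → ℝ)).symm.injective)
  rw [← Mahler.polarSet_eq hg, measureReal_def, measureReal_def, hvol, ← ENNReal.toReal_mul] at h
  have hbody : volume (Mahler.body (g.comp (WithLp.linearEquiv 2 ℝ (Fin 3 → ℝ)).symm.toLinearMap)) =
      volume {x | g x ≤ 1} := hvol {x | g x ≤ 1}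
  rw [hbody] at h
  calc (32 / 3 : ℝ≥0∞) = ENNReal.ofReal (32 / 3) := by
        rw [ENNReal.ofReal_div_of_pos (by norm_num)]; norm_num
    _ ≤ _ := (ENNReal.ofReal_le_ofReal h).trans ENNReal.ofReal_toReal_le
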